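/- Let A_0, …, A_{k-1} be a finite collection of computably enumerable sets, none of which is K-trivial. Then there exists a computably enumerable set B such that B is Turing equivalent to the halting problem ∅′ and B <_K A_i for every i < k. -/

import Mathlib

open Part Filter

open scoped Classical

namespace KPaper

/-- Binary strings. -/
abbrev Str := List Bool

/-! ### Oracle (Turing) reducibility -/

/-- The functions `ℕ →. ℕ` that are partial recursive relative to an oracle `O : ℕ →. ℕ`.
This mirrors Mathlib's `Nat.Partrec`, with an extra base case for the oracle. -/
inductive RecursiveIn (O : ℕ →. ℕ) : (ℕ →. ℕ) → Prop
  | oracle : RecursiveIn O O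
  | zero : RecursiveIn O (pure 0)
  | succ : RecursiveIn O ↑Nat.succ
  | left : RecursiveIn O ↑fun n : ℕ => n.unpair.1
  | right : RecursiveIn O ↑fun n : ℕ => n.unpair.2
  | pair {f g} : RecursiveIn O f → RecursiveIn O g →
      RecursiveIn O fun n => Nat.pair <$> f n <*> g n
  | comp {f g} : RecursiveIn O f → RecursiveIn O g → RecursiveIn O fun n => g n >>= f
  | prec {f g} : RecursiveIn O f → RecursiveIn O g → RecursiveIn O (Nat.unpaired fun a n =>
      n.rec (f a) fun y IH => do let i ← IH; g (Nat.pair a (Nat.pair y i)))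
  | rfind {f} : RecursiveIn O f →
      RecursiveIn O fun a => Nat.rfind fun n => (fun m => m = 0) <$> f (Nat.pair a n)

/-- The characteristic (partial) function of a set of naturals, used as a Turing oracle. -/
noncomputable def chi (A : Set ℕ) : ℕ →. ℕ := fun n => Part.some (if n ∈ A then 1 else 0)

/-- The characteristic function of an infinite binary sequence, used as a Turing oracle. -/
def chiSeq (X : ℕ → Bool) : ℕ →. ℕ := fun n => Part.some (cond (X n) 1 0)

/-- `A` is Turing reducible to `B`. -/
noncomputable def TuringLeSet (A B : Set ℕ) : Prop := RecursiveIn (chi B) (chi A)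

/-- `A` is Turing equivalent to `B`. -/
noncomputable def TuringEquivSet (A B : Set ℕ) : Prop := TuringLeSet A B ∧ TuringLeSet B A

/-- Turing equivalence between a set and an infinite binary sequence. -/
noncomputable def TuringEquivSetSeq (A : Set ℕ) (X : ℕ → Bool) : Prop :=
  RecursiveIn (chiSeq X) (chi A) ∧ RecursiveIn (chi A) (chiSeq X)

/-- The halting problem `∅'`. -/
def haltingSet : Set ℕ := {n | ((Denumerable.ofNat Nat.Partrec.Code n).eval n).Dom}

/-- A set of naturals is computably enumerable iff it is the domain of a
partial computable function. -/
def CESet (A : Set ℕ) : Prop := ∃ f : ℕ →. ℕ, Nat.Partrec f ∧ ∀ n, n ∈ A ↔ (f n).Dom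

/-! ### Machines and Kolmogorov complexity -/

/-- A (plain) machine is a partial computable map from binary strings to binary strings. -/
def PlainMachine (M : Str →. Str) : Prop := Partrec M

/-- A prefix-free machine: a partial computable map on binary strings whose
domain is an antichain under the prefix relation. -/
def PFMachine (M : Str →. Str) : Prop :=
  Partrec M ∧ ∀ ρ₁ ρ₂ : Str, (M ρ₁).Dom → (M ρ₂).Dom → ρ₁ <+: ρ₂ → ρ₁ = ρ₂

/-- The Kolmogorov complexity of a string `σ` with respect to a machine `M`:
the least length of an `M`-description of `σ` (`⊤` if there is none). -/
noncomputable def KC (M : Str →. Str) (σ : Str) : ℕ∞ :=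
  ⨅ ρ : {ρ : Str // σ ∈ M ρ}, ((ρ : Str).length : ℕ∞)

/-- An optimal prefix-free machine: a prefix-free machine whose associated complexity
is minimal, up to an additive constant, among all prefix-free machines. -/
def OptimalPF (U : Str →. Str) : Prop :=
  PFMachine U ∧ ∀ M : Str →. Str, PFMachine M → ∃ c : ℕ, ∀ σ : Str, KC U σ ≤ KC M σ + c

/-- An optimal plain machine. -/
def OptimalPlain (V : Str →. Str) : Prop :=
  PlainMachine V ∧ ∀ M : Str →. Str, PlainMachine M → ∃ c : ℕ, ∀ σ : Str, KC V σ ≤ KC M σ + c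

/-! ### Initial segments -/

/-- The first `n` bits of the characteristic sequence of a set of naturals. -/
noncomputable def restrSet (A : Set ℕ) (n : ℕ) : Str :=
  (List.range n).map fun i => decide (i ∈ A)

/-- The first `n` bits of an infinite binary sequence. -/
def restrSeq (X : ℕ → Bool) (n : ℕ) : Str := (List.range n).map X

/-- The string `0^n`; `K(n)` is identified with `K(0^n)`. -/
def zeroStr (n : ℕ) : Str := List.replicate n false

/-! ### `≤_K`, `<_K`, `K`-triviality (and the `≤_C` analogues) -/

def KLeSet (U : Str →. Str) (A B : Set ℕ) : Prop :=
  ∃ c : ℕ, ∀ n, KC U (restrSet A n) ≤ KC U (restrSet B n) + c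

def KLtSet (U : Str →. Str) (A B : Set ℕ) : Prop := KLeSet U A B ∧ ¬ KLeSet U B A

def KTrivialSet (U : Str →. Str) (A : Set ℕ) : Prop :=
  ∃ c : ℕ, ∀ n, KC U (restrSet A n) ≤ KC U (zeroStr n) + c

def KLeSeq (U : Str →. Str) (X Y : ℕ → Bool) : Prop :=
  ∃ c : ℕ, ∀ n, KC U (restrSeq X n) ≤ KC U (restrSeq Y n) + c

def KLtSeq (U : Str →. Str) (X Y : ℕ → Bool) : Prop := KLeSeq U X Y ∧ ¬ KLeSeq U Y X

def KTrivialSeq (U : Str →. Str) (X : ℕ → Bool) : Prop :=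
  ∃ c : ℕ, ∀ n, KC U (restrSeq X n) ≤ KC U (zeroStr n) + c

/-! ### Computably enumerable reals -/

/-- The real number in `[0,1]` whose binary expansion is the sequence `X`. -/
noncomputable def realOfSeq (X : ℕ → Bool) : ℝ := ∑' i : ℕ, cond (X i) ((2 : ℝ) ^ (i + 1))⁻¹ 0

/-- `X` (identified with the real it is the binary expansion of) is a computably
enumerable real: it is the limit of a nondecreasing computable sequence of
(dyadic) rationals. -/
def CEReal (X : ℕ → Bool) : Prop :=
  ∃ f : ℕ → ℤ, Computable f ∧
    (∀ s, (f s : ℝ) / 2 ^ s ≤ (f (s + 1) : ℝ) / 2 ^ (s + 1)) ∧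
    Tendsto (fun s => (f s : ℝ) / 2 ^ s) atTop (nhds (realOfSeq X))

/-- The characteristic sequence of a set of naturals. -/
noncomputable def seqOfSet (A : Set ℕ) : ℕ → Bool := fun i => decide (i ∈ A)

/-! ### Solovay reducibility -/

/-- Solovay reducibility on c.e. reals: `X ≤_S Y` iff there are nondecreasing computable
rational approximations to `X` and `Y` and a constant `c` such that at each stage the
distance to `X` is bounded by `c` times the distance to `Y`. -/
def SolovayLe (X Y : ℕ → Bool) : Prop :=
  ∃ (c : ℕ) (f g : ℕ → ℤ), Computable f ∧ Computable g ∧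
    (∀ s, (f s : ℝ) / 2 ^ s ≤ (f (s + 1) : ℝ) / 2 ^ (s + 1)) ∧
    (∀ s, (g s : ℝ) / 2 ^ s ≤ (g (s + 1) : ℝ) / 2 ^ (s + 1)) ∧
    Tendsto (fun s => (f s : ℝ) / 2 ^ s) atTop (nhds (realOfSeq X)) ∧
    Tendsto (fun s => (g s : ℝ) / 2 ^ s) atTop (nhds (realOfSeq Y)) ∧
    ∀ s, realOfSeq X - (f s : ℝ) / 2 ^ s ≤ (c : ℝ) * (realOfSeq Y - (g s : ℝ) / 2 ^ s)


section
/-! ### Kraft inequality -/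

theorem kraft_pf (S : Finset Str) (h : ∀ x ∈ S, ∀ y ∈ S, x <+: y → x = y) :
    ∑ w ∈ S, (1 / 2 : ℝ) ^ w.length ≤ 1 := by
  by_cases h0 : ([] : Str) ∈ S
  · have : S = {[]} := by
      ext y
      simp only [Finset.mem_singleton]
      constructor
      · intro hy
        exact (h [] h0 y hy (List.nil_prefix)).symm
      · rintro rfl; exact h0
    rw [this]; simp
  · have hud : InformationTheory.UniquelyDecodable (S : Set (List Bool)) := by
      intro L₁
      induction L₁ with
      | nil =>
        intro L₂ _ h2 he
        cases L₂ with
        | nil => rfl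
        | cons a L =>
          simp at he
          have := h2 a (by simp)
          rw [he.1] at this
          exact absurd this h0
      | cons a L ih =>
        intro L₂ h1 h2 he
        cases L₂ with
        | nil =>
          simp at he
          have := h1 a (by simp)
          rw [he.1] at this
          exact absurd this h0
        | cons b L' =>
          simp only [List.flatten_cons] at he
          have ha : a ∈ S := h1 a (by simp)
          have hb : b ∈ S := h2 b (by simp)
          have hab : a = b := by
            rcases List.prefix_or_prefix_of_prefix (l₁ := a) (l₂ := b) (l₃ := a ++ L.flatten)
              (List.prefix_append _ _) (he ▸ List.prefix_append _ _) with h3 | h3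
            · exact h a ha b hb h3
            · exact (h b hb a ha h3).symm
          subst hab
          have := List.append_cancel_left he
          rw [ih L' (fun w hw => h1 w (by simp [hw])) (fun w hw => h2 w (by simp [hw])) this]
    have := InformationTheory.kraft_mcmillan_inequality hud
    simpa using this

/-! ### Kraft–Chaitin theorem (lossy form) -/

/-- weight of a request -/
noncomputable def rwt (x : Option (ℕ × Str)) : ℝ :=
  match x with
  | Option.some (l, _) => (1 / 2 : ℝ) ^ l
  | Option.none => 0

theorem rwt_nonneg (x) : 0 ≤ rwt x := by
  unfold rwt; split <;> positivity

/-- value of a binary string -/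
def bval (τ : Str) : ℕ := τ.foldl (fun v b => 2 * v + cond b 1 0) 0

theorem bval_append (τ υ : Str) : bval (τ ++ υ) = 2 ^ υ.length * bval τ + bval υ := by
  induction υ using List.reverseRecOn with
  | nil => simp [bval]
  | append_singleton l b ih =>
    have h1 : bval (τ ++ (l ++ [b])) = 2 * bval (τ ++ l) + cond b 1 0 := by
      simp [bval, List.foldl_append]
    have h2 : bval (l ++ [b]) = 2 * bval l + cond b 1 0 := by
      simp [bval, List.foldl_append]
    rw [h1, h2, ih]; simp [pow_succ]; ring

theorem bval_lt (τ : Str) : bval τ < 2 ^ τ.length := by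
  induction τ using List.reverseRecOn with
  | nil => simp [bval]
  | append_singleton l b ih =>
    have h2 : bval (l ++ [b]) = 2 * bval l + cond b 1 0 := by
      simp [bval, List.foldl_append]
    rw [h2]; simp [pow_succ]; cases b <;> simp <;> omega

theorem exists_bval (n : ℕ) : ∀ q < 2 ^ n, ∃ τ : Str, τ.length = n ∧ bval τ = q := by
  induction n with
  | zero => intro q hq; exact ⟨[], rfl, by simp at hq; simp [bval, hq]⟩
  | succ n ih =>
    intro q hq
    obtain ⟨τ, h1, h2⟩ := ih (q / 2) (by rw [pow_succ] at hq; omega)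
    refine ⟨τ ++ [decide (q % 2 = 1)], by simp [h1], ?_⟩
    have : bval (τ ++ [decide (q % 2 = 1)]) = 2 * bval τ + cond (decide (q % 2 = 1)) 1 0 := by
      simp [bval, List.foldl_append]
    rw [this, h2]
    rcases Nat.mod_two_eq_zero_or_one q with h | h <;> simp [h] <;> omega

/-- running (exponent, numerator) for the partial sums of the weights of requests -/
def kcst (r : ℕ → Option (ℕ × Str)) (t : ℕ) : ℕ × ℕ :=
  Nat.rec (0, 0) (fun t EX =>
    Option.casesOn (r t) EX (fun x => (EX.1 + x.1, EX.2 * 2 ^ x.1 + 2 ^ EX.1))) t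

theorem primrec_pow2 : Primrec (fun n : ℕ => 2 ^ n) := by
  refine (Primrec.nat_rec' (f := fun n : ℕ => n) (g := fun _ => 1) (h := fun _ p => 2 * p.2)
    Primrec.id (Primrec.const 1) ?_).of_eq ?_
  · exact (Primrec.nat_mul.comp (Primrec.const 2) (Primrec.snd.comp Primrec.snd)).to₂
  · intro n
    induction n with
    | zero => rfl
    | succ n ih => simp only [pow_succ]; rw [← ih]; ring

theorem kcst_comp {r : ℕ → Option (ℕ × Str)} (hr : Computable r) : Computable (kcst r) := by
  unfold kcst
  refine Computable.nat_rec (f := fun t : ℕ => t) (g := fun _ => ((0, 0) : ℕ × ℕ))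
    (h := fun _ (p : ℕ × (ℕ × ℕ)) => Option.casesOn (r p.1) p.2
      (fun x => (p.2.1 + x.1, p.2.2 * 2 ^ x.1 + 2 ^ p.2.1))) Computable.id (Computable.const _) ?_
  refine Computable.option_casesOn (hr.comp (Computable.fst.comp Computable.snd))
    (Computable.snd.comp Computable.snd) ?_
  have : Primrec (fun q : (ℕ × (ℕ × (ℕ × ℕ))) × (ℕ × Str) =>
      (q.1.2.2.1 + q.2.1, q.1.2.2.2 * 2 ^ q.2.1 + 2 ^ q.1.2.2.1)) := by
    have a1 : Primrec (fun q : (ℕ × (ℕ × (ℕ × ℕ))) × (ℕ × Str) => q.1.2.2.1) :=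
      Primrec.fst.comp (Primrec.snd.comp (Primrec.snd.comp Primrec.fst))
    have a2 : Primrec (fun q : (ℕ × (ℕ × (ℕ × ℕ))) × (ℕ × Str) => q.1.2.2.2) :=
      Primrec.snd.comp (Primrec.snd.comp (Primrec.snd.comp Primrec.fst))
    have a3 : Primrec (fun q : (ℕ × (ℕ × (ℕ × ℕ))) × (ℕ × Str) => q.2.1) :=
      Primrec.fst.comp Primrec.snd
    exact Primrec.pair (Primrec.nat_add.comp a1 a3)
      (Primrec.nat_add.comp (Primrec.nat_mul.comp a2 (primrec_pow2.comp a3)) (primrec_pow2.comp a1))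
  exact this.to_comp

theorem kcst_spec (r : ℕ → Option (ℕ × Str)) (t : ℕ) :
    ((kcst r t).2 : ℝ) / 2 ^ (kcst r t).1 = ∑ s ∈ Finset.range t, rwt (r s) := by
  induction t with
  | zero => simp [kcst]
  | succ t ih =>
    rw [Finset.sum_range_succ, ← ih]
    have : kcst r (t + 1) = Option.casesOn (r t) (kcst r t)
      (fun x => ((kcst r t).1 + x.1, (kcst r t).2 * 2 ^ x.1 + 2 ^ (kcst r t).1)) := rfl
    rw [this]
    rcases r t with _ | ⟨l, ρ⟩
    · simp [rwt]
    · simp only [rwt, one_div, inv_pow]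
      push_cast
      rw [pow_add]
      field_simp

/-- test that `τ` is the code word for request `t` -/
def kctest (r : ℕ → Option (ℕ × Str)) (τ : Str) (t : ℕ) : Option Str :=
  (r t).bind fun x =>
    if τ.length = x.1 + 1 ∧ (kcst r t).2 * 2 ^ (x.1 + 1) ≤ bval τ * 2 ^ (kcst r t).1 ∧
      bval τ * 2 ^ (kcst r t).1 < (kcst r t).2 * 2 ^ (x.1 + 1) + 2 ^ (kcst r t).1
    then Option.some x.2 else Option.none

theorem bval_prim : Primrec bval := by
  unfold bval
  refine Primrec.list_foldl (α := Str) (β := Bool) (σ := ℕ) (f := fun τ => τ) (g := fun _ => 0)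
    (h := fun _ p => 2 * p.1 + cond p.2 1 0) Primrec.id (Primrec.const 0) ?_
  have : Primrec (fun q : Str × (ℕ × Bool) => 2 * q.2.1 + cond q.2.2 1 0) :=
    Primrec.nat_add.comp (Primrec.nat_mul.comp (Primrec.const 2) (Primrec.fst.comp Primrec.snd))
      (Primrec.cond (Primrec.snd.comp Primrec.snd) (Primrec.const 1) (Primrec.const 0))
  exact this.to₂

theorem kctest_comp {r : ℕ → Option (ℕ × Str)} (hr : Computable r) : Computable₂ (kctest r) := by
  unfold kctest
  refine Computable.option_bind (hr.comp Computable.snd) ?_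
  have hp : Primrec (fun q : (ℕ × ℕ) × (Str × (ℕ × Str)) =>
      if q.2.1.length = q.2.2.1 + 1 ∧ q.1.2 * 2 ^ (q.2.2.1 + 1) ≤ bval q.2.1 * 2 ^ q.1.1 ∧
        bval q.2.1 * 2 ^ q.1.1 < q.1.2 * 2 ^ (q.2.2.1 + 1) + 2 ^ q.1.1
      then Option.some q.2.2.2 else Option.none) := by
    have bv : Primrec (fun q : (ℕ × ℕ) × (Str × (ℕ × Str)) => bval q.2.1) :=
      bval_prim.comp (Primrec.fst.comp Primrec.snd)
    have ln : Primrec (fun q : (ℕ × ℕ) × (Str × (ℕ × Str)) => q.2.1.length) :=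
      Primrec.list_length.comp (Primrec.fst.comp Primrec.snd)
    have x1 : Primrec (fun q : (ℕ × ℕ) × (Str × (ℕ × Str)) => q.2.2.1 + 1) :=
      Primrec.succ.comp (Primrec.fst.comp (Primrec.snd.comp Primrec.snd))
    have e1 : Primrec (fun q : (ℕ × ℕ) × (Str × (ℕ × Str)) => q.1.1) :=
      (Primrec.fst.comp Primrec.fst)
    have e2 : Primrec (fun q : (ℕ × ℕ) × (Str × (ℕ × Str)) => q.1.2) :=
      (Primrec.snd.comp Primrec.fst)
    have m1 := Primrec.nat_mul.comp e2 (primrec_pow2.comp x1)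
    have m2 := Primrec.nat_mul.comp bv (primrec_pow2.comp e1)
    have m3 := Primrec.nat_add.comp m1 (primrec_pow2.comp e1)
    refine Primrec.ite ?_ (Primrec.option_some.comp
      (Primrec.snd.comp (Primrec.snd.comp Primrec.snd))) (Primrec.const Option.none)
    refine PrimrecPred.and (Primrec.eq.comp ln x1) (PrimrecPred.and ?_ ?_)
    · exact Primrec.nat_le.comp m1 m2
    · exact Primrec.nat_lt.comp m2 m3
  have h2 : Computable (fun q : (Str × ℕ) × (ℕ × Str) => (kcst r q.1.2, (q.1.1, q.2))) :=
    Computable.pair ((kcst_comp hr).comp (Computable.snd.comp Computable.fst))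
      (Computable.pair (Computable.fst.comp Computable.fst) Computable.snd)
  exact (hp.to_comp.comp h2).of_eq fun q => by
    dsimp only

/-- real interpretation of the test -/
theorem kctest_mem {r : ℕ → Option (ℕ × Str)} {τ : Str} {t : ℕ} {ρ : Str}
    (h : kctest r τ t = Option.some ρ) : ∃ l, r t = Option.some (l, ρ) ∧ τ.length = l + 1 ∧
      (∑ s ∈ Finset.range t, rwt (r s)) ≤ bval τ * (1 / 2 : ℝ) ^ (l + 1) ∧
      (bval τ + 1) * (1 / 2 : ℝ) ^ (l + 1) ≤ ∑ s ∈ Finset.range (t + 1), rwt (r s) := by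
  unfold kctest at h
  rcases hr : r t with _ | ⟨l, ρ'⟩
  · simp [hr] at h
  · simp only [hr, Option.bind_some] at h
    split_ifs at h with hc
    obtain ⟨h1, h2, h3⟩ := hc
    simp only [Option.some.injEq] at h
    subst h
    refine ⟨l, rfl, h1, ?_⟩
    rw [Finset.sum_range_succ, ← kcst_spec, hr]
    set E := (kcst r t).1
    set X := (kcst r t).2
    have h2' : (X : ℝ) * 2 ^ (l + 1) ≤ bval τ * 2 ^ E := by exact_mod_cast h2
    have h3' : (bval τ : ℝ) * 2 ^ E + 1 ≤ X * 2 ^ (l + 1) + 2 ^ E := by exact_mod_cast h3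
    simp only [rwt, one_div, inv_pow]
    constructor
    · rw [← div_eq_mul_inv, div_le_div_iff₀ (by positivity) (by positivity)]; exact h2'
    · rw [← div_eq_mul_inv, div_le_iff₀ (by positivity)]
      have : (X / 2 ^ E + (2 ^ l)⁻¹) * 2 ^ (l + 1) = (X * 2 ^ (l + 1)) / 2 ^ E + (2 : ℝ) := by
        rw [pow_succ]; field_simp
      rw [this]
      have h5 : (bval τ : ℝ) ≤ (X * 2 ^ (l + 1)) / 2 ^ E + 1 := by
        rw [div_add_one (by positivity), le_div_iff₀ (by positivity)]; linarith
      linarith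

theorem kctest_exists {r : ℕ → Option (ℕ × Str)} {t : ℕ} {l : ℕ} {ρ : Str}
    (hs : ∑ s ∈ Finset.range (t + 1), rwt (r s) ≤ 1) (h : r t = Option.some (l, ρ)) :
    ∃ τ : Str, τ.length = l + 1 ∧ kctest r τ t = Option.some ρ := by
  set E := (kcst r t).1 with hE
  set X := (kcst r t).2 with hX
  have hq : (X * 2 ^ (l + 1) + (2 ^ E - 1)) / 2 ^ E * 2 ^ E ≤ X * 2 ^ (l + 1) + (2 ^ E - 1) :=
    Nat.div_mul_le_self _ _
  have hp : 0 < 2 ^ E := by positivity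
  have hq2 := Nat.lt_div_mul_add (a := X * 2 ^ (l + 1) + (2 ^ E - 1)) hp
  set q := (X * 2 ^ (l + 1) + (2 ^ E - 1)) / 2 ^ E
  have hlt : q < 2 ^ (l + 1) := by
    rw [Finset.sum_range_succ, ← kcst_spec, h, ← hE, ← hX] at hs
    simp only [rwt, one_div, inv_pow] at hs
    have h6 : (X : ℝ) * 2 ^ (l + 1) + 2 * 2 ^ E ≤ 2 ^ (l + 1) * 2 ^ E := by
      have := mul_le_mul_of_nonneg_right hs (show (0 : ℝ) ≤ 2 ^ (l + 1) * 2 ^ E by positivity)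
      have h7 : ((X : ℝ) / 2 ^ E + (2 ^ l)⁻¹) * (2 ^ (l + 1) * 2 ^ E)
        = X * 2 ^ (l + 1) + 2 * 2 ^ E := by rw [pow_succ]; field_simp
      linarith
    have h8 : X * 2 ^ (l + 1) + 2 * 2 ^ E ≤ 2 ^ (l + 1) * 2 ^ E := by exact_mod_cast h6
    have : q * 2 ^ E < 2 ^ (l + 1) * 2 ^ E := by omega
    exact lt_of_mul_lt_mul_right this (by positivity)
  obtain ⟨τ, h1, h2⟩ := exists_bval (l + 1) q hlt
  refine ⟨τ, h1, ?_⟩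
  unfold kctest
  rw [h]
  simp only [Option.bind_some]
  rw [if_pos]
  refine ⟨h1, ?_, ?_⟩
  · rw [h2]; simp only [← hE, ← hX]; omega
  · rw [h2]; simp only [← hE, ← hX]; omega

theorem kc_sep {r : ℕ → Option (ℕ × Str)} {τ₁ τ₂ : Str} {t₁ t₂ : ℕ} {ρ₁ ρ₂ : Str}
    (h1 : kctest r τ₁ t₁ = Option.some ρ₁) (h2 : kctest r τ₂ t₂ = Option.some ρ₂) (hp : τ₁ <+: τ₂) :
    t₁ = t₂ := by
  obtain ⟨l₁, _, a2, a3, a4⟩ := kctest_mem h1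
  obtain ⟨l₂, _, b2, b3, b4⟩ := kctest_mem h2
  obtain ⟨υ, rfl⟩ := hp
  have hb : (bval (τ₁ ++ υ) : ℝ) = 2 ^ υ.length * bval τ₁ + bval υ := by
    exact_mod_cast bval_append τ₁ υ
  have hl : (bval υ : ℝ) + 1 ≤ 2 ^ υ.length := by exact_mod_cast bval_lt υ
  have hl0 : (0 : ℝ) ≤ bval υ := by positivity
  have hlen : l₂ + 1 = (l₁ + 1) + υ.length := by rw [← b2, ← a2]; simp
  have e1 : (1 / 2 : ℝ) ^ (l₁ + 1) = 2 ^ υ.length * (1 / 2) ^ (l₂ + 1) := by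
    rw [hlen, pow_add]
    have : (2 : ℝ) ^ υ.length * (1 / 2) ^ υ.length = 1 := by rw [← mul_pow]; norm_num
    linear_combination (-(1 / 2 : ℝ) ^ (l₁ + 1)) * this
  have hpos : (0 : ℝ) < (1 / 2) ^ (l₂ + 1) := by positivity
  have mono : ∀ a b, a ≤ b → ∑ s ∈ Finset.range a, rwt (r s) ≤ ∑ s ∈ Finset.range b, rwt (r s) :=
    fun a b hab => Finset.sum_le_sum_of_subset_of_nonneg (Finset.range_mono hab)
      (fun _ _ _ => rwt_nonneg _)
  rw [hb] at b3 b4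
  rw [e1] at a3 a4
  rcases lt_trichotomy t₁ t₂ with h | h | h
  · have := mono (t₁ + 1) t₂ h
    nlinarith
  · exact h
  · have := mono (t₂ + 1) t₁ h
    nlinarith

theorem KC_le_of_mem {M : Str →. Str} {σ τ : Str} (h : σ ∈ M τ) : KC M σ ≤ τ.length :=
  iInf_le (fun ρ : {ρ : Str // σ ∈ M ρ} => ((ρ : Str).length : ℕ∞)) ⟨τ, h⟩

theorem kc_theorem {U : Str →. Str} (hU : OptimalPF U) {r : ℕ → Option (ℕ × Str)}
    (hr : Computable r) (hs : ∀ N, ∑ s ∈ Finset.range N, rwt (r s) ≤ 1) :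
    ∃ c : ℕ, ∀ t l ρ, r t = Option.some (l, ρ) → KC U ρ ≤ ((l + c : ℕ) : ℕ∞) := by
  let M : Str →. Str := fun τ => Nat.rfindOpt (kctest r τ)
  have hM : PFMachine M := by
    refine ⟨Partrec.rfindOpt (kctest_comp hr), ?_⟩
    intro τ₁ τ₂ d1 d2 hp
    obtain ⟨t₁, ρ₁, h1⟩ := Nat.rfindOpt_dom.1 d1
    obtain ⟨t₂, ρ₂, h2⟩ := Nat.rfindOpt_dom.1 d2
    have := kc_sep h1 h2 hp
    subst this
    obtain ⟨l₁, a1, a2, _⟩ := kctest_mem h1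
    obtain ⟨l₂, b1, b2, _⟩ := kctest_mem h2
    rw [a1] at b1
    simp only [Option.some.injEq, Prod.mk.injEq] at b1
    exact hp.eq_of_length (by rw [a2, b2, b1.1])
  obtain ⟨c, hc⟩ := hU.2 M hM
  refine ⟨1 + c, fun t l ρ h => ?_⟩
  obtain ⟨τ, h1, h2⟩ := kctest_exists (hs (t + 1)) h
  have hmem : ρ ∈ M τ := by
    have hd : (M τ).Dom := Nat.rfindOpt_dom.2 ⟨t, ρ, h2⟩
    obtain ⟨t', h3⟩ := Nat.rfindOpt_spec (Part.get_mem hd)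
    have := kc_sep h3 h2 (List.prefix_refl _)
    subst this
    have h4 : (M τ).get hd = ρ := by
      have h5 : kctest r τ t' = Option.some ((M τ).get hd) := h3
      rw [h2] at h5
      simpa using h5.symm
    rw [← h4]
    exact Part.get_mem hd
  calc KC U ρ ≤ KC M ρ + c := hc ρ
    _ ≤ (τ.length : ℕ∞) + c := by gcongr; exact KC_le_of_mem hmem
    _ = ((l + (1 + c) : ℕ) : ℕ∞) := by rw [h1]; push_cast; ring

/-- two-index version -/
theorem kc_theorem₂ {U : Str →. Str} (hU : OptimalPF U) {R : ℕ → ℕ → Option (ℕ × Str)}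
    (hr : Computable₂ R)
    (hs : ∀ N, ∑ s ∈ Finset.range N, ∑ a ∈ Finset.range N, rwt (R s a) ≤ 1) :
    ∃ c : ℕ, ∀ s a l ρ, R s a = Option.some (l, ρ) → KC U ρ ≤ ((l + c : ℕ) : ℕ∞) := by
  obtain ⟨c, hc⟩ := kc_theorem hU (r := fun n => R n.unpair.1 n.unpair.2)
    (hr.comp (Computable.fst.comp Computable.unpair) (Computable.snd.comp Computable.unpair)) (by
      intro N
      refine le_trans ?_ (hs N)
      rw [← Finset.sum_product']
      rw [← Finset.sum_image (s := Finset.range N) (g := Nat.unpair)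
        (f := fun p => rwt (R p.1 p.2))]
      · refine Finset.sum_le_sum_of_subset_of_nonneg ?_ (fun _ _ _ => rwt_nonneg _)
        intro p hp
        simp only [Finset.mem_image, Finset.mem_range, Finset.mem_product] at hp ⊢
        obtain ⟨n, hn, rfl⟩ := hp
        exact ⟨(Nat.unpair_left_le n).trans_lt hn, (Nat.unpair_right_le n).trans_lt hn⟩
      · intro x _ y _ hxy
        have := congrArg (fun p : ℕ × ℕ => Nat.pair p.1 p.2) hxy
        simpa using this)
  refine ⟨c, fun s a l ρ h => hc (Nat.pair s a) l ρ (by simpa using h)⟩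

end

section
/-! ### The construction -/

/-- The stage-wise approximations the construction works with. -/
structure Env where
  /-- `D s a`: the length and output of the description with code `a`, seen by stage `s` -/
  D : ℕ → ℕ → Option (ℕ × Str)
  /-- `AS i s x`: has `x` entered the `i`-th set by stage `s`? -/
  AS : ℕ → ℕ → ℕ → Bool
  /-- halting problem approximation -/
  HS : ℕ → ℕ → Bool
  /-- number of sets -/
  k : ℕ
  /-- a constant -/
  C : ℕ

/-- log entries `(i, t, b)` : at stage `t` the descriptions of numbers `≤ b` were treated for `i` -/
abbrev LogE := ℕ × ℕ × ℕ
/-- levels `(p, r, marker, coding flag, log)` -/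
abbrev Lev := ℕ × ℕ × ℕ × Bool × List LogE
/-- states: the enumerated part of `B` and the list of levels -/
abbrev Sta := List ℕ × List Lev

/-- marker of a level -/
def Lev.mk' (L : Lev) : ℕ := L.2.2.1

def resA (E : Env) (i s n : ℕ) : Str := (List.range n).map (E.AS i s)

def resB (B : List ℕ) (n : ℕ) : Str := (List.range n).map (fun x => B.any (fun y => decide (y = x)))

def curB (E : Env) (i s x a : ℕ) : Bool :=
  (E.D s a).elim false
    (fun v => decide (v.2 = resA E i s v.2.length) && decide (x < v.2.length))

def untB (E : Env) (i s : ℕ) (log : List LogE) (b a : ℕ) : Bool :=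
  (E.D s a).elim false
    (fun v => decide (v.2 = List.replicate v.2.length false) && decide (v.2.length ≤ b) &&
      !(log.any fun e => decide (e.1 = i) && (E.D e.2.1 a).isSome && decide (v.2.length ≤ e.2.2) &&
        decide (resA E i e.2.1 v.2.length = resA E i s v.2.length)))

def wt (E : Env) (s a : ℕ) : ℕ := (E.D s a).elim 0 (fun v => 2 ^ (s - v.1))

def Qm (E : Env) (i s x : ℕ) : ℕ := ∑ a ∈ Finset.range s, bif curB E i s x a then wt E s a else 0

def Vm (E : Env) (i s : ℕ) (log : List LogE) (b : ℕ) : ℕ :=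
  ∑ a ∈ Finset.range s, bif untB E i s log b a then wt E s a else 0

def base (log : List LogE) (i : ℕ) : ℕ :=
  log.foldr (fun e acc => bif decide (e.1 = i) then e.2.1 else acc) 0

/-- least triggered index (or `k`) -/
def trigI (E : Env) (s : ℕ) (L : Lev) : ℕ :=
  (List.range E.k).findIdx (fun i => decide (2 ^ s < Qm E i s L.2.2.1 * 2 ^ (L.1 + L.2.1)))

def codB (E : Env) (s e : ℕ) (L : Lev) : Bool := E.HS s e && !L.2.2.2.1

def RB (E : Env) (s : ℕ) (B : List ℕ) (e : ℕ) (L : Lev) : Bool :=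
  decide (e.unpair.1 < E.k) &&
  (List.range s).all (fun a => (E.D s a).elim true (fun v =>
    !(decide (v.2.length ≤ L.2.2.1) && decide (v.2 = resB B v.2.length)) ||
    (List.range s).any (fun a' => (E.D s a').elim false (fun v' =>
      decide (v'.2 = resA E e.unpair.1 s v.2.length) && decide (v'.1 ≤ v.1 + e.unpair.2)))))

def viol (E : Env) (s : ℕ) (B : List ℕ) (e : ℕ) (L : Lev) : Bool :=
  decide (trigI E s L < E.k) || (codB E s e L || RB E s B e L)

/-- is the trigger answered by a reset? -/
def trtB (E : Env) (s : ℕ) (L : Lev) : Bool :=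
  decide (Vm E (trigI E s L) s L.2.2.2.2 (base L.2.2.2.2 (trigI E s L)) <
    Qm E (trigI E s L) s (base L.2.2.2.2 (trigI E s L)) * 2 ^ L.1)

def upd (E : Env) (s e : ℕ) (L : Lev) : Lev :=
  bif decide (trigI E s L < E.k) then
    bif trtB E s L then
      (L.1, L.2.1 + 1, s, E.HS s e,
        (trigI E s L, s, base L.2.2.2.2 (trigI E s L)) :: L.2.2.2.2)
    else (L.1, L.2.1, s, E.HS s e, L.2.2.2.2)
  else (L.1, L.2.1 + 1, s, E.HS s e, L.2.2.2.2)

def newp (E : Env) (Ls : List Lev) : ℕ :=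
  Ls.getLast?.elim E.C (fun L => L.1 + L.2.1 + E.C)

def mvIdx (E : Env) (s : ℕ) (S : Sta) : ℕ :=
  (List.range S.2.length).findIdx (fun e => viol E s S.1 e (S.2.getD e default))

def step (E : Env) (s : ℕ) (S : Sta) : Sta :=
  bif decide (mvIdx E s S < S.2.length) then
    ((S.2.getD (mvIdx E s S) default).2.2.1 :: S.1,
      S.2.take (mvIdx E s S) ++ [upd E s (mvIdx E s S) (S.2.getD (mvIdx E s S) default)])
  else
    (S.1, S.2 ++ [(newp E S.2, 0, s, E.HS s S.2.length, [])])

def St (E : Env) (t : ℕ) : Sta := Nat.rec ([], []) (fun t S => step E t S) t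

theorem St_succ (E : Env) (t : ℕ) : St E (t + 1) = step E t (St E t) := rfl

def lev (E : Env) (t e : ℕ) : Lev := (St E t).2.getD e default
def len (E : Env) (t : ℕ) : ℕ := (St E t).2.length
def mv (E : Env) (t : ℕ) : ℕ := mvIdx E t (St E t)
def Bs (E : Env) (t : ℕ) : List ℕ := (St E t).1
/-- marker of level `e` at stage `t` -/
def mk (E : Env) (t e : ℕ) : ℕ := (lev E t e).2.2.1
def lg (E : Env) (t e : ℕ) : List LogE := (lev E t e).2.2.2.2

variable {E : Env}

theorem mv_le (t : ℕ) : mv E t ≤ len E t := by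
  unfold mv mvIdx len
  exact (List.findIdx_le_length).trans (by simp)

theorem step_eq (t : ℕ) : ∃ x : Lev, (St E (t + 1)).2 = (St E t).2.take (mv E t) ++ [x] ∧
    x.2.2.1 = t ∧ x.2.2.2.1 = E.HS t (mv E t) ∧
    (mv E t < len E t → x = upd E t (mv E t) (lev E t (mv E t)) ∧ Bs E (t + 1) = mk E t (mv E t) :: Bs E t) ∧
    (mv E t = len E t → x = (newp E (St E t).2, 0, t, E.HS t (mv E t), []) ∧ Bs E (t + 1) = Bs E t) := by
  by_cases h : mv E t < len E t
  · refine ⟨upd E t (mv E t) (lev E t (mv E t)), ?_, ?_, ?_, fun _ => ⟨rfl, ?_⟩, fun h' => absurd h' h.ne⟩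
    · rw [St_succ, step]
      rw [show decide (mvIdx E t (St E t) < (St E t).2.length) = true from decide_eq_true h]
      rfl
    · unfold upd; cases decide (trigI E t (lev E t (mv E t)) < E.k) <;>
        cases trtB E t (lev E t (mv E t)) <;> rfl
    · unfold upd; cases decide (trigI E t (lev E t (mv E t)) < E.k) <;>
        cases trtB E t (lev E t (mv E t)) <;> rfl
    · rw [Bs, St_succ, step]
      rw [show decide (mvIdx E t (St E t) < (St E t).2.length) = true from decide_eq_true h]
      rfl
  · have he : mv E t = len E t := le_antisymm (mv_le t) (not_lt.1 h)
    refine ⟨(newp E (St E t).2, 0, t, E.HS t (mv E t), []), ?_, rfl, rfl, fun h' => absurd h' h, fun _ => ⟨rfl, ?_⟩⟩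
    · rw [St_succ, step]
      rw [show decide (mvIdx E t (St E t) < (St E t).2.length) = false from decide_eq_false h]
      rw [he]
      simp [len]
    · rw [Bs, St_succ, step]
      rw [show decide (mvIdx E t (St E t) < (St E t).2.length) = false from decide_eq_false h]
      rfl

theorem len_succ (t : ℕ) : len E (t + 1) = mv E t + 1 := by
  obtain ⟨x, h, _⟩ := step_eq (E := E) t
  have := mv_le (E := E) t
  unfold len at *
  rw [h]; simp; exact this

theorem lev_lt {t e : ℕ} (he : e < mv E t) : lev E (t + 1) e = lev E t e := by
  obtain ⟨x, h, _⟩ := step_eq (E := E) t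
  have := mv_le (E := E) t
  unfold lev len at *
  rw [h, List.getD_eq_getElem?_getD, List.getD_eq_getElem?_getD, List.getElem?_append_left (by simp; omega),
    List.getElem?_take_of_lt he]

theorem lev_at (t : ℕ) : (mk E (t + 1) (mv E t) = t) ∧ (lev E (t + 1) (mv E t)).2.2.2.1 = E.HS t (mv E t) ∧
    (mv E t < len E t → lev E (t + 1) (mv E t) = upd E t (mv E t) (lev E t (mv E t)) ∧
      Bs E (t + 1) = mk E t (mv E t) :: Bs E t) ∧
    (mv E t = len E t → lev E (t + 1) (mv E t) = (newp E (St E t).2, 0, t, E.HS t (mv E t), []) ∧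
      Bs E (t + 1) = Bs E t) := by
  obtain ⟨x, h, h1, h2, h3, h4⟩ := step_eq (E := E) t
  have hx : lev E (t + 1) (mv E t) = x := by
    have := mv_le (E := E) t
    unfold lev len at *
    rw [h, List.getD_eq_getElem?_getD, List.getElem?_append_right (by simp)]
    simp [this]
  unfold mk
  rw [hx]
  exact ⟨h1, h2, h3, h4⟩

theorem not_viol {t e : ℕ} (he : e < mv E t) : viol E t (Bs E t) e (lev E t e) = false := by
  have := List.not_of_lt_findIdx (xs := List.range (St E t).2.length)
    (p := fun e => viol E t (St E t).1 e ((St E t).2.getD e default)) (i := e) he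
  rw [List.getElem_range] at this
  exact this

theorem viol_at {t : ℕ} (he : mv E t < len E t) :
    viol E t (Bs E t) (mv E t) (lev E t (mv E t)) = true := by
  have := List.findIdx_getElem (xs := List.range (St E t).2.length)
    (p := fun e => viol E t (St E t).1 e ((St E t).2.getD e default))
    (w := by rw [List.length_range]; exact he)
  rw [List.getElem_range] at this
  exact this

theorem lt_len_of_le_mv {t e : ℕ} (h : e < mv E t) : e < len E t := h.trans_le (mv_le t)

/-- the marker of a level is the last stage at which this level or a smaller one acted -/
theorem marker {t e : ℕ} (he : e < len E t) :
    mk E t e < t ∧ mv E (mk E t e) = e ∧ ∀ u, mk E t e < u → u < t → e < mv E u := by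
  induction t generalizing e with
  | zero => simp [len, St] at he
  | succ t ih =>
    rw [len_succ] at he
    rcases Nat.lt_succ_iff_lt_or_eq.1 he with h | h
    · have h2 : mk E (t + 1) e = mk E t e := by unfold mk; rw [lev_lt h]
      obtain ⟨a, b, c⟩ := ih (lt_len_of_le_mv h)
      rw [h2]
      refine ⟨by omega, b, fun u h3 h4 => ?_⟩
      rcases Nat.lt_succ_iff_lt_or_eq.1 h4 with h5 | h5
      · exact c u h3 h5
      · rw [h5]; exact h
    · subst h
      rw [(lev_at t).1]
      exact ⟨by omega, rfl, fun u h3 h4 => by omega⟩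

theorem marker_mono {t e e' : ℕ} (h : e < e') (h' : e' < len E t) : mk E t e < mk E t e' := by
  obtain ⟨a, b, c⟩ := marker (h.trans h')
  obtain ⟨a', b', c'⟩ := marker h'
  by_contra hn
  rcases (not_lt.1 hn).lt_or_eq with h1 | h1
  · have := c' _ h1 a
    omega
  · rw [h1] at b'; omega

theorem mem_Bs {t x : ℕ} : x ∈ Bs E t ↔ ∃ u < t, mv E u < len E u ∧ mk E u (mv E u) = x := by
  induction t with
  | zero => simp [Bs, St]
  | succ t ih =>
    obtain ⟨_, _, h3, h4⟩ := lev_at (E := E) t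
    rcases (mv_le (E := E) t).lt_or_eq with h | h
    · rw [(h3 h).2, List.mem_cons, ih]
      constructor
      · rintro (rfl | ⟨u, hu, h⟩)
        · exact ⟨t, by omega, h, rfl⟩
        · exact ⟨u, by omega, h⟩
      · rintro ⟨u, hu, h5, h6⟩
        rcases Nat.lt_succ_iff_lt_or_eq.1 hu with h7 | h7
        · exact Or.inr ⟨u, h7, h5, h6⟩
        · subst h7; exact Or.inl h6.symm
    · rw [(h4 h).2, ih]
      constructor
      · rintro ⟨u, hu, h⟩; exact ⟨u, by omega, h⟩
      · rintro ⟨u, hu, h5, h6⟩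
        rcases Nat.lt_succ_iff_lt_or_eq.1 hu with h7 | h7
        · exact ⟨u, h7, h5, h6⟩
        · subst h7; omega

theorem Bs_mono {t t' x : ℕ} (h : t ≤ t') (hx : x ∈ Bs E t) : x ∈ Bs E t' := by
  rw [mem_Bs] at *
  obtain ⟨u, hu, h2⟩ := hx
  exact ⟨u, by omega, h2⟩

theorem marker_not_mem {t e : ℕ} (he : e < len E t) : mk E t e ∉ Bs E t := by
  rw [mem_Bs]
  rintro ⟨u, hu, h1, h2⟩
  obtain ⟨a, b, c⟩ := marker he
  obtain ⟨a', b', c'⟩ := marker h1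
  rw [h2] at a' b'
  have := c u a' hu
  omega

/-- markers of moves at the same or a deeper level are fresh -/
theorem marker_fresh {t t' : ℕ} (h : t < t') (hm : mv E t' < len E t') (hle : mv E t ≤ mv E t') :
    t ≤ mk E t' (mv E t') := by
  obtain ⟨a, b, c⟩ := marker hm
  by_contra hn
  have := c t (not_le.1 hn) h
  omega

/-- persistence of a level -/
theorem persist {t t' e : ℕ} (h : t ≤ t') (he : e < len E t) (hq : ∀ u, t ≤ u → u < t' → e ≤ mv E u) :
    e < len E t' := by
  rcases h.lt_or_eq with h | h
  · obtain ⟨u, rfl⟩ : ∃ u, t' = u + 1 := ⟨t' - 1, by omega⟩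
    rw [len_succ]
    have := hq u (by omega) (by omega)
    omega
  · rwa [← h]

theorem lev_const {t t' e : ℕ} (h : t ≤ t') (hq : ∀ u, t ≤ u → u < t' → e < mv E u) :
    lev E t' e = lev E t e := by
  induction t', h using Nat.le_induction with
  | base => rfl
  | succ u hu ih =>
    rw [lev_lt (hq u hu (by omega)), ih (fun v h1 h2 => hq v h1 (by omega))]

/-- what a move does to its level -/
theorem upd_cases (s e : ℕ) (L : Lev) :
    (trigI E s L < E.k ∧ trtB E s L = true ∧ upd E s e L = (L.1, L.2.1 + 1, s, E.HS s e,
        (trigI E s L, s, base L.2.2.2.2 (trigI E s L)) :: L.2.2.2.2)) ∨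
    (trigI E s L < E.k ∧ trtB E s L = false ∧ upd E s e L = (L.1, L.2.1, s, E.HS s e, L.2.2.2.2)) ∨
    (¬ trigI E s L < E.k ∧ upd E s e L = (L.1, L.2.1 + 1, s, E.HS s e, L.2.2.2.2)) := by
  unfold upd
  by_cases h : trigI E s L < E.k
  · cases h2 : trtB E s L <;> simp [h]
  · simp [h]

/-- monotonicity along a run -/
theorem run_mono {t t' e : ℕ} (h : t ≤ t') (he : e < len E t)
    (hq : ∀ u, t ≤ u → u < t' → e ≤ mv E u) :
    (lev E t' e).1 = (lev E t e).1 ∧ (lev E t e).2.1 ≤ (lev E t' e).2.1 ∧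
    lg E t e <:+ lg E t' e := by
  induction t', h using Nat.le_induction with
  | base => exact ⟨rfl, le_rfl, List.suffix_refl _⟩
  | succ u hu ih =>
    obtain ⟨i1, i2, i3⟩ := ih (fun v h1 h2 => hq v h1 (by omega))
    have hl := persist hu he (fun v h1 h2 => hq v h1 (by omega))
    rcases (hq u hu (by omega)).lt_or_eq with h1 | h1
    · unfold lg at *
      rw [lev_lt h1]; exact ⟨i1, i2, i3⟩
    · subst h1
      unfold lg at *
      rw [((lev_at u).2.2.1 hl).1]
      rcases upd_cases (E := E) u (mv E u) (lev E u (mv E u)) with ⟨_, _, h⟩ | ⟨_, _, h⟩ | ⟨_, h⟩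
      · rw [h]; exact ⟨i1, by simp; omega, i3.trans (List.suffix_cons _ _)⟩
      · rw [h]; exact ⟨i1, i2, i3⟩
      · rw [h]; exact ⟨i1, by simp; omega, i3⟩

/-- a reset changes the base; otherwise the `i`-part of the log is unchanged -/
theorem run_base {t t' e : ℕ} (i : ℕ) (h : t ≤ t') (he : e < len E t)
    (hq : ∀ u, t ≤ u → u < t' → e ≤ mv E u) :
    base (lg E t' e) i = base (lg E t e) i ∨
    ∃ s, t ≤ s ∧ s < t' ∧ (i, s, base (lg E t e) i) ∈ lg E t' e := by
  induction t', h using Nat.le_induction with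
  | base => exact Or.inl rfl
  | succ u hu ih =>
    have ih := ih (fun v h1 h2 => hq v h1 (by omega))
    have hl := persist hu he (fun v h1 h2 => hq v h1 (by omega))
    rcases ih with ih | ⟨s, h1, h2, h3⟩
    · rcases (hq u hu (by omega)).lt_or_eq with h1 | h1
      · left; unfold lg at *; rw [lev_lt h1, ih]
      · subst h1
        unfold lg at *
        rw [((lev_at u).2.2.1 hl).1]
        rcases upd_cases (E := E) u (mv E u) (lev E u (mv E u)) with ⟨_, _, h⟩ | ⟨_, _, h⟩ | ⟨_, h⟩
        · rw [h]
          by_cases hi : trigI E u (lev E u (mv E u)) = i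
          · right
            refine ⟨u, hu, by omega, ?_⟩
            rw [hi, ih]
            simp
          · left
            rw [← ih]
            simp [base, hi]
        · rw [h]; left; exact ih
        · rw [h]; left; exact ih
    · right
      refine ⟨s, h1, by omega, ?_⟩
      have := (run_mono (E := E) (t := u) (t' := u + 1) (by omega) hl
        (fun v h1 h2 => hq v (by omega) (by omega))).2.2
      exact this.subset h3

end

section
/-! ### Measure-theoretic analysis -/

structure Env.Ok (E : Env) (W : ℕ → ℝ) : Prop where
  lt : ∀ {s a v}, E.D s a = Option.some v → a < s
  lle : ∀ {s a v}, E.D s a = Option.some v → v.1 ≤ s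
  len : ∀ {s a v}, E.D s a = Option.some v → v.2.length ≤ s
  mono : ∀ {s t a v}, s ≤ t → E.D s a = Option.some v → E.D t a = Option.some v
  ASmono : ∀ {i s t x}, s ≤ t → E.AS i s x = true → E.AS i t x = true
  HSmono : ∀ {s t x}, s ≤ t → E.HS s x = true → E.HS t x = true
  W_nonneg : ∀ a, 0 ≤ W a
  W_eq : ∀ {s a v}, E.D s a = Option.some v → W a = (1 / 2 : ℝ) ^ v.1
  kraft : ∀ F : Finset ℕ, ∑ a ∈ F, W a ≤ 1
  hC : 4 * (E.k + 2) ≤ 2 ^ E.C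

variable {E : Env} {W : ℕ → ℝ}

theorem chain {t e : ℕ} (h : e + 1 < len E t) :
    (lev E t (e + 1)).1 = (lev E t e).1 + (lev E t e).2.1 + E.C := by
  induction t generalizing e with
  | zero => simp [len, St] at h
  | succ t ih =>
    rw [len_succ] at h
    have h1 : e < mv E t := by omega
    rw [lev_lt h1]
    rcases Nat.lt_succ_iff_lt_or_eq.1 h with h2 | h2
    · rw [lev_lt h2]; exact ih (lt_len_of_le_mv h2)
    · rw [h2]
      rcases (mv_le (E := E) t).lt_or_eq with h3 | h3
      · rw [((lev_at t).2.2.1 h3).1]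
        have := ih (e := e) (by omega)
        rw [h2] at this
        rcases upd_cases (E := E) t (mv E t) (lev E t (mv E t)) with ⟨_, _, h⟩ | ⟨_, _, h⟩ | ⟨_, h⟩ <;>
          rw [h] <;> exact this
      · rw [((lev_at t).2.2.2 h3).1]
        unfold newp
        have h4 : (St E t).2.getLast? = Option.some (lev E t e) := by
          unfold lev
          have h5 : e < (St E t).2.length := by unfold len at h3; omega
          have h6 : (St E t).2.length - 1 = e := by unfold len at h3; omega
          rw [List.getLast?_eq_getElem?, h6, List.getD_eq_getElem?_getD, List.getElem?_eq_getElem h5]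
          simp
        rw [h4]; rfl

theorem chain0 {t : ℕ} (h : 0 < len E t) : (lev E t 0).1 = E.C := by
  induction t with
  | zero => simp [len, St] at h
  | succ t ih =>
    rcases (Nat.zero_le (mv E t)).lt_or_eq with h1 | h1
    · rw [lev_lt h1]; exact ih (lt_len_of_le_mv h1)
    · rw [h1]
      rcases (mv_le (E := E) t).lt_or_eq with h3 | h3
      · rw [((lev_at t).2.2.1 h3).1]
        have := ih (by omega)
        rw [h1] at this
        rcases upd_cases (E := E) t (mv E t) (lev E t (mv E t)) with ⟨_, _, h⟩ | ⟨_, _, h⟩ | ⟨_, h⟩ <;>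
          rw [h] <;> exact this
      · rw [((lev_at t).2.2.2 h3).1]
        unfold newp
        have h4 : (St E t).2 = [] := by
          unfold len at h3; exact List.length_eq_zero_iff.1 (by omega)
        rw [h4]; rfl

noncomputable def mass (W : ℕ → ℝ) (F : Finset ℕ) : ℝ := ∑ a ∈ F, W a

def cset (E : Env) (i s x : ℕ) : Finset ℕ := (Finset.range s).filter (fun a => curB E i s x a = true)
def uset (E : Env) (i s : ℕ) (log : List LogE) (b : ℕ) : Finset ℕ :=
  (Finset.range s).filter (fun a => untB E i s log b a = true)

theorem mem_cset (ok : E.Ok W) {i s x a : ℕ} : a ∈ cset E i s x ↔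
    ∃ v, E.D s a = Option.some v ∧ v.2 = resA E i s v.2.length ∧ x < v.2.length := by
  unfold cset curB
  rw [Finset.mem_filter]
  constructor
  · rintro ⟨_, h⟩
    rcases hD : E.D s a with _ | v
    · simp [hD] at h
    · rw [hD] at h
      simp at h
      exact ⟨v, rfl, h⟩
  · rintro ⟨v, h1, h2, h3⟩
    refine ⟨Finset.mem_range.2 (ok.lt h1), ?_⟩
    rw [h1]
    simp only [Option.elim_some, Bool.and_eq_true, decide_eq_true_eq]
    exact ⟨h2, h3⟩

theorem mem_uset (ok : E.Ok W) {i s b a : ℕ} {log : List LogE} : a ∈ uset E i s log b ↔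
    ∃ v, E.D s a = Option.some v ∧ v.2 = List.replicate v.2.length false ∧ v.2.length ≤ b ∧
      ∀ t b', (i, t, b') ∈ log → (E.D t a).isSome → v.2.length ≤ b' →
        resA E i t v.2.length ≠ resA E i s v.2.length := by
  unfold uset untB
  rw [Finset.mem_filter]
  constructor
  · rintro ⟨_, h⟩
    rcases hD : E.D s a with _ | v
    · simp [hD] at h
    · rw [hD] at h
      simp only [Option.elim_some, Bool.and_eq_true, decide_eq_true_eq, Bool.not_eq_true',
        List.any_eq_false] at h
      refine ⟨v, rfl, h.1.1, h.1.2, fun t b' h1 h2 h3 h4 => ?_⟩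
      exact h.2 _ h1 ⟨⟨⟨rfl, h2⟩, h3⟩, h4⟩
  · rintro ⟨v, h1, h2, h3, h4⟩
    refine ⟨Finset.mem_range.2 (ok.lt h1), ?_⟩
    rw [h1]
    simp only [Option.elim_some, Bool.and_eq_true, decide_eq_true_eq, Bool.not_eq_true',
        List.any_eq_false]
    refine ⟨⟨h2, h3⟩, ?_⟩
    rintro ⟨i', t, b'⟩ hm ⟨⟨⟨h5, h6⟩, h7⟩, h8⟩
    simp only at h5 h6 h7 h8
    subst h5
    exact h4 t b' hm h6 h7 h8

theorem wt_real (ok : E.Ok W) {s a : ℕ} {v} (h : E.D s a = Option.some v) :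
    ((wt E s a : ℕ) : ℝ) = 2 ^ s * W a := by
  unfold wt
  rw [h, ok.W_eq h]
  simp only [Option.elim_some]
  have := ok.lle h
  rw [one_div, inv_pow]
  push_cast
  rw [pow_sub₀ _ (by norm_num) this]

theorem Q_real (ok : E.Ok W) (i s x : ℕ) : (Qm E i s x : ℝ) = 2 ^ s * mass W (cset E i s x) := by
  unfold Qm mass
  rw [Nat.cast_sum, Finset.mul_sum, cset, Finset.sum_filter]
  refine Finset.sum_congr rfl fun a _ => ?_
  rcases h : curB E i s x a with _ | _
  · simp
  · simp only [cond_true, if_true]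
    rcases hD : E.D s a with _ | v
    · simp [curB, hD] at h
    · exact wt_real ok hD

theorem V_real (ok : E.Ok W) (i s b : ℕ) (log) :
    (Vm E i s log b : ℝ) = 2 ^ s * mass W (uset E i s log b) := by
  unfold Vm mass
  rw [Nat.cast_sum, Finset.mul_sum, uset, Finset.sum_filter]
  refine Finset.sum_congr rfl fun a _ => ?_
  rcases h : untB E i s log b a with _ | _
  · simp
  · simp only [cond_true, if_true]
    rcases hD : E.D s a with _ | v
    · simp [untB, hD] at h
    · exact wt_real ok hD

/-- threshold of a level -/
noncomputable def thr (L : Lev) : ℝ := (1 / 2 : ℝ) ^ (L.1 + L.2.1)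

theorem thr_pos (L : Lev) : 0 < thr L := by unfold thr; positivity

theorem trig_iff (ok : E.Ok W) (i s : ℕ) (L : Lev) :
    2 ^ s < Qm E i s L.2.2.1 * 2 ^ (L.1 + L.2.1) ↔ thr L < mass W (cset E i s L.2.2.1) := by
  have h : (2 ^ s < Qm E i s L.2.2.1 * 2 ^ (L.1 + L.2.1)) ↔
      ((2 : ℝ) ^ s < Qm E i s L.2.2.1 * 2 ^ (L.1 + L.2.1)) := by exact_mod_cast Iff.rfl
  rw [h, Q_real ok, thr, one_div, inv_pow, mul_assoc]
  rw [lt_mul_iff_one_lt_right (by positivity), inv_lt_iff_one_lt_mul₀ (by positivity), mul_comm]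

theorem trig_spec (ok : E.Ok W) {s : ℕ} {L : Lev} (h : trigI E s L < E.k) :
    thr L < mass W (cset E (trigI E s L) s L.2.2.1) := by
  rw [← trig_iff ok]
  have := List.findIdx_getElem (xs := List.range E.k)
    (p := fun i => decide (2 ^ s < Qm E i s L.2.2.1 * 2 ^ (L.1 + L.2.1)))
    (w := by rw [List.length_range]; exact h)
  rw [List.getElem_range] at this
  exact of_decide_eq_true this

theorem not_trig_spec (ok : E.Ok W) {s i : ℕ} {L : Lev} (h : ¬ trigI E s L < E.k) (hi : i < E.k) :
    mass W (cset E i s L.2.2.1) ≤ thr L := by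
  rw [← not_lt, ← trig_iff ok]
  have := List.not_of_lt_findIdx (xs := List.range E.k)
    (p := fun i => decide (2 ^ s < Qm E i s L.2.2.1 * 2 ^ (L.1 + L.2.1))) (i := i)
    (lt_of_lt_of_le hi (not_lt.1 h))
  rw [List.getElem_range] at this
  exact of_decide_eq_false this

theorem trt_spec (ok : E.Ok W) {s : ℕ} {L : Lev} : trtB E s L = true ↔
    mass W (uset E (trigI E s L) s L.2.2.2.2 (base L.2.2.2.2 (trigI E s L))) <
    mass W (cset E (trigI E s L) s (base L.2.2.2.2 (trigI E s L))) * 2 ^ L.1 := by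
  unfold trtB
  rw [decide_eq_true_eq]
  rw [← Nat.cast_lt (α := ℝ)]
  push_cast
  rw [Q_real ok, V_real ok, mul_assoc, mul_lt_mul_iff_right₀ (by positivity)]

theorem stay (ok : E.Ok W) {t e i : ℕ} (he : e < len E (t + 1)) (hi : i < E.k) :
    mass W (cset E i t (mk E (t + 1) e)) ≤ thr (lev E (t + 1) e) := by
  rw [len_succ] at he
  rcases Nat.lt_succ_iff_lt_or_eq.1 he with h | h
  · unfold mk
    rw [lev_lt h]
    have := not_viol h
    unfold viol at this
    simp only [Bool.or_eq_false_iff, decide_eq_false_iff_not] at this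
    exact not_trig_spec ok this.1 hi
  · subst h
    rw [(lev_at t).1]
    have : cset E i t t = ∅ := by
      ext a
      rw [mem_cset ok]
      simp only [Finset.notMem_empty, iff_false]
      rintro ⟨v, h1, _, h2⟩
      have := ok.len h1
      omega
    rw [this]
    simp [mass, (thr_pos _).le]

theorem resA_sandwich (ok : E.Ok W) {i s t u n : ℕ} (h1 : s ≤ t) (h2 : t ≤ u)
    (h : resA E i s n = resA E i u n) : resA E i t n = resA E i s n := by
  unfold resA at *
  rw [List.map_inj_left] at *
  intro x hx
  have h3 := h x hx
  cases h4 : E.AS i s x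
  · cases h5 : E.AS i t x
    · rfl
    · rw [ok.ASmono h2 h5, h4] at h3; cases h3
  · rw [ok.ASmono h1 h4]

theorem resA_le {i s t m n : ℕ} (hmn : m ≤ n) (h : resA E i s n = resA E i t n) :
    resA E i s m = resA E i t m := by
  unfold resA at *
  rw [List.map_inj_left] at *
  intro x hx
  exact h x (by rw [List.mem_range] at *; omega)

@[simp] theorem resA_length (i s n : ℕ) : (resA E i s n).length = n := by simp [resA]

theorem mass_mono (ok : E.Ok W) {F G : Finset ℕ} (h : F ⊆ G) : mass W F ≤ mass W G :=
  Finset.sum_le_sum_of_subset_of_nonneg h (fun _ _ _ => ok.W_nonneg _)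

theorem mass_nonneg (ok : E.Ok W) (F : Finset ℕ) : 0 ≤ mass W F :=
  Finset.sum_nonneg fun _ _ => ok.W_nonneg _

/-- pairwise disjoint families have total mass bounded by that of any superset -/
theorem mass_disj (ok : E.Ok W) {ι : Type*} (S : Finset ι) (F : ι → Finset ℕ)
    (h : ∀ x ∈ S, ∀ y ∈ S, x ≠ y → Disjoint (F x) (F y)) {G : Finset ℕ} (hG : ∀ x ∈ S, F x ⊆ G) :
    ∑ x ∈ S, mass W (F x) ≤ mass W G := by
  have : mass W (S.biUnion F) = ∑ x ∈ S, mass W (F x) := by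
    unfold mass
    exact Finset.sum_biUnion (fun x hx y hy hxy => h x hx y hy hxy)
  rw [← this]
  exact mass_mono ok (Finset.biUnion_subset.2 hG)

theorem mass_disj_one (ok : E.Ok W) {ι : Type*} (S : Finset ι) (F : ι → Finset ℕ)
    (h : ∀ x ∈ S, ∀ y ∈ S, x ≠ y → Disjoint (F x) (F y)) :
    ∑ x ∈ S, mass W (F x) ≤ 1 :=
  (mass_disj ok S F h (G := S.biUnion F) (fun x hx => Finset.subset_biUnion_of_mem F hx)).trans
    (ok.kraft _)

/-- A sum of powers of one half with distinct exponents. -/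
theorem sum_half_pow_le (n : ℕ) : ∑ j ∈ Finset.range n, (1 / 2 : ℝ) ^ j ≤ 2 := by
  have : ∑ j ∈ Finset.range n, (1 / 2 : ℝ) ^ j = 2 - 2 * (1 / 2) ^ n := by
    induction n with
    | zero => simp
    | succ n ih => rw [Finset.sum_range_succ, ih, pow_succ]; ring
  rw [this]
  have : (0 : ℝ) ≤ (1 / 2) ^ n := by positivity
  linarith

theorem sum_half_inj {ι : Type*} (S : Finset ι) (f : ι → ℕ)
    (h : ∀ x ∈ S, ∀ y ∈ S, f x = f y → x = y) : ∑ x ∈ S, (1 / 2 : ℝ) ^ f x ≤ 2 := by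
  rw [← Finset.sum_image (s := S) (g := f) (f := fun n => (1 / 2 : ℝ) ^ n) h]
  refine le_trans ?_ (sum_half_pow_le ((S.image f).sup id + 1))
  refine Finset.sum_le_sum_of_subset_of_nonneg ?_ (fun _ _ _ => by positivity)
  intro n hn
  rw [Finset.mem_range]
  have := Finset.le_sup (f := id) hn
  simp only [id] at this
  omega

/-! ### Moves -/

/-- a nontreating trigger move -/
def isNT (E : Env) (t : ℕ) : Prop :=
  mv E t < len E t ∧ trigI E t (lev E t (mv E t)) < E.k ∧ trtB E t (lev E t (mv E t)) = false
/-- trigger index -/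
def ti (E : Env) (t : ℕ) : ℕ := trigI E t (lev E t (mv E t))
/-- a move at which `r` increases -/
def isInc (E : Env) (t : ℕ) : Prop := mv E t < len E t ∧ ¬ isNT E t

theorem inc_spec {t : ℕ} (h : isInc E t) :
    (lev E (t + 1) (mv E t)).2.1 = (lev E t (mv E t)).2.1 + 1 := by
  rw [((lev_at t).2.2.1 h.1).1]
  rcases upd_cases (E := E) t (mv E t) (lev E t (mv E t)) with ⟨_, _, h'⟩ | ⟨a, b, h'⟩ | ⟨_, h'⟩
  · rw [h']
  · exact absurd ⟨h.1, a, b⟩ h.2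
  · rw [h']

/-- not interrupted by smaller levels before `T` -/
def alive (E : Env) (T t : ℕ) : Prop := ∀ u, t < u → u < T → mv E t ≤ mv E u

/-- key of a trigger move -/
def key (E : Env) (t : ℕ) : Finset ℕ := cset E (ti E t) t (mk E t (mv E t))

theorem key_disj (ok : E.Ok W) {t t' : ℕ} (h : t < t') (hm : mv E t' < len E t')
    (hle : mv E t ≤ mv E t') {a : ℕ} (ha : a ∈ key E t) (ha' : a ∈ key E t') : False := by
  have hf := marker_fresh h hm hle
  obtain ⟨v, h1, _, _⟩ := (mem_cset ok).1 ha
  obtain ⟨v', h1', _, h2'⟩ := (mem_cset ok).1 ha'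
  have e := ok.mono h.le h1
  rw [h1'] at e
  have e := Option.some.inj e
  subst e
  have := ok.len h1
  omega

/-- increments within one run -/
theorem inc_sum (e T : ℕ) (S : Finset ℕ)
    (hS : ∀ t ∈ S, t < T ∧ isInc E t ∧ mv E t = e ∧ alive E T t) :
    ∑ t ∈ S, thr (lev E t e) ≤ 2 * (1 / 2 : ℝ) ^ (lev E T e).1 := by
  have hp : ∀ t ∈ S, (lev E T e).1 = (lev E t e).1 := by
    intro t ht
    obtain ⟨h1, h2, h3, h4⟩ := hS t ht
    subst h3
    refine (run_mono h1.le h2.1 ?_).1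
    intro u hu hu'
    rcases hu.lt_or_eq with h5 | h5
    · exact h4 u h5 hu'
    · rw [h5]
  have hlt : ∀ x ∈ S, ∀ y ∈ S, x < y → (lev E x e).2.1 < (lev E y e).2.1 := by
    intro x hx y hy hxy
    obtain ⟨h1, h2, h3, h4⟩ := hS x hx
    obtain ⟨h1', h2', h3', h4'⟩ := hS y hy
    have hi := inc_spec h2
    rw [h3] at hi
    have hl : e < len E (x + 1) := by rw [len_succ]; omega
    have := (run_mono (E := E) (t := x + 1) (t' := y) hxy hl
      (fun u hu hu' => h3 ▸ h4 u (by omega) (by omega))).2.1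
    omega
  have : ∑ t ∈ S, thr (lev E t e) = ∑ t ∈ S, (1 / 2 : ℝ) ^ (lev E T e).1 * (1 / 2) ^ (lev E t e).2.1 := by
    refine Finset.sum_congr rfl fun t ht => ?_
    rw [thr, pow_add, hp t ht]
  rw [this, ← Finset.mul_sum, mul_comm]
  refine mul_le_mul_of_nonneg_right (sum_half_inj S _ ?_) (by positivity)
  intro x hx y hy hxy
  rcases lt_trichotomy x y with h | h | h
  · have := hlt x hx y hy h; omega
  · exact h
  · have := hlt y hy x hx h; omega

theorem base_le_marker {t e i : ℕ} (he : e < len E t) : base (lg E t e) i ≤ mk E t e := by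
  induction t generalizing e with
  | zero => simp [len, St] at he
  | succ t ih =>
    rw [len_succ] at he
    rcases Nat.lt_succ_iff_lt_or_eq.1 he with h | h
    · unfold lg mk at *
      rw [lev_lt h]; exact ih (lt_len_of_le_mv h)
    · subst h
      rw [(lev_at t).1]
      rcases (mv_le (E := E) t).lt_or_eq with h3 | h3
      · have := (ih (e := mv E t) h3).trans (marker h3).1.le
        unfold lg at *
        rw [((lev_at t).2.2.1 h3).1]
        rcases upd_cases (E := E) t (mv E t) (lev E t (mv E t)) with ⟨_, _, h⟩ | ⟨_, _, h⟩ | ⟨_, h⟩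
        · rw [h]
          by_cases hi : trigI E t (lev E t (mv E t)) = i
          · simp [base, hi]
          · simpa [base, hi] using this
        · rw [h]; exact this
        · rw [h]; exact this
      · unfold lg
        rw [((lev_at t).2.2.2 h3).1]
        simp [base]

/-- nontreating moves within one run, for one index -/
theorem nt_sum (ok : E.Ok W) (e T i : ℕ) (S : Finset ℕ)
    (hS : ∀ t ∈ S, t < T ∧ isNT E t ∧ mv E t = e ∧ alive E T t ∧ ti E t = i) :
    ∑ t ∈ S, mass W (key E t ∩ cset E i T 0) ≤ (1 / 2 : ℝ) ^ (lev E T e).1 := by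
  -- restrict to moves with nonempty live part
  set S' := S.filter (fun t => (key E t ∩ cset E i T 0).Nonempty) with hS'
  have hrestr : ∑ t ∈ S, mass W (key E t ∩ cset E i T 0) =
      ∑ t ∈ S', mass W (key E t ∩ cset E i T 0) := by
    rw [hS', Finset.sum_filter]
    refine Finset.sum_congr rfl fun t _ => ?_
    split_ifs with h
    · rfl
    · rw [Finset.not_nonempty_iff_eq_empty.1 h]; simp [mass]
  rw [hrestr]
  have hq : ∀ t ∈ S, ∀ u, t ≤ u → u < T → e ≤ mv E u := by
    intro t ht u hu hu'
    obtain ⟨h1, h2, h3, h4, h5⟩ := hS t ht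
    rcases hu.lt_or_eq with h6 | h6
    · exact h3 ▸ h4 u h6 hu'
    · rw [← h6, h3]
  have hel : ∀ t ∈ S, e < len E t := fun t ht => by
    have := (hS t ht).2.1.1; rwa [(hS t ht).2.2.1] at this
  let b : ℕ → ℕ := fun t => base (lg E t e) i
  let F : ℕ → Finset ℕ := fun c => S'.filter (fun t => b t = c)
  let tl : ℕ → ℕ := fun c => (F c).sup id
  have hsub : ∀ t ∈ S', t ∈ S := fun t ht => (Finset.mem_filter.1 ht).1
  have htl : ∀ c ∈ S'.image b, tl c ∈ F c := by
    intro c hc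
    obtain ⟨t, ht, htc⟩ := Finset.mem_image.1 hc
    have hne : (F c).Nonempty := ⟨t, Finset.mem_filter.2 ⟨ht, htc⟩⟩
    obtain ⟨x, hx, hx'⟩ := Finset.exists_mem_eq_sup (F c) hne id
    show (F c).sup id ∈ F c
    rw [hx']; exact hx
  have hle : ∀ c, ∀ t ∈ F c, t ≤ tl c := fun c t ht => Finset.le_sup (f := id) ht
  rw [← Finset.sum_fiberwise_of_maps_to (g := b) (t := S'.image b)
    (fun t ht => Finset.mem_image_of_mem b ht)]
  -- each fibre
  have hfib : ∀ c ∈ S'.image b, ∑ t ∈ S' with b t = c, mass W (key E t ∩ cset E i T 0) ≤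
      (1 / 2 : ℝ) ^ (lev E T e).1 * mass W (uset E i (tl c) (lg E (tl c) e) c) := by
    intro c hc
    have hm := htl c hc
    have hm' := Finset.mem_filter.1 hm
    obtain ⟨h1, h2, h3, h4, h5⟩ := hS _ (hsub _ hm'.1)
    have hp := (run_mono h1.le (hel _ (hsub _ hm'.1)) (hq _ (hsub _ hm'.1))).1
    have hb : base (lg E (tl c) e) i = c := hm'.2
    have hntr := h2.2.2
    have hti : trigI E (tl c) (lev E (tl c) e) = i := by rw [← h5, ti, h3]
    rw [h3] at hntr
    have hQ : mass W (cset E i (tl c) c) * 2 ^ (lev E (tl c) e).1 ≤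
        mass W (uset E i (tl c) (lg E (tl c) e) c) := by
      by_contra hcon
      have := (trt_spec ok (s := tl c) (L := lev E (tl c) e)).2 (by
        rw [hti]
        change mass W (uset E i (tl c) (lg E (tl c) e) (base (lg E (tl c) e) i)) <
          mass W (cset E i (tl c) (base (lg E (tl c) e) i)) * _
        rw [hb]
        exact not_le.1 hcon)
      rw [this] at hntr; cases hntr
    have hsum : ∑ t ∈ S' with b t = c, mass W (key E t ∩ cset E i T 0) ≤
        mass W (cset E i (tl c) c) := by
      refine mass_disj ok _ _ ?_ ?_
      · intro x hx y hy hxy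
        rw [Finset.mem_filter] at hx hy
        obtain ⟨x1, x2, x3, x4, x5⟩ := hS x (hsub x hx.1)
        obtain ⟨y1, y2, y3, y4, y5⟩ := hS y (hsub y hy.1)
        rw [Finset.disjoint_left]
        intro a ha ha'
        rw [Finset.mem_inter] at ha ha'
        rcases lt_or_gt_of_ne hxy with h | h
        · exact key_disj ok h y2.1 (by omega) ha.1 ha'.1
        · exact key_disj ok h x2.1 (by omega) ha'.1 ha.1
      · intro t ht a ha
        have htF : t ∈ F c := ht
        rw [Finset.mem_filter] at ht
        obtain ⟨x1, x2, x3, x4, x5⟩ := hS t (hsub t ht.1)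
        rw [Finset.mem_inter, key, x5, x3] at ha
        obtain ⟨v, g1, g2, g3⟩ := (mem_cset ok).1 ha.1
        obtain ⟨v', g1', g2', g3'⟩ := (mem_cset ok).1 ha.2
        have e1 := ok.mono x1.le g1
        rw [g1'] at e1
        have e1 := Option.some.inj e1
        subst e1
        rw [mem_cset ok]
        refine ⟨v', ok.mono (hle c t htF) g1, ?_, ?_⟩
        · exact g2.trans (resA_sandwich ok (hle c t htF) h1.le (g2.symm.trans g2')).symm
        · have hbm := base_le_marker (E := E) (t := t) (e := e) (i := i) (hel t (hsub t ht.1))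
          have : b t = c := ht.2
          have : base (lg E t e) i = c := this
          omega
    rw [hp]
    calc _ ≤ mass W (cset E i (tl c) c) := hsum
      _ = (1 / 2 : ℝ) ^ (lev E (tl c) e).1 * (mass W (cset E i (tl c) c) * 2 ^ (lev E (tl c) e).1) := by
          rw [one_div, inv_pow]; field_simp
      _ ≤ _ := mul_le_mul_of_nonneg_left hQ (by positivity)
  refine (Finset.sum_le_sum hfib).trans ?_
  rw [← Finset.mul_sum]
  -- the batches of different rounds are disjoint
  have key1 : ∀ c ∈ S'.image b, ∀ c' ∈ S'.image b, tl c < tl c' → c ≠ c' →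
      Disjoint (uset E i (tl c) (lg E (tl c) e) c) (uset E i (tl c') (lg E (tl c') e) c') := by
    intro c hc c' hc' hlt hne
    have hm := Finset.mem_filter.1 (htl c hc)
    have hm' := Finset.mem_filter.1 (htl c' hc')
    obtain ⟨x1, x2, x3, x4, x5⟩ := hS _ (hsub _ hm.1)
    obtain ⟨y1, y2, y3, y4, y5⟩ := hS _ (hsub _ hm'.1)
    have hb : base (lg E (tl c) e) i = c := hm.2
    have hb' : base (lg E (tl c') e) i = c' := hm'.2
    rw [Finset.disjoint_left]
    intro a ha ha'
    rcases run_base (E := E) i hlt.le (hel _ (hsub _ hm.1))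
      (fun u h1 h2 => hq _ (hsub _ hm.1) u h1 (by omega)) with h | ⟨s, s1, s2, s3⟩
    · rw [hb, hb'] at h; exact hne h.symm
    · rw [hb] at s3
      obtain ⟨v, g1, g2, g3, g4⟩ := (mem_uset ok).1 ha
      obtain ⟨v', g1', g2', g3', g4'⟩ := (mem_uset ok).1 ha'
      have e1 := ok.mono hlt.le g1
      rw [g1'] at e1
      have e1 := Option.some.inj e1
      subst e1
      refine g4' s c s3 (by rw [ok.mono s1 g1]; rfl) g3 ?_
      obtain ⟨a₀, ha₀⟩ := (Finset.mem_filter.1 hm.1).2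
      rw [Finset.mem_inter, key, x5, x3] at ha₀
      obtain ⟨w, k1, k2, k3⟩ := (mem_cset ok).1 ha₀.1
      obtain ⟨w', k1', k2', k3'⟩ := (mem_cset ok).1 ha₀.2
      have e1 := ok.mono x1.le k1
      rw [k1'] at e1
      have e1 := Option.some.inj e1
      subst e1
      have hbm := base_le_marker (E := E) (t := tl c) (e := e) (i := i) (hel _ (hsub _ hm.1))
      rw [hb] at hbm
      have hT : resA E i (tl c) v'.2.length = resA E i T v'.2.length :=
        resA_le (n := w'.2.length) (by omega) (k2.symm.trans k2')
      rw [resA_sandwich ok s1 (by omega) hT, resA_sandwich ok hlt.le y1.le hT]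
  have hone : ∑ c ∈ S'.image b, mass W (uset E i (tl c) (lg E (tl c) e) c) ≤ 1 := by
    refine mass_disj_one ok _ _ ?_
    intro c hc c' hc' hne
    rcases lt_trichotomy (tl c) (tl c') with h | h | h
    · exact key1 c hc c' hc' h hne
    · exfalso
      have h1 := (Finset.mem_filter.1 (htl c hc)).2
      have h2 := (Finset.mem_filter.1 (htl c' hc')).2
      rw [h] at h1
      exact hne (h1.symm.trans h2)
    · exact (key1 c' hc' c hc h hne.symm).symm
  calc _ ≤ (1 / 2 : ℝ) ^ (lev E T e).1 * 1 := mul_le_mul_of_nonneg_left hone (by positivity)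
    _ = _ := mul_one _

end

section
variable {E : Env} {W : ℕ → ℝ}

/-- what remains of the cost of move `t` at stage `T` -/
noncomputable def gl (E : Env) (W : ℕ → ℝ) (T t : ℕ) : ℝ :=
  if isNT E t then mass W (key E t ∩ cset E (ti E t) T 0) else thr (lev E t (mv E t))

theorem gl_nonneg (ok : E.Ok W) (T t : ℕ) : 0 ≤ gl E W T t := by
  unfold gl; split_ifs
  · exact mass_nonneg ok _
  · exact (thr_pos _).le

theorem run_sum (ok : E.Ok W) (e T : ℕ) (S : Finset ℕ)
    (hS : ∀ t ∈ S, t < T ∧ mv E t < len E t ∧ mv E t = e ∧ alive E T t) :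
    ∑ t ∈ S, gl E W T t ≤ (E.k + 2) * (1 / 2 : ℝ) ^ (lev E T e).1 := by
  rw [← Finset.sum_filter_add_sum_filter_not S (fun t => isNT E t)]
  have h1 : ∑ t ∈ S with isNT E t, gl E W T t ≤ E.k * (1 / 2 : ℝ) ^ (lev E T e).1 := by
    rw [← Finset.sum_fiberwise_of_maps_to (g := ti E) (t := Finset.range E.k)]
    · calc _ ≤ ∑ i ∈ Finset.range E.k, (1 / 2 : ℝ) ^ (lev E T e).1 := by
            refine Finset.sum_le_sum fun i _ => ?_
            refine le_trans (le_of_eq ?_) (nt_sum ok e T i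
              ((S.filter (fun t => isNT E t)).filter (fun t => ti E t = i)) ?_)
            · refine Finset.sum_congr rfl fun t ht => ?_
              simp only [Finset.mem_filter] at ht
              rw [gl, if_pos ht.1.2, ht.2]
            · intro t ht
              simp only [Finset.mem_filter] at ht
              obtain ⟨a1, a2, a3, a4⟩ := hS t ht.1.1
              exact ⟨a1, ht.1.2, a3, a4, ht.2⟩
        _ = _ := by simp
    · intro t ht
      simp only [Finset.mem_filter] at ht
      exact Finset.mem_range.2 ht.2.2.1
  have h2 : ∑ t ∈ S with ¬ isNT E t, gl E W T t ≤ 2 * (1 / 2 : ℝ) ^ (lev E T e).1 := by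
    refine le_trans (le_of_eq ?_) (inc_sum (E := E) e T (S.filter (fun t => ¬ isNT E t)) ?_)
    · refine Finset.sum_congr rfl fun t ht => ?_
      simp only [Finset.mem_filter] at ht
      rw [gl, if_neg ht.2, (hS t ht.1).2.2.1]
    · intro t ht
      simp only [Finset.mem_filter] at ht
      obtain ⟨a1, a2, a3, a4⟩ := hS t ht.1
      exact ⟨a1, ⟨a2, ht.2⟩, a3, a4⟩
  linarith

/-- stage at which move `t` is overruled -/
noncomputable def kill (E : Env) (N t : ℕ) : ℕ :=
  if h : ∃ T, t < T ∧ T < N ∧ mv E T < mv E t then Nat.find h else N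

theorem kill_spec {N t : ℕ} (ht : t < N) (hm : mv E t < len E t) :
    t < kill E N t ∧ alive E (kill E N t) t ∧ kill E N t ≤ N ∧ mv E t < len E (kill E N t) ∧
    (kill E N t < N → mv E (kill E N t) < mv E t) := by
  have main : t < kill E N t ∧ alive E (kill E N t) t ∧ kill E N t ≤ N ∧
      (kill E N t < N → mv E (kill E N t) < mv E t) := by
    unfold kill
    split_ifs with h
    · have hs := Nat.find_spec h
      refine ⟨hs.1, ?_, hs.2.1.le, fun _ => hs.2.2⟩
      intro u h1 h2
      by_contra hc
      exact Nat.find_min h h2 ⟨h1, h2.trans hs.2.1, not_le.1 hc⟩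
    · refine ⟨ht, ?_, le_rfl, fun h => absurd h (lt_irrefl _)⟩
      intro u h1 h2
      by_contra hc
      exact h ⟨u, h1, h2, not_le.1 hc⟩
  obtain ⟨a, b, c, d⟩ := main
  refine ⟨a, b, c, ?_, d⟩
  refine persist a.le hm ?_
  intro u hu hu'
  rcases hu.lt_or_eq with h | h
  · exact b u h hu'
  · rw [h]

noncomputable def moves (E : Env) (N : ℕ) : Finset ℕ :=
  (Finset.range N).filter (fun t => mv E t < len E t)

/-- the mass lost by the keys before being overruled -/
theorem lost_sum (ok : E.Ok W) (N : ℕ) :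
    ∑ t ∈ (moves E N).filter (fun t => isNT E t),
      mass W (key E t \ cset E (ti E t) (kill E N t) 0) ≤ E.k := by
  rw [← Finset.sum_fiberwise_of_maps_to (g := ti E) (t := Finset.range E.k)]
  · calc _ ≤ ∑ i ∈ Finset.range E.k, (1 : ℝ) := by
          refine Finset.sum_le_sum fun i _ => ?_
          refine mass_disj_one ok _ _ ?_
          have main : ∀ x y, x < y → x < N → y < N → mv E x < len E x → mv E y < len E y →
              ti E x = i → ti E y = i →
              Disjoint (key E x \ cset E (ti E x) (kill E N x) 0)
                (key E y \ cset E (ti E y) (kill E N y) 0) := by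
            intro x y hxy hx hy hmx hmy hix hiy
            rw [Finset.disjoint_left]
            intro a ha ha'
            rw [Finset.mem_sdiff] at ha ha'
            obtain ⟨k1, k2, k3, k4, k5⟩ := kill_spec hx hmx
            by_cases hle : mv E x ≤ mv E y
            · exact key_disj ok hxy hmy hle ha.1 ha'.1
            · have hky : kill E N x ≤ y := by
                by_contra hc
                exact hle (k2 y hxy (not_le.1 hc))
              apply ha.2
              have h1 := ha.1
              have h2 := ha'.1
              unfold key at h1 h2
              rw [hix] at h1 ⊢
              rw [hiy] at h2
              obtain ⟨v, g1, g2, g3⟩ := (mem_cset ok).1 h1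
              obtain ⟨v', g1', g2', g3'⟩ := (mem_cset ok).1 h2
              have e1 := ok.mono hxy.le g1
              rw [g1'] at e1
              have e1 := Option.some.inj e1
              subst e1
              rw [mem_cset ok]
              refine ⟨v', ok.mono k1.le g1, ?_, by omega⟩
              exact g2.trans (resA_sandwich ok k1.le hky (g2.symm.trans g2')).symm
          intro x hx y hy hxy
          simp only [Finset.mem_filter, moves, Finset.mem_range] at hx hy
          rcases lt_or_gt_of_ne hxy with h | h
          · exact main x y h hx.1.1.1 hy.1.1.1 hx.1.1.2 hy.1.1.2 hx.2 hy.2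
          · exact (main y x h hy.1.1.1 hx.1.1.1 hy.1.1.2 hx.1.1.2 hy.2 hx.2).symm
      _ = _ := by simp
  · intro t ht
    simp only [Finset.mem_filter] at ht
    exact Finset.mem_range.2 ht.2.2.1

theorem C_pos (ok : E.Ok W) : 1 ≤ E.C := by
  by_contra h
  have : E.C = 0 := by omega
  have h2 := ok.hC
  rw [this] at h2
  simp at h2
  omega

theorem p_grow (ok : E.Ok W) {t m j : ℕ} (h : m + 1 + j < len E t) :
    (lev E t m).1 + (lev E t m).2.1 + E.C + j ≤ (lev E t (m + 1 + j)).1 := by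
  induction j with
  | zero => rw [add_zero, chain (by omega)]
  | succ j ih =>
    have := ih (by omega)
    have h2 := chain (E := E) (t := t) (e := m + 1 + j) (by omega)
    have := C_pos ok
    rw [show m + 1 + (j + 1) = m + 1 + j + 1 by ring, h2]
    omega

theorem p_grow0 (ok : E.Ok W) {t j : ℕ} (h : j < len E t) : E.C + j ≤ (lev E t j).1 := by
  induction j with
  | zero => rw [add_zero, chain0 h]
  | succ j ih =>
    have := ih (by omega)
    have h2 := chain (E := E) (t := t) (e := j) (by omega)
    have := C_pos ok
    rw [h2]
    omega

theorem half_C (ok : E.Ok W) : (E.k + 2) * (2 * (1 / 2 : ℝ) ^ E.C) ≤ 1 / 2 := by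
  have h : (4 * (E.k + 2) : ℝ) ≤ 2 ^ E.C := by exact_mod_cast ok.hC
  rw [one_div, inv_pow]
  have : (0 : ℝ) < 2 ^ E.C := by positivity
  rw [show ((E.k : ℝ) + 2) * (2 * (2 ^ E.C)⁻¹) = ((E.k + 2) * 2) / 2 ^ E.C by
    rw [div_eq_mul_inv]; ring]
  rw [div_le_iff₀ this]
  linarith

theorem deep_sum (ok : E.Ok W) {t m : ℕ} :
    ∑ e ∈ Finset.Ico (m + 1) (len E t), (E.k + 2) * (1 / 2 : ℝ) ^ (lev E t e).1 ≤
      1 / 2 * thr (lev E t m) := by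
  rw [Finset.sum_Ico_eq_sum_range]
  calc _ ≤ ∑ j ∈ Finset.range (len E t - (m + 1)),
        ((E.k + 2) * (thr (lev E t m) * (1 / 2 : ℝ) ^ E.C)) * (1 / 2 : ℝ) ^ j := by
          refine Finset.sum_le_sum fun j hj => ?_
          rw [Finset.mem_range] at hj
          have := p_grow ok (E := E) (t := t) (m := m) (j := j) (by omega)
          rw [thr, ← pow_add, mul_assoc, ← pow_add]
          refine mul_le_mul_of_nonneg_left ?_ (by positivity)
          exact pow_le_pow_of_le_one (by norm_num) (by norm_num) this
    _ = ((E.k + 2) * (thr (lev E t m) * (1 / 2 : ℝ) ^ E.C)) *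
        ∑ j ∈ Finset.range (len E t - (m + 1)), (1 / 2 : ℝ) ^ j := by rw [Finset.mul_sum]
    _ ≤ ((E.k + 2) * (thr (lev E t m) * (1 / 2 : ℝ) ^ E.C)) * 2 := by
        refine mul_le_mul_of_nonneg_left (sum_half_pow_le _) ?_
        have := thr_pos (lev E t m)
        positivity
    _ = ((E.k + 2) * (2 * (1 / 2 : ℝ) ^ E.C)) * thr (lev E t m) := by ring
    _ ≤ _ := mul_le_mul_of_nonneg_right (half_C ok) (thr_pos _).le

theorem all_sum (ok : E.Ok W) {t : ℕ} :
    ∑ e ∈ Finset.range (len E t), (E.k + 2) * (1 / 2 : ℝ) ^ (lev E t e).1 ≤ 1 / 2 := by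
  calc _ ≤ ∑ j ∈ Finset.range (len E t),
        ((E.k + 2) * (1 / 2 : ℝ) ^ E.C) * (1 / 2 : ℝ) ^ j := by
          refine Finset.sum_le_sum fun j hj => ?_
          rw [Finset.mem_range] at hj
          rw [mul_assoc, ← pow_add]
          refine mul_le_mul_of_nonneg_left ?_ (by positivity)
          exact pow_le_pow_of_le_one (by norm_num) (by norm_num) (p_grow0 ok hj)
    _ = ((E.k + 2) * (1 / 2 : ℝ) ^ E.C) *
        ∑ j ∈ Finset.range (len E t), (1 / 2 : ℝ) ^ j := by rw [Finset.mul_sum]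
    _ ≤ ((E.k + 2) * (1 / 2 : ℝ) ^ E.C) * 2 :=
        mul_le_mul_of_nonneg_left (sum_half_pow_le _) (by positivity)
    _ = ((E.k + 2) * (2 * (1 / 2 : ℝ) ^ E.C)) := by ring
    _ ≤ _ := half_C ok

theorem gl_sum (ok : E.Ok W) (N : ℕ) :
    ∑ t ∈ moves E N, gl E W (kill E N t) t ≤
      1 / 2 * (∑ t ∈ moves E N, thr (lev E t (mv E t))) + 1 / 2 := by
  have hmem : ∀ t ∈ moves E N, t < N ∧ mv E t < len E t := fun t ht => by
    simpa [moves] using ht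
  rw [← Finset.sum_fiberwise_of_maps_to (g := kill E N) (t := Finset.range (N + 1))
    (fun t ht => Finset.mem_range.2
      (Nat.lt_succ_of_le (kill_spec (hmem t ht).1 (hmem t ht).2).2.2.1))]
  rw [Finset.sum_range_succ]
  refine add_le_add ?_ ?_
  · rw [Finset.mul_sum, moves, Finset.sum_filter]
    refine Finset.sum_le_sum fun T hT => ?_
    rw [Finset.mem_range] at hT
    by_cases hmT : mv E T < len E T
    · rw [if_pos hmT]
      refine le_trans ?_ (deep_sum ok)
      rw [← Finset.sum_fiberwise_of_maps_to (g := mv E)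
        (t := Finset.Ico (mv E T + 1) (len E T))]
      · refine Finset.sum_le_sum fun e _ => ?_
        refine le_trans (le_of_eq ?_) (run_sum ok e T (((moves E N).filter
          (fun t => kill E N t = T)).filter (fun t => mv E t = e)) ?_)
        · refine Finset.sum_congr rfl fun t ht => ?_
          simp only [Finset.mem_filter] at ht
          rw [ht.1.2]
        · intro t ht
          simp only [Finset.mem_filter] at ht
          obtain ⟨h1, h2⟩ := hmem t ht.1.1
          obtain ⟨k1, k2, k3, k4, k5⟩ := kill_spec h1 h2
          rw [ht.1.2] at k1 k2
          exact ⟨k1, h2, ht.2, k2⟩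
      · intro t ht
        simp only [Finset.mem_filter] at ht
        obtain ⟨h1, h2⟩ := hmem t (by simp only [moves, Finset.mem_filter]; exact ht.1)
        obtain ⟨k1, k2, k3, k4, k5⟩ := kill_spec h1 h2
        rw [ht.2] at k4 k5
        rw [Finset.mem_Ico]
        exact ⟨k5 hT, k4⟩
    · rw [if_neg hmT]
      rw [Finset.sum_eq_zero]
      intro t ht
      exfalso
      simp only [Finset.mem_filter] at ht
      obtain ⟨h1, h2⟩ := hmem t (by simp only [moves, Finset.mem_filter]; exact ht.1)
      obtain ⟨k1, k2, k3, k4, k5⟩ := kill_spec h1 h2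
      rw [ht.2] at k4 k5
      have := k5 hT
      omega
  · refine le_trans ?_ (all_sum ok (t := N))
    rw [← Finset.sum_fiberwise_of_maps_to (g := mv E) (t := Finset.range (len E N))]
    · refine Finset.sum_le_sum fun e _ => ?_
      refine le_trans (le_of_eq ?_) (run_sum ok e N (((moves E N).filter
        (fun t => kill E N t = N)).filter (fun t => mv E t = e)) ?_)
      · refine Finset.sum_congr rfl fun t ht => ?_
        simp only [Finset.mem_filter] at ht
        rw [ht.1.2]
      · intro t ht
        simp only [Finset.mem_filter] at ht
        obtain ⟨h1, h2⟩ := hmem t ht.1.1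
        obtain ⟨k1, k2, k3, k4, k5⟩ := kill_spec h1 h2
        rw [ht.1.2] at k1 k2
        exact ⟨k1, h2, ht.2, k2⟩
    · intro t ht
      simp only [Finset.mem_filter] at ht
      obtain ⟨h1, h2⟩ := hmem t ht.1
      obtain ⟨k1, k2, k3, k4, k5⟩ := kill_spec h1 h2
      rw [ht.2] at k4
      exact Finset.mem_range.2 k4

/-- the total cost of all moves is bounded -/
theorem total_cost (ok : E.Ok W) (N : ℕ) :
    ∑ t ∈ moves E N, thr (lev E t (mv E t)) ≤ 2 * E.k + 1 := by
  have h1 : ∑ t ∈ moves E N, thr (lev E t (mv E t)) ≤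
      ∑ t ∈ moves E N, ((if isNT E t then mass W (key E t \ cset E (ti E t) (kill E N t) 0) else 0)
        + gl E W (kill E N t) t) := by
    refine Finset.sum_le_sum fun t _ => ?_
    unfold gl
    split_ifs with h
    · have h2 := trig_spec ok h.2.1
      have h3 : mass W (key E t) = mass W (key E t \ cset E (ti E t) (kill E N t) 0) +
          mass W (key E t ∩ cset E (ti E t) (kill E N t) 0) := by
        unfold mass
        rw [add_comm]
        exact (Finset.sum_inter_add_sum_sdiff _ _ _).symm
      rw [← h3]
      exact h2.le
    · simp
  rw [Finset.sum_add_distrib, ← Finset.sum_filter] at h1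
  have h2 := lost_sum ok N
  have h3 := gl_sum ok N
  linarith

end

section
/-! ### Computability of the construction -/

section prim
variable {α β σ : Type} [Primcodable α] [Primcodable β] [Primcodable σ]

theorem p_sum {f : α → ℕ} {g : α → ℕ → ℕ} (hf : Primrec f)
    (hg : Primrec fun p : α × ℕ => g p.1 p.2) :
    Primrec fun x => ∑ a ∈ Finset.range (f x), g x a := by
  have : Primrec fun x => Nat.rec (motive := fun _ => ℕ) 0 (fun n acc => acc + g x n) (f x) :=
    Primrec.nat_rec' (h := fun x (p : ℕ × ℕ) => p.2 + g x p.1) hf (Primrec.const 0)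
      (Primrec.nat_add.comp (Primrec.snd.comp Primrec.snd)
        (hg.comp (Primrec.pair Primrec.fst (Primrec.fst.comp Primrec.snd))))
  refine this.of_eq fun x => ?_
  induction f x with
  | zero => simp
  | succ n ih => rw [Finset.sum_range_succ, ← ih]

theorem p_elim {o : α → Option β} {d : α → σ} {g : α → β → σ} (ho : Primrec o) (hd : Primrec d)
    (hg : Primrec fun p : α × β => g p.1 p.2) : Primrec fun x => (o x).elim (d x) (g x) := by
  refine (Primrec.option_casesOn (g := g) ho hd hg).of_eq fun x => ?_
  cases o x <;> rfl

theorem p_findIdx {l : α → List β} {p : α → β → Bool} (hl : Primrec l)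
    (hp : Primrec fun q : α × β => p q.1 q.2) : Primrec fun x => (l x).findIdx (p x) :=
  Primrec.list_findIdx hl hp

theorem p_any {l : α → List β} {p : α → β → Bool} (hl : Primrec l)
    (hp : Primrec fun q : α × β => p q.1 q.2) : Primrec fun x => (l x).any (p x) := by
  have h := Primrec.nat_lt.decide.comp (p_findIdx hl hp) (Primrec.list_length.comp hl)
  refine h.of_eq fun x => ?_
  rw [Bool.eq_iff_iff, decide_eq_true_iff, List.findIdx_lt_length, List.any_eq_true]

theorem p_not {f : α → Bool} (hf : Primrec f) : Primrec fun x => !f x := Primrec.not.comp hf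
theorem p_and {f g : α → Bool} (hf : Primrec f) (hg : Primrec g) : Primrec fun x => f x && g x :=
  Primrec.and.comp hf hg
theorem p_or {f g : α → Bool} (hf : Primrec f) (hg : Primrec g) : Primrec fun x => f x || g x :=
  Primrec.or.comp hf hg

theorem p_all {l : α → List β} {p : α → β → Bool} (hl : Primrec l)
    (hp : Primrec fun q : α × β => p q.1 q.2) : Primrec fun x => (l x).all (p x) := by
  refine (p_not (p_any (p := fun x y => !p x y) hl (p_not hp))).of_eq fun x => ?_
  simp [List.all_eq_not_any_not]

theorem p_lt {f g : α → ℕ} (hf : Primrec f) (hg : Primrec g) :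
    Primrec fun x => decide (f x < g x) := Primrec.nat_lt.decide.comp hf hg
theorem p_le {f g : α → ℕ} (hf : Primrec f) (hg : Primrec g) :
    Primrec fun x => decide (f x ≤ g x) := Primrec.nat_le.decide.comp hf hg
theorem p_eq [DecidableEq β] {f g : α → β} (hf : Primrec f) (hg : Primrec g) :
    Primrec fun x => decide (f x = g x) := Primrec.eq.decide.comp hf hg
theorem p_add {f g : α → ℕ} (hf : Primrec f) (hg : Primrec g) : Primrec fun x => f x + g x :=
  Primrec.nat_add.comp hf hg
theorem p_sub {f g : α → ℕ} (hf : Primrec f) (hg : Primrec g) : Primrec fun x => f x - g x :=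
  Primrec.nat_sub.comp hf hg
theorem p_mul {f g : α → ℕ} (hf : Primrec f) (hg : Primrec g) : Primrec fun x => f x * g x :=
  Primrec.nat_mul.comp hf hg
theorem p_len {f : α → List β} (hf : Primrec f) : Primrec fun x => (f x).length :=
  Primrec.list_length.comp hf
theorem p_fst {f : α → β × σ} (hf : Primrec f) : Primrec fun x => (f x).1 := Primrec.fst.comp hf
theorem p_snd {f : α → β × σ} (hf : Primrec f) : Primrec fun x => (f x).2 := Primrec.snd.comp hf
theorem p_pow2 {f : α → ℕ} (hf : Primrec f) : Primrec fun x => 2 ^ f x := primrec_pow2.comp hf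
theorem p_map {f : α → List β} {g : α → β → σ} (hf : Primrec f)
    (hg : Primrec fun q : α × β => g q.1 q.2) : Primrec fun x => (f x).map (g x) :=
  Primrec.list_map hf hg
theorem p_range {f : α → ℕ} (hf : Primrec f) : Primrec fun x => List.range (f x) :=
  Primrec.list_range.comp hf
theorem p_cond {c : α → Bool} {f g : α → σ} (hc : Primrec c) (hf : Primrec f) (hg : Primrec g) :
    Primrec fun x => bif c x then f x else g x := Primrec.cond hc hf hg
theorem p_repl {f : α → ℕ} (hf : Primrec f) : Primrec fun x => List.replicate (f x) false := by
  refine (p_map (g := fun _ _ => false) (p_range hf) (Primrec.const false)).of_eq fun x => ?_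
  simp
theorem p_getD {l : α → List β} {n : α → ℕ} (d : β) (hl : Primrec l) (hn : Primrec n) :
    Primrec fun x => (l x).getD (n x) d := (Primrec.list_getD d).comp hl hn
theorem p_take {l : α → List β} {n : α → ℕ} (hl : Primrec l) (hn : Primrec n) :
    Primrec fun x => (l x).take (n x) := Primrec.list_take.comp hn hl
theorem p_append {l m : α → List β} (hl : Primrec l) (hn : Primrec m) :
    Primrec fun x => l x ++ m x := Primrec.list_append.comp hl hn
theorem p_cons {l : α → List β} {m : α → β} (hm : Primrec m) (hl : Primrec l) :
    Primrec fun x => m x :: l x := Primrec.list_cons.comp hm hl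
theorem p_last {l : α → List β} (hl : Primrec l) : Primrec fun x => (l x).getLast? := by
  refine (Primrec.list_head?.comp (Primrec.list_reverse.comp hl)).of_eq fun x => ?_
  simp
end prim

/-- the approximations are primitive recursive -/
structure Env.Pr (E : Env) : Prop where
  D : Primrec fun p : ℕ × ℕ => E.D p.1 p.2
  AS : Primrec fun p : ℕ × ℕ × ℕ => E.AS p.1 p.2.1 p.2.2
  HS : Primrec fun p : ℕ × ℕ => E.HS p.1 p.2

section
variable {E : Env} {α : Type} [Primcodable α]

theorem p_D (pr : E.Pr) {s a : α → ℕ} (hs : Primrec s) (ha : Primrec a) :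
    Primrec fun x => E.D (s x) (a x) := pr.D.comp (Primrec.pair hs ha)
theorem p_HS (pr : E.Pr) {s a : α → ℕ} (hs : Primrec s) (ha : Primrec a) :
    Primrec fun x => E.HS (s x) (a x) := pr.HS.comp (Primrec.pair hs ha)

theorem p_resA (pr : E.Pr) {i s n : α → ℕ} (hi : Primrec i) (hs : Primrec s) (hn : Primrec n) :
    Primrec fun x => resA E (i x) (s x) (n x) :=
  p_map (g := fun x y => E.AS (i x) (s x) y) (p_range hn)
    (pr.AS.comp (Primrec.pair (hi.comp Primrec.fst) (Primrec.pair (hs.comp Primrec.fst) Primrec.snd)))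

theorem p_resB {B : α → List ℕ} {n : α → ℕ} (hB : Primrec B) (hn : Primrec n) :
    Primrec fun x => resB (B x) (n x) :=
  p_map (g := fun z x => (B z).any (fun y => decide (y = x))) (p_range hn)
    (p_any (l := fun q : α × ℕ => B q.1) (p := fun q y => decide (y = q.2)) (hB.comp Primrec.fst)
      (p_eq Primrec.snd (Primrec.snd.comp Primrec.fst)))

theorem p_curB (pr : E.Pr) {i s y a : α → ℕ} (hi : Primrec i) (hs : Primrec s) (hy : Primrec y)
    (ha : Primrec a) : Primrec fun x => curB E (i x) (s x) (y x) (a x) :=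
  p_elim (g := fun x (v : ℕ × Str) => decide (v.2 = resA E (i x) (s x) v.2.length) &&
      decide (y x < v.2.length)) (p_D pr hs ha) (Primrec.const false)
    (p_and (p_eq (p_snd Primrec.snd) (p_resA pr (hi.comp Primrec.fst) (hs.comp Primrec.fst)
        (p_len (p_snd Primrec.snd))))
      (p_lt (hy.comp Primrec.fst) (p_len (p_snd Primrec.snd))))

theorem p_untB (pr : E.Pr) {i s b a : α → ℕ} {log : α → List LogE} (hi : Primrec i)
    (hs : Primrec s) (hl : Primrec log) (hb : Primrec b)
    (ha : Primrec a) : Primrec fun x => untB E (i x) (s x) (log x) (b x) (a x) := by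
  have h2 : Primrec fun q : α × ℕ × Str => q.2.2 := p_snd Primrec.snd
  have hn : Primrec fun q : (α × ℕ × Str) × LogE => q.1.2.2.length :=
    p_len (h2.comp Primrec.fst)
  have hx : Primrec fun q : (α × ℕ × Str) × LogE => q.1.1 := p_fst Primrec.fst
  refine p_elim (g := fun x (v : ℕ × Str) => decide (v.2 = List.replicate v.2.length false) &&
      decide (v.2.length ≤ b x) &&
      !((log x).any fun e => decide (e.1 = i x) && (E.D e.2.1 (a x)).isSome &&
        decide (v.2.length ≤ e.2.2) &&
        decide (resA E (i x) e.2.1 v.2.length = resA E (i x) (s x) v.2.length)))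
        (p_D pr hs ha) (Primrec.const false) ?_
  refine p_and (p_and (p_eq h2 (p_repl (p_len h2))) (p_le (p_len h2) (hb.comp Primrec.fst))) ?_
  refine p_not (p_any (p := fun (q : α × ℕ × Str) (e : LogE) =>
    decide (e.1 = i q.1) && (E.D e.2.1 (a q.1)).isSome &&
        decide (q.2.2.length ≤ e.2.2) &&
        decide (resA E (i q.1) e.2.1 q.2.2.length = resA E (i q.1) (s q.1) q.2.2.length))
        (hl.comp Primrec.fst) ?_)
  refine p_and (p_and (p_and (p_eq (p_fst Primrec.snd) (hi.comp hx)) ?_)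
    (p_le hn (p_snd (p_snd Primrec.snd)))) ?_
  · exact Primrec.option_isSome.comp (p_D pr (p_fst (p_snd Primrec.snd)) (ha.comp hx))
  · exact p_eq (p_resA pr (hi.comp hx) (p_fst (p_snd Primrec.snd)) hn)
      (p_resA pr (hi.comp hx) (hs.comp hx) hn)

theorem p_wt (pr : E.Pr) {s a : α → ℕ} (hs : Primrec s) (ha : Primrec a) :
    Primrec fun x => wt E (s x) (a x) :=
  p_elim (g := fun x (v : ℕ × Str) => 2 ^ (s x - v.1)) (p_D pr hs ha) (Primrec.const 0)
    (p_pow2 (p_sub (hs.comp Primrec.fst) (p_fst Primrec.snd)))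

theorem p_Qm (pr : E.Pr) {i s y : α → ℕ} (hi : Primrec i) (hs : Primrec s) (hy : Primrec y) :
    Primrec fun x => Qm E (i x) (s x) (y x) :=
  p_sum (g := fun x a => bif curB E (i x) (s x) (y x) a then wt E (s x) a else 0) hs
    (p_cond (p_curB pr (hi.comp Primrec.fst) (hs.comp Primrec.fst) (hy.comp Primrec.fst)
      Primrec.snd) (p_wt pr (hs.comp Primrec.fst) Primrec.snd) (Primrec.const 0))

theorem p_Vm (pr : E.Pr) {i s b : α → ℕ} {log : α → List LogE} (hi : Primrec i)
    (hs : Primrec s) (hl : Primrec log) (hb : Primrec b) :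
    Primrec fun x => Vm E (i x) (s x) (log x) (b x) :=
  p_sum (g := fun x a => bif untB E (i x) (s x) (log x) (b x) a then wt E (s x) a else 0) hs
    (p_cond (p_untB pr (hi.comp Primrec.fst) (hs.comp Primrec.fst) (hl.comp Primrec.fst)
      (hb.comp Primrec.fst) Primrec.snd) (p_wt pr (hs.comp Primrec.fst) Primrec.snd)
      (Primrec.const 0))

theorem p_base {log : α → List LogE} {i : α → ℕ} (hl : Primrec log) (hi : Primrec i) :
    Primrec fun x => base (log x) (i x) :=
  Primrec.list_foldr (h := fun x (q : LogE × ℕ) => bif decide (q.1.1 = i x) then q.1.2.1 else q.2)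
    hl (Primrec.const 0)
    (p_cond (p_eq (p_fst (p_fst Primrec.snd)) (hi.comp Primrec.fst))
      (p_fst (p_snd (p_fst Primrec.snd))) (p_snd Primrec.snd))

theorem p_trigI (pr : E.Pr) {s : α → ℕ} {L : α → Lev} (hs : Primrec s) (hL : Primrec L) :
    Primrec fun x => trigI E (s x) (L x) := by
  have hL' : Primrec fun q : α × ℕ => L q.1 := hL.comp Primrec.fst
  have hs' : Primrec fun q : α × ℕ => s q.1 := hs.comp Primrec.fst
  exact p_findIdx (p := fun x i => decide (2 ^ s x < Qm E i (s x) (L x).2.2.1 * 2 ^ ((L x).1 + (L x).2.1)))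
    (p_range (Primrec.const E.k))
    (p_lt (p_pow2 hs') (p_mul (p_Qm pr Primrec.snd hs' (p_fst (p_snd (p_snd hL'))))
      (p_pow2 (p_add (p_fst hL') (p_fst (p_snd hL'))))))

theorem p_unp {f : α → ℕ} (hf : Primrec f) : Primrec fun x => (f x).unpair := Primrec.unpair.comp hf

theorem p_RB (pr : E.Pr) {s e : α → ℕ} {L : α → Lev} {B : α → List ℕ} (hs : Primrec s)
    (hB : Primrec B) (he : Primrec e) (hL : Primrec L) :
    Primrec fun x => RB E (s x) (B x) (e x) (L x) := by
  refine p_and (p_lt (p_fst (p_unp he)) (Primrec.const _)) ?_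
  refine p_all (p := fun x a => (E.D (s x) a).elim true (fun v =>
    !(decide (v.2.length ≤ (L x).2.2.1) && decide (v.2 = resB (B x) v.2.length)) ||
    (List.range (s x)).any (fun a' => (E.D (s x) a').elim false (fun v' =>
      decide (v'.2 = resA E (e x).unpair.1 (s x) v.2.length) && decide (v'.1 ≤ v.1 + (e x).unpair.2)))))
    (p_range hs) ?_
  refine p_elim (g := fun (q : α × ℕ) (v : ℕ × Str) =>
    !(decide (v.2.length ≤ (L q.1).2.2.1) && decide (v.2 = resB (B q.1) v.2.length)) ||
    (List.range (s q.1)).any (fun a' => (E.D (s q.1) a').elim false (fun v' =>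
      decide (v'.2 = resA E (e q.1).unpair.1 (s q.1) v.2.length) &&
        decide (v'.1 ≤ v.1 + (e q.1).unpair.2))))
    (p_D pr (hs.comp Primrec.fst) Primrec.snd) (Primrec.const true) ?_
  have hx : Primrec fun q : (α × ℕ) × ℕ × Str => q.1.1 := p_fst Primrec.fst
  have hv : Primrec fun q : (α × ℕ) × ℕ × Str => q.2.2 := p_snd Primrec.snd
  refine p_or (p_not (p_and (p_le (p_len hv) (p_fst (p_snd (p_snd (hL.comp hx)))))
    (p_eq hv (p_resB (hB.comp hx) (p_len hv))))) ?_
  refine p_any (p := fun (q : (α × ℕ) × ℕ × Str) a' => (E.D (s q.1.1) a').elim false (fun v' =>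
      decide (v'.2 = resA E (e q.1.1).unpair.1 (s q.1.1) q.2.2.length) &&
        decide (v'.1 ≤ q.2.1 + (e q.1.1).unpair.2))) (p_range (hs.comp hx)) ?_
  refine p_elim (g := fun (q : ((α × ℕ) × ℕ × Str) × ℕ) v' =>
      decide (v'.2 = resA E (e q.1.1.1).unpair.1 (s q.1.1.1) q.1.2.2.length) &&
        decide (v'.1 ≤ q.1.2.1 + (e q.1.1.1).unpair.2))
    (p_D pr (hs.comp (hx.comp Primrec.fst)) Primrec.snd) (Primrec.const false) ?_
  have hq : Primrec fun q : (((α × ℕ) × ℕ × Str) × ℕ) × ℕ × Str => q.1.1 := p_fst Primrec.fst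
  have hx' : Primrec fun q : (((α × ℕ) × ℕ × Str) × ℕ) × ℕ × Str => q.1.1.1.1 := hx.comp hq
  exact p_and (p_eq (p_snd Primrec.snd) (p_resA pr (p_fst (p_unp (he.comp hx'))) (hs.comp hx')
    (p_len (hv.comp hq)))) (p_le (p_fst Primrec.snd) (p_add (p_fst (p_snd hq))
      (p_snd (p_unp (he.comp hx')))))

theorem p_viol (pr : E.Pr) {s e : α → ℕ} {L : α → Lev} {B : α → List ℕ} (hs : Primrec s)
    (hB : Primrec B) (he : Primrec e) (hL : Primrec L) :
    Primrec fun x => viol E (s x) (B x) (e x) (L x) :=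
  p_or (p_lt (p_trigI pr hs hL) (Primrec.const _))
    (p_or (p_and (p_HS pr hs he) (p_not (p_fst (p_snd (p_snd (p_snd hL))))))
      (p_RB pr hs hB he hL))

theorem p_trtB (pr : E.Pr) {s : α → ℕ} {L : α → Lev} (hs : Primrec s) (hL : Primrec L) :
    Primrec fun x => trtB E (s x) (L x) := by
  have hlog : Primrec fun x => (L x).2.2.2.2 := p_snd (p_snd (p_snd (p_snd hL)))
  have ht := p_trigI pr hs hL
  have hb := p_base hlog ht
  exact p_lt (p_Vm pr ht hs hlog hb) (p_mul (p_Qm pr ht hs hb) (p_pow2 (p_fst hL)))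

theorem p_upd (pr : E.Pr) {s e : α → ℕ} {L : α → Lev} (hs : Primrec s) (he : Primrec e)
    (hL : Primrec L) : Primrec fun x => upd E (s x) (e x) (L x) := by
  have hlog : Primrec fun x => (L x).2.2.2.2 := p_snd (p_snd (p_snd (p_snd hL)))
  have ht := p_trigI pr hs hL
  have hb := p_base hlog ht
  have h1 := p_fst hL
  have h2 := p_fst (p_snd hL)
  have h2' := p_add h2 (Primrec.const 1)
  have hH := p_HS pr hs he
  exact p_cond (p_lt ht (Primrec.const _))
    (p_cond (p_trtB pr hs hL)
      (h1.pair (h2'.pair (hs.pair (hH.pair (p_cons (ht.pair (hs.pair hb)) hlog)))))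
      (h1.pair (h2.pair (hs.pair (hH.pair hlog)))))
    (h1.pair (h2'.pair (hs.pair (hH.pair hlog))))

theorem p_newp {Ls : α → List Lev} (h : Primrec Ls) : Primrec fun x => newp E (Ls x) :=
  p_elim (g := fun _ (L : Lev) => L.1 + L.2.1 + E.C) (p_last h) (Primrec.const _)
    (p_add (p_add (p_fst Primrec.snd) (p_fst (p_snd Primrec.snd))) (Primrec.const _))

theorem p_mvIdx (pr : E.Pr) {s : α → ℕ} {S : α → Sta} (hs : Primrec s) (hS : Primrec S) :
    Primrec fun x => mvIdx E (s x) (S x) :=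
  p_findIdx (p := fun x e => viol E (s x) (S x).1 e ((S x).2.getD e default))
    (p_range (p_len (p_snd hS)))
    (p_viol pr (hs.comp Primrec.fst) (p_fst (hS.comp Primrec.fst)) Primrec.snd
      (p_getD default (p_snd (hS.comp Primrec.fst)) Primrec.snd))

theorem p_step (pr : E.Pr) {s : α → ℕ} {S : α → Sta} (hs : Primrec s) (hS : Primrec S) :
    Primrec fun x => step E (s x) (S x) := by
  have hm := p_mvIdx pr hs hS
  have h2 := p_snd hS
  have h1 := p_fst hS
  have hg := p_getD (default : Lev) h2 hm
  exact p_cond (p_lt hm (p_len h2))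
    ((p_cons (p_fst (p_snd (p_snd hg))) h1).pair
      (p_append (p_take h2 hm) (p_cons (p_upd pr hs hm hg) (Primrec.const []))))
    (h1.pair (p_append h2 (p_cons ((p_newp h2).pair ((Primrec.const 0).pair
      (hs.pair ((p_HS pr hs (p_len h2)).pair (Primrec.const []))))) (Primrec.const []))))

theorem p_St (pr : E.Pr) {s : α → ℕ} (hs : Primrec s) : Primrec fun x => St E (s x) := by
  have : Primrec (St E) :=
    Primrec.nat_rec₁ (f := fun t S => step E t S) ([], []) (p_step pr Primrec.fst Primrec.snd)
  exact this.comp hs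

theorem p_mv (pr : E.Pr) {s : α → ℕ} (hs : Primrec s) : Primrec fun x => mv E (s x) :=
  p_mvIdx pr hs (p_St pr hs)
theorem p_Bs (pr : E.Pr) {s : α → ℕ} (hs : Primrec s) : Primrec fun x => Bs E (s x) :=
  p_fst (p_St pr hs)
theorem p_slen (pr : E.Pr) {s : α → ℕ} (hs : Primrec s) : Primrec fun x => len E (s x) :=
  p_len (p_snd (p_St pr hs))
theorem p_lev (pr : E.Pr) {s e : α → ℕ} (hs : Primrec s) (he : Primrec e) :
    Primrec fun x => lev E (s x) (e x) :=
  p_getD _ (p_snd (p_St pr hs)) he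
theorem p_mk (pr : E.Pr) {s e : α → ℕ} (hs : Primrec s) (he : Primrec e) :
    Primrec fun x => mk E (s x) (e x) := p_fst (p_snd (p_snd (p_lev pr hs he)))
theorem p_lg (pr : E.Pr) {s e : α → ℕ} (hs : Primrec s) (he : Primrec e) :
    Primrec fun x => lg E (s x) (e x) := p_snd (p_snd (p_snd (p_snd (p_lev pr hs he))))
end

end

section
/-! ### The approximations attached to a machine and a family of c.e. sets -/

/-- `E` approximates `U`, the sets `A i` and the halting problem -/
structure Env.For (E : Env) (U : Str →. Str) (A : ℕ → Set ℕ) : Prop where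
  sound : ∀ {s a v}, E.D s a = Option.some v → ∃ τ : Str, Encodable.encode τ = a ∧ τ.length = v.1 ∧ v.2 ∈ U τ
  compl : ∀ {τ ρ : Str}, ρ ∈ U τ → ∃ s, E.D s (Encodable.encode τ) = Option.some (τ.length, ρ)
  AS : ∀ {i x}, i < E.k → (x ∈ A i ↔ ∃ s, E.AS i s x = true)
  HS : ∀ {x}, x ∈ haltingSet ↔ ∃ s, E.HS s x = true

open Nat.Partrec (Code)
open Nat.Partrec.Code (evaln)

def mkD (c : Code) (s a : ℕ) : Option (ℕ × Str) :=
  (Encodable.decode a : Option Str).bind fun τ => (evaln s c a).bind fun y =>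
    (Encodable.decode y : Option Str).bind fun ρ =>
      bif (decide (Encodable.encode τ = a) && decide (a < s) && decide (τ.length ≤ s) &&
        decide (ρ.length ≤ s)) then Option.some (τ.length, ρ) else Option.none

def mkAS (cl : List Code) (i s x : ℕ) : Bool :=
  (cl[i]?).elim false (fun c => (evaln s c x).isSome)

def mkHS (s x : ℕ) : Bool := (evaln s (Denumerable.ofNat Code x) x).isSome

theorem p_evaln {α : Type} [Primcodable α] {s x : α → ℕ} {c : α → Code} (hs : Primrec s)
    (hc : Primrec c) (hx : Primrec x) : Primrec fun z => evaln (s z) (c z) (x z) :=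
  Nat.Partrec.Code.primrec_evaln.comp ((hs.pair hc).pair hx)

theorem mkD_prim (c : Code) : Primrec fun p : ℕ × ℕ => mkD c p.1 p.2 := by
  unfold mkD
  refine Primrec.option_bind (Primrec.decode.comp Primrec.snd) ?_
  refine Primrec.option_bind (p_evaln (p_fst Primrec.fst) (Primrec.const c) (p_snd Primrec.fst)) ?_
  refine Primrec.option_bind (Primrec.decode.comp Primrec.snd) ?_
  have h1 : Primrec fun q : (((ℕ × ℕ) × Str) × ℕ) × Str => q.1.1.2 := p_snd (p_fst Primrec.fst)
  have h2 : Primrec fun q : (((ℕ × ℕ) × Str) × ℕ) × Str => q.1.1.1.2 :=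
    p_snd (p_fst (p_fst Primrec.fst))
  have h3 : Primrec fun q : (((ℕ × ℕ) × Str) × ℕ) × Str => q.1.1.1.1 :=
    p_fst (p_fst (p_fst Primrec.fst))
  exact p_cond (p_and (p_and (p_and (p_eq (Primrec.encode.comp h1) h2) (p_lt h2 h3))
    (p_le (p_len h1) h3)) (p_le (p_len Primrec.snd) h3))
    (Primrec.option_some.comp ((p_len h1).pair Primrec.snd)) (Primrec.const Option.none)

theorem mkAS_prim (cl : List Code) : Primrec fun p : ℕ × ℕ × ℕ => mkAS cl p.1 p.2.1 p.2.2 :=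
  p_elim (g := fun (p : ℕ × ℕ × ℕ) c => (evaln p.2.1 c p.2.2).isSome)
    ((Primrec.list_getElem?₁ cl).comp Primrec.fst) (Primrec.const false)
    (Primrec.option_isSome.comp (p_evaln (p_fst (p_snd Primrec.fst)) Primrec.snd
      (p_snd (p_snd Primrec.fst))))

theorem mkHS_prim : Primrec fun p : ℕ × ℕ => mkHS p.1 p.2 :=
  Primrec.option_isSome.comp (p_evaln Primrec.fst ((Primrec.ofNat Code).comp Primrec.snd) Primrec.snd)

theorem mkD_eq {c : Code} {s a : ℕ} {v : ℕ × Str} : mkD c s a = Option.some v ↔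
    ∃ τ y ρ, (Encodable.decode a : Option Str) = Option.some τ ∧ evaln s c a = Option.some y ∧
      (Encodable.decode y : Option Str) = Option.some ρ ∧ Encodable.encode τ = a ∧ a < s ∧ τ.length ≤ s ∧
      ρ.length ≤ s ∧ v = (τ.length, ρ) := by
  unfold mkD
  simp only [Option.bind_eq_some_iff, Bool.cond_eq_ite, Option.ite_none_right_eq_some,
    Bool.and_eq_true, decide_eq_true_eq, Option.some.injEq]
  constructor
  · rintro ⟨τ, h1, y, h2, ρ, h3, ⟨⟨⟨h4, h5⟩, h6⟩, h7⟩, h8⟩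
    exact ⟨τ, y, ρ, h1, h2, h3, h4, h5, h6, h7, h8.symm⟩
  · rintro ⟨τ, y, ρ, h1, h2, h3, h4, h5, h6, h7, h8⟩
    exact ⟨τ, h1, y, h2, ρ, h3, ⟨⟨⟨h4, h5⟩, h6⟩, h7⟩, h8.symm⟩

theorem evaln_isSome_mono {c : Code} {s t x : ℕ} (h : s ≤ t) (hs : (evaln s c x).isSome = true) :
    (evaln t c x).isSome = true := by
  obtain ⟨y, hy⟩ := Option.isSome_iff_exists.1 hs
  exact Option.isSome_iff_exists.2 ⟨y, Nat.Partrec.Code.evaln_mono h hy⟩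

theorem eval_dom_iff {c : Code} {x : ℕ} : (c.eval x).Dom ↔ ∃ s, (evaln s c x).isSome = true := by
  rw [Part.dom_iff_mem]
  constructor
  · rintro ⟨y, hy⟩
    obtain ⟨s, hs⟩ := Nat.Partrec.Code.evaln_complete.1 hy
    exact ⟨s, Option.isSome_iff_exists.2 ⟨y, hs⟩⟩
  · rintro ⟨s, hs⟩
    obtain ⟨y, hy⟩ := Option.isSome_iff_exists.1 hs
    exact ⟨y, Nat.Partrec.Code.evaln_complete.2 ⟨s, hy⟩⟩

/-- weight of codes -/
noncomputable def mkW (U : Str →. Str) (a : ℕ) : ℝ :=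
  if h : ∃ τ : Str, Encodable.encode τ = a ∧ (U τ).Dom then (1 / 2) ^ h.choose.length else 0

theorem mkW_eq {U : Str →. Str} {τ : Str} (h : (U τ).Dom) :
    mkW U (Encodable.encode τ) = (1 / 2) ^ τ.length := by
  have h' : ∃ τ' : Str, Encodable.encode τ' = Encodable.encode τ ∧ (U τ').Dom := ⟨τ, rfl, h⟩
  rw [mkW, dif_pos h', Encodable.encode_injective h'.choose_spec.1]

theorem mkW_kraft {U : Str →. Str} (hU : PFMachine U) (F : Finset ℕ) : ∑ a ∈ F, mkW U a ≤ 1 := by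
  let P : ℕ → Prop := fun a => ∃ τ : Str, Encodable.encode τ = a ∧ (U τ).Dom
  let S : Finset Str := (F.preimage Encodable.encode Encodable.encode_injective.injOn).filter
    (fun τ => (U τ).Dom)
  have h1 : ∑ a ∈ F, mkW U a = ∑ a ∈ S.image Encodable.encode, mkW U a := by
    symm
    refine Finset.sum_subset ?_ ?_
    · intro a ha
      simp only [S, Finset.mem_image, Finset.mem_filter, Finset.mem_preimage] at ha
      obtain ⟨τ, h, rfl⟩ := ha
      exact h.1
    · intro a ha hn
      rw [mkW, dif_neg]
      rintro ⟨τ, rfl, h⟩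
      exact hn (Finset.mem_image_of_mem _ (Finset.mem_filter.2 ⟨Finset.mem_preimage.2 ha, h⟩))
  rw [h1, Finset.sum_image (fun x _ y _ h => Encodable.encode_injective h)]
  have h2 : ∑ τ ∈ S, mkW U (Encodable.encode τ) = ∑ τ ∈ S, (1 / 2 : ℝ) ^ τ.length :=
    Finset.sum_congr rfl fun τ hτ => mkW_eq (Finset.mem_filter.1 hτ).2
  rw [h2]
  refine kraft_pf S ?_
  intro x hx y hy h
  exact hU.2 x y (Finset.mem_filter.1 hx).2 (Finset.mem_filter.1 hy).2 h

theorem exists_env {U : Str →. Str} (hU : PFMachine U) {k : ℕ} (A : Fin k → Set ℕ)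
    (hA : ∀ i, CESet (A i)) :
    ∃ (E : Env) (W : ℕ → ℝ), E.k = k ∧ E.Ok W ∧ E.Pr ∧
      E.For U (fun i => if h : i < k then A ⟨i, h⟩ else ∅) := by
  obtain ⟨c, hc⟩ := Nat.Partrec.Code.exists_code.1 hU.1
  have hc' : ∀ τ : Str, c.eval (Encodable.encode τ) = Part.map Encodable.encode (U τ) := by
    intro τ
    have := congrFun hc (Encodable.encode τ)
    refine this.trans ?_
    simp only [Encodable.encodek, Part.coe_some, Part.bind_some]
  have hcode : ∀ i, ∃ c : Code, ∀ n, n ∈ A i ↔ (c.eval n).Dom := by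
    intro i
    obtain ⟨f, hf, h⟩ := hA i
    obtain ⟨c, rfl⟩ := Nat.Partrec.Code.exists_code.1 hf
    exact ⟨c, h⟩
  choose cA hcA using hcode
  have hD : ∀ {s a v}, mkD c s a = Option.some v →
      ∃ τ : Str, Encodable.encode τ = a ∧ τ.length = v.1 ∧ v.2 ∈ U τ := by
    intro s a v h
    obtain ⟨τ, y, ρ, h1, h2, h3, h4, h5, h6, h7, rfl⟩ := mkD_eq.1 h
    refine ⟨τ, h4, rfl, ?_⟩
    have := Nat.Partrec.Code.evaln_sound h2
    rw [← h4, hc', Part.mem_map_iff] at this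
    obtain ⟨ρ', h8, rfl⟩ := this
    rw [Encodable.encodek, Option.some.injEq] at h3
    rwa [← h3]
  refine ⟨⟨mkD c, mkAS (List.ofFn cA), mkHS, k, 4 * (k + 2)⟩, mkW U, rfl, ?_, ?_, ?_⟩
  · constructor
    · intro s a v h
      obtain ⟨τ, y, ρ, h1, h2, h3, h4, h5, h6, h7, rfl⟩ := mkD_eq.1 h
      exact h5
    · intro s a v h
      obtain ⟨τ, y, ρ, h1, h2, h3, h4, h5, h6, h7, rfl⟩ := mkD_eq.1 h
      exact h6
    · intro s a v h
      obtain ⟨τ, y, ρ, h1, h2, h3, h4, h5, h6, h7, rfl⟩ := mkD_eq.1 h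
      exact h7
    · intro s t a v hst h
      obtain ⟨τ, y, ρ, h1, h2, h3, h4, h5, h6, h7, rfl⟩ := mkD_eq.1 h
      exact mkD_eq.2 ⟨τ, y, ρ, h1, Nat.Partrec.Code.evaln_mono hst h2, h3, h4, by omega, by omega,
        by omega, rfl⟩
    · intro i s t x hst h
      simp only [mkAS] at h ⊢
      rcases h' : (List.ofFn cA)[i]? with _ | c'
      · simp [h'] at h
      · rw [h'] at h
        exact evaln_isSome_mono hst h
    · intro s t x hst h
      exact evaln_isSome_mono hst h
    · intro a
      unfold mkW; split_ifs <;> positivity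
    · intro s a v h
      obtain ⟨τ, rfl, h2, h3⟩ := hD h
      rw [mkW_eq (Part.dom_iff_mem.2 ⟨_, h3⟩), h2]
    · exact mkW_kraft hU
    · exact Nat.lt_two_pow_self.le
  · exact ⟨mkD_prim c, mkAS_prim _, mkHS_prim⟩
  · constructor
    · exact hD
    · intro τ ρ h
      have : Encodable.encode ρ ∈ c.eval (Encodable.encode τ) := by
        rw [hc', Part.mem_map_iff]
        exact ⟨ρ, h, rfl⟩
      obtain ⟨s, hs⟩ := Nat.Partrec.Code.evaln_complete.1 this
      refine ⟨s + Encodable.encode τ + τ.length + ρ.length + 1, mkD_eq.2 ⟨τ, Encodable.encode ρ, ρ,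
        Encodable.encodek _, Nat.Partrec.Code.evaln_mono (by omega) hs, Encodable.encodek _, rfl,
        by omega, by omega, by omega, rfl⟩⟩
    · intro i x hi
      have hi' : i < k := hi
      rw [dif_pos hi', hcA, eval_dom_iff]
      simp [mkAS, hi']
    · intro x
      exact eval_dom_iff

end

section
/-! ### `B` is `K`-below every `A i` -/

theorem le_KC_add {U : Str →. Str} {ρ : Str} {x c : ℕ∞}
    (h : ∀ τ, ρ ∈ U τ → x ≤ (τ.length : ℕ∞) + c) : x ≤ KC U ρ + c := by
  unfold KC
  rcases isEmpty_or_nonempty {τ : Str // ρ ∈ U τ} with h' | h'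
  · rw [iInf_of_empty]; simp
  · obtain ⟨τ, hτ⟩ := ciInf_mem (fun τ : {τ : Str // ρ ∈ U τ} => ((τ : Str).length : ℕ∞))
    rw [← hτ]
    exact h τ.1 τ.2

variable {E : Env} {W : ℕ → ℝ} {U : Str →. Str} {A : ℕ → Set ℕ}

/-- the constructed set -/
def Bset (E : Env) : Set ℕ := {x | ∃ t, x ∈ Bs E t}

theorem restr_eq {X : Set ℕ} {n : ℕ} {f : ℕ → Bool} (h : ∀ x < n, (f x = true ↔ x ∈ X)) :
    (List.range n).map f = restrSet X n := by
  unfold restrSet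
  refine List.map_congr_left fun x hx => ?_
  rw [List.mem_range] at hx
  rw [Bool.eq_iff_iff, h x hx, decide_eq_true_iff]

theorem lim_aux (P : ℕ → ℕ → Prop) (hm : ∀ x s t, s ≤ t → P s x → P t x) (n : ℕ) :
    ∃ s0, ∀ s ≥ s0, ∀ x < n, (P s x ↔ ∃ u, P u x) := by
  induction n with
  | zero => exact ⟨0, by simp⟩
  | succ n ih =>
    obtain ⟨s0, h0⟩ := ih
    by_cases hn : ∃ u, P u n
    · obtain ⟨u, hu⟩ := hn
      refine ⟨max s0 u, fun s hs x hx => ?_⟩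
      rcases Nat.lt_succ_iff_lt_or_eq.1 hx with h | rfl
      · exact h0 s (by omega) x h
      · exact ⟨fun h => ⟨_, h⟩, fun _ => hm _ _ _ (by omega) hu⟩
    · refine ⟨s0, fun s hs x hx => ?_⟩
      rcases Nat.lt_succ_iff_lt_or_eq.1 hx with h | rfl
      · exact h0 s (by omega) x h
      · exact ⟨fun h => ⟨_, h⟩, fun h => absurd h hn⟩

theorem resA_lim (ok : E.Ok W) (fo : E.For U A) {i : ℕ} (hi : i < E.k) (n : ℕ) :
    ∃ s0, ∀ s ≥ s0, resA E i s n = restrSet (A i) n := by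
  obtain ⟨s0, h⟩ := lim_aux (fun s x => E.AS i s x = true) (fun x s t hst h => ok.ASmono hst h) n
  exact ⟨s0, fun s hs => restr_eq fun x hx => by rw [fo.AS hi]; exact h s hs x hx⟩

theorem any_iff {B : List ℕ} {x : ℕ} : (B.any (fun y => decide (y = x)) = true) ↔ x ∈ B := by
  simp

theorem resB_lim (n : ℕ) : ∃ s0, ∀ s ≥ s0, resB (Bs E s) n = restrSet (Bset E) n := by
  obtain ⟨s0, h⟩ := lim_aux (fun s x => x ∈ Bs E s) (fun x s t hst h => Bs_mono hst h) n
  exact ⟨s0, fun s hs => restr_eq fun x hx => by rw [any_iff]; exact h s hs x hx⟩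

theorem resB_congr {B B' : List ℕ} {n : ℕ} (h : ∀ x < n, (x ∈ B ↔ x ∈ B')) :
    resB B n = resB B' n := by
  unfold resB
  refine List.map_congr_left fun x hx => ?_
  rw [List.mem_range] at hx
  rw [Bool.eq_iff_iff, any_iff, any_iff, h x hx]

@[simp] theorem resB_length (B : List ℕ) (n : ℕ) : (resB B n).length = n := by simp [resB]

theorem req_sum (ok : E.Ok W) (R : ℕ → Option (ℕ × Str)) (G : Finset ℕ) (q : ℝ) (hq : 0 ≤ q)
    (h : ∀ a, R a ≠ Option.none → a ∈ G ∧ rwt (R a) ≤ q * W a) (N : ℕ) :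
    ∑ a ∈ Finset.range N, rwt (R a) ≤ q * mass W G := by
  unfold mass
  rw [Finset.mul_sum]
  have h1 : ∑ a ∈ Finset.range N, rwt (R a) ≤
      ∑ a ∈ Finset.range N, if a ∈ G then q * W a else 0 := by
    refine Finset.sum_le_sum fun a _ => ?_
    by_cases h' : R a = Option.none
    · rw [h']
      simp only [rwt]
      split_ifs
      · exact mul_nonneg hq (ok.W_nonneg a)
      · exact le_rfl
    · rw [if_pos (h a h').1]; exact (h a h').2
  refine h1.trans ?_
  rw [← Finset.sum_filter]
  refine Finset.sum_le_sum_of_subset_of_nonneg ?_ (fun a _ _ => mul_nonneg hq (ok.W_nonneg a))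
  intro a ha
  exact (Finset.mem_filter.1 ha).2

/-- requests of the machine witnessing `B ≤_K A i` -/
def reqB (E : Env) (i t a : ℕ) : Option (ℕ × Str) :=
  (E.D t a).elim Option.none fun v =>
    bif curB E i t 0 a && (!curB E i (t - 1) 0 a ||
      (decide (mv E t < len E t) && curB E i t (mk E t (mv E t)) a)) then
      Option.some (v.1 + E.C, resB (Bs E (t + 1)) v.2.length) else Option.none

theorem reqB_prim (pr : E.Pr) (i : ℕ) : Primrec fun p : ℕ × ℕ => reqB E i p.1 p.2 := by
  have h1 : Primrec fun q : (ℕ × ℕ) × ℕ × Str => q.1.1 := p_fst Primrec.fst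
  have h2 : Primrec fun q : (ℕ × ℕ) × ℕ × Str => q.1.2 := p_snd Primrec.fst
  have hv : Primrec fun q : (ℕ × ℕ) × ℕ × Str => q.2 := Primrec.snd
  refine p_elim (g := fun (p : ℕ × ℕ) (v : ℕ × Str) =>
    bif curB E i p.1 0 p.2 && (!curB E i (p.1 - 1) 0 p.2 ||
      (decide (mv E p.1 < len E p.1) && curB E i p.1 (mk E p.1 (mv E p.1)) p.2)) then
      Option.some (v.1 + E.C, resB (Bs E (p.1 + 1)) v.2.length) else Option.none)
    (p_D pr Primrec.fst Primrec.snd) (Primrec.const Option.none) ?_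
  refine p_cond (p_and (p_curB pr (Primrec.const i) h1 (Primrec.const 0) h2)
    (p_or (p_not (p_curB pr (Primrec.const i) (p_sub h1 (Primrec.const 1)) (Primrec.const 0) h2))
      (p_and (p_lt (p_mv pr h1) (p_slen pr h1))
        (p_curB pr (Primrec.const i) h1 (p_mk pr h1 (p_mv pr h1)) h2))))
    (Primrec.option_some.comp ((p_add (p_fst hv) (Primrec.const _)).pair
      (p_resB (p_Bs pr (p_add h1 (Primrec.const 1))) (p_len (p_snd hv))))) (Primrec.const Option.none)

theorem cur_mem (ok : E.Ok W) {i s x a : ℕ} : curB E i s x a = true ↔ a ∈ cset E i s x := by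
  unfold cset
  rw [Finset.mem_filter, Finset.mem_range]
  refine ⟨fun h => ⟨?_, h⟩, fun h => h.2⟩
  unfold curB at h
  rcases hD : E.D s a with _ | v
  · simp [hD] at h
  · exact ok.lt hD

theorem reqB_eq (ok : E.Ok W) {i t a : ℕ} {y : ℕ × Str} : reqB E i t a = Option.some y ↔
    ∃ v, E.D t a = Option.some v ∧ a ∈ cset E i t 0 ∧ (a ∉ cset E i (t - 1) 0 ∨
      (mv E t < len E t ∧ a ∈ cset E i t (mk E t (mv E t)))) ∧
      y = (v.1 + E.C, resB (Bs E (t + 1)) v.2.length) := by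
  unfold reqB
  rcases hD : E.D t a with _ | v
  · simp
  · simp only [Option.elim_some, Bool.cond_eq_ite, Bool.and_eq_true, Bool.or_eq_true,
      Option.ite_none_right_eq_some, Option.some.injEq, Bool.not_eq_true', decide_eq_true_eq,
      ← Bool.not_eq_true, cur_mem ok]
    constructor
    · rintro ⟨⟨h1, h2⟩, h3⟩
      exact ⟨v, rfl, h1, h2, h3.symm⟩
    · rintro ⟨v', rfl, h1, h2, h3⟩
      exact ⟨⟨h1, h2⟩, h3.symm⟩

/-- the stages at which a description is current form an interval -/
theorem cset_sandwich (ok : E.Ok W) {i s t u a x : ℕ} (h1 : s ≤ t) (h2 : t ≤ u)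
    (hs : a ∈ cset E i s x) (hu : a ∈ cset E i u x) : a ∈ cset E i t x := by
  rw [mem_cset ok] at *
  obtain ⟨v, a1, a2, a3⟩ := hs
  obtain ⟨v', b1, b2, b3⟩ := hu
  have : v' = v := Option.some.inj (b1.symm.trans (ok.mono (h1.trans h2) a1))
  subst this
  refine ⟨v', ok.mono h1 a1, ?_, a3⟩
  rw [resA_sandwich ok h1 h2 (a2.symm.trans b2)]
  exact a2

theorem reqB_sum (ok : E.Ok W) {i : ℕ} (hi : i < E.k) (N : ℕ) :
    ∑ s ∈ Finset.range N, ∑ a ∈ Finset.range N, rwt (reqB E i s a) ≤ 1 := by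
  set F : ℕ → Finset ℕ := fun s => cset E i s 0 \ cset E i (s - 1) 0 with hF
  set G : ℕ → Finset ℕ := fun s => if mv E s < len E s then
    cset E i s (mk E s (mv E s)) ∩ cset E i (s - 1) 0 else ∅ with hG
  have hstage : ∀ s, ∑ a ∈ Finset.range N, rwt (reqB E i s a) ≤
      (1 / 2) ^ E.C * (mass W (F s) + mass W (G s)) := by
    intro s
    have := req_sum ok (reqB E i s) (F s ∪ G s) ((1 / 2) ^ E.C) (by positivity) (fun a ha => by
      rcases h : reqB E i s a with _ | y
      · exact absurd h ha
      · obtain ⟨v, h1, h2, h3, rfl⟩ := (reqB_eq ok).1 h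
        constructor
        · rw [Finset.mem_union]
          by_cases h4 : a ∈ cset E i (s - 1) 0
          · right
            rcases h3 with h3 | ⟨h3, h5⟩
            · exact absurd h4 h3
            · simp only [hG, if_pos h3, Finset.mem_inter]
              exact ⟨h5, h4⟩
          · left
            exact Finset.mem_sdiff.2 ⟨h2, h4⟩
        · simp only [rwt]
          rw [ok.W_eq h1, pow_add, mul_comm]) N
    refine this.trans (mul_le_mul_of_nonneg_left ?_ (by positivity))
    unfold mass
    rw [← Finset.sum_union_inter]
    exact le_add_of_nonneg_right (Finset.sum_nonneg fun a _ => ok.W_nonneg a)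
  have h1 : ∑ s ∈ Finset.range N, mass W (F s) ≤ 1 := by
    refine mass_disj_one ok _ _ ?_
    have key : ∀ x y, x < y → Disjoint (F x) (F y) := by
      intro x y hxy
      rw [Finset.disjoint_left]
      intro a ha hb
      simp only [hF, Finset.mem_sdiff] at ha hb
      exact hb.2 (cset_sandwich ok (by omega) (by omega) ha.1 hb.1)
    intro x _ y _ hxy
    rcases lt_or_gt_of_ne hxy with h | h
    · exact key x y h
    · exact (key y x h).symm
  have h2 : ∑ s ∈ Finset.range N, mass W (G s) ≤ 2 * E.k + 1 := by
    refine le_trans ?_ (total_cost ok N)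
    unfold moves
    rw [Finset.sum_filter]
    refine Finset.sum_le_sum fun s _ => ?_
    by_cases hm : mv E s < len E s
    · rw [if_pos hm]
      simp only [hG, if_pos hm]
      rcases s with _ | t
      · simp [len, St] at hm
      · refine le_trans ?_ (stay ok hm hi)
        refine mass_mono ok ?_
        intro a ha
        rw [Finset.mem_inter, mem_cset ok, mem_cset ok] at ha
        obtain ⟨⟨v, a1, a2, a3⟩, v', b1, b2, b3⟩ := ha
        rw [Nat.add_sub_cancel] at b1 b2
        have : v = v' := Option.some.inj (a1.symm.trans (ok.mono (by omega) b1))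
        subst this
        exact (mem_cset ok).2 ⟨v, b1, b2, a3⟩
    · rw [if_neg hm]
      simp only [hG, if_neg hm]
      simp [mass]
  calc _ ≤ ∑ s ∈ Finset.range N, (1 / 2 : ℝ) ^ E.C * (mass W (F s) + mass W (G s)) :=
        Finset.sum_le_sum fun s _ => hstage s
    _ = (1 / 2 : ℝ) ^ E.C * (∑ s ∈ Finset.range N, mass W (F s) +
          ∑ s ∈ Finset.range N, mass W (G s)) := by
        rw [← Finset.sum_add_distrib, Finset.mul_sum]
    _ ≤ (1 / 2 : ℝ) ^ E.C * (2 * E.k + 2) := by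
        refine mul_le_mul_of_nonneg_left (by linarith) (by positivity)
    _ ≤ 1 := by
        have h : (4 * (E.k + 2) : ℝ) ≤ 2 ^ E.C := by exact_mod_cast ok.hC
        rw [one_div, inv_pow, inv_mul_le_one₀ (by positivity)]
        have : (0 : ℝ) ≤ E.k := by positivity
        linarith

theorem B_le (hU : OptimalPF U) (ok : E.Ok W) (pr : E.Pr) (fo : E.For U A) {i : ℕ} (hi : i < E.k) :
    KLeSet U (Bset E) (A i) := by
  obtain ⟨c, hc⟩ := kc_theorem₂ hU (R := reqB E i) (reqB_prim pr i).to_comp (reqB_sum ok hi)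
  refine ⟨E.C + c, fun n => le_KC_add fun τ hτ => ?_⟩
  rcases Nat.eq_zero_or_pos n with rfl | hn
  · refine (KC_le_of_mem (τ := τ) ?_).trans (by simp)
    simpa [restrSet] using hτ
  set a := Encodable.encode τ with ha
  obtain ⟨s1, h1⟩ := fo.compl hτ
  obtain ⟨s2, h2⟩ := resA_lim ok fo hi n
  have hlen : (restrSet (A i) n).length = n := by simp [restrSet]
  have hcur : ∀ s, s1 ≤ s → s2 ≤ s → a ∈ cset E i s 0 := by
    intro s hs hs'
    refine (mem_cset ok).2 ⟨_, ok.mono hs h1, ?_, ?_⟩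
    · simp only [hlen]; exact (h2 s hs').symm
    · simp only [hlen]; exact hn
  have hex : ∃ s, a ∈ cset E i s 0 := ⟨max s1 s2, hcur _ (by omega) (by omega)⟩
  set s0 := Nat.find hex with hs0
  have hs0' : a ∈ cset E i s0 0 := Nat.find_spec hex
  have hall : ∀ t ≥ s0, a ∈ cset E i t 0 := fun t ht =>
    cset_sandwich ok ht (u := max t (max s1 s2)) (by omega) hs0' (hcur _ (by omega) (by omega))
  have hv : ∀ t ≥ s0, E.D t a = Option.some (τ.length, restrSet (A i) n) := by
    intro t ht
    obtain ⟨v, b1, _⟩ := (mem_cset ok).1 (hall t ht)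
    have e1 := ok.mono (le_max_left t s1) b1
    have e2 := ok.mono (le_max_right t s1) h1
    rw [b1, ← e1, e2]
  have main : ∀ t ≥ s0, ∃ s, reqB E i s a = Option.some (τ.length + E.C, resB (Bs E (t + 1)) n) := by
    intro t ht
    induction t, ht using Nat.le_induction with
    | base =>
      refine ⟨s0, (reqB_eq ok).2 ⟨_, hv s0 le_rfl, hs0', Or.inl ?_, by simp only [hlen]⟩⟩
      have : s0 ≠ 0 := by
        intro h0
        have := ok.lt (hv s0 le_rfl)
        omega
      exact Nat.find_min hex (by omega)
    | succ t ht ih =>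
      by_cases hm : mv E (t + 1) < len E (t + 1) ∧ mk E (t + 1) (mv E (t + 1)) < n
      · refine ⟨t + 1, (reqB_eq ok).2 ⟨_, hv _ (by omega), hall _ (by omega), Or.inr ⟨hm.1, ?_⟩,
          by simp only [hlen]⟩⟩
        obtain ⟨v, b1, b2, b3⟩ := (mem_cset ok).1 (hall (t + 1) (by omega))
        refine (mem_cset ok).2 ⟨v, b1, b2, ?_⟩
        have := hv (t + 1) (by omega)
        rw [b1, Option.some.injEq] at this
        rw [this]
        simp only [hlen]
        exact hm.2
      · obtain ⟨s, hs⟩ := ih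
        refine ⟨s, ?_⟩
        rw [hs]
        congr 2
        refine resB_congr fun x hx => ?_
        obtain ⟨_, _, h3, h4⟩ := lev_at (E := E) (t + 1)
        rcases (mv_le (E := E) (t + 1)).lt_or_eq with h | h
        · rw [(h3 h).2, List.mem_cons]
          have : mk E (t + 1) (mv E (t + 1)) ≠ x := by
            intro h'
            exact hm ⟨h, by omega⟩
          constructor
          · exact Or.inr
          · rintro (h' | h')
            · exact absurd h'.symm this
            · exact h'
        · rw [(h4 h).2]
  obtain ⟨s3, h3⟩ := resB_lim (E := E) n
  obtain ⟨s, hs⟩ := main (max s0 s3) (by omega)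
  rw [h3 _ (by omega)] at hs
  refine (hc _ _ _ _ hs).trans ?_
  push_cast
  rw [add_assoc]

end

section
/-! ### Every level moves only finitely often -/

variable {E : Env} {W : ℕ → ℝ} {U : Str →. Str} {A : ℕ → Set ℕ}

/-- level `e` is created just before `S` and never destroyed afterwards -/
structure Run (E : Env) (e S : ℕ) : Prop where
  pos : 1 ≤ S
  le : ∀ t ≥ S, e ≤ mv E t
  ex : e < len E S
  lg0 : lg E S e = []

theorem Run.lt_len {e S : ℕ} (h : Run E e S) {t : ℕ} (ht : S ≤ t) : e < len E t :=
  persist ht h.ex fun u hu _ => h.le u hu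

theorem mk_ge {e t t' : ℕ} (h : t < t') (he : e < len E t') (hm : mv E t = e) : t ≤ mk E t' e := by
  obtain ⟨_, _, h3⟩ := marker he
  by_contra hn
  have := h3 t (by omega) h
  omega

theorem mk_mono {e s t : ℕ} (h : s ≤ t) (hs : e < len E s) (ht : e < len E t) :
    mk E s e ≤ mk E t e := by
  obtain ⟨h1, h2, _⟩ := marker hs
  exact mk_ge (by omega) ht h2

theorem run_exists {e : ℕ} (h : ∃ S, ∀ t ≥ S, e ≤ mv E t) : ∃ S, Run E e S := by
  have h0 := Nat.find_spec h
  set S0 := Nat.find h with hS0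
  have hlen : len E S0 ≤ e := by
    rcases Nat.eq_zero_or_pos S0 with h1 | h1
    · rw [h1]; simp [len, St]
    · have hmin := Nat.find_min h (m := S0 - 1) (by omega)
      have : mv E (S0 - 1) < e := by
        by_contra hc
        refine hmin fun t ht => ?_
        rcases ht.lt_or_eq with h2 | h2
        · exact h0 t (by omega)
        · rw [← h2]; omega
      have e1 : S0 = (S0 - 1) + 1 := by omega
      rw [e1, len_succ]
      omega
  have h1 := h0 S0 le_rfl
  have h2 := mv_le (E := E) S0
  have h3 : mv E S0 = len E S0 := by omega
  have h4 : mv E S0 = e := by omega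
  refine ⟨S0 + 1, by omega, fun t ht => h0 t (by omega), by rw [len_succ]; omega, ?_⟩
  have := ((lev_at (E := E) S0).2.2.2 h3).1
  rw [h4] at this
  rw [lg, this]

theorem Run.p_eq {e S : ℕ} (h : Run E e S) {t : ℕ} (ht : S ≤ t) : (lev E t e).1 = (lev E S e).1 :=
  (run_mono ht h.ex fun u hu _ => h.le u hu).1

theorem Run.r_mono {e S : ℕ} (h : Run E e S) {t t' : ℕ} (ht : S ≤ t) (htt : t ≤ t') :
    (lev E t e).2.1 ≤ (lev E t' e).2.1 :=
  (run_mono htt (h.lt_len ht) fun u hu _ => h.le u (by omega)).2.1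

theorem base_cons (x : LogE) (log : List LogE) (i : ℕ) :
    base (x :: log) i = if x.1 = i then x.2.1 else base log i := by
  simp only [base, List.foldr_cons, Bool.cond_eq_ite, decide_eq_true_eq]

/-- the treating moves of level `e` for `i` -/
def isT (E : Env) (e i t : ℕ) : Prop :=
  mv E t = e ∧ mv E t < len E t ∧ trigI E t (lev E t e) = i ∧ i < E.k ∧ trtB E t (lev E t e) = true

theorem isT_lg {e i t : ℕ} (h : isT E e i t) :
    lg E (t + 1) e = (i, t, base (lg E t e) i) :: lg E t e := by
  obtain ⟨rfl, h2, rfl, h4, h5⟩ := h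
  have h6 := ((lev_at (E := E) t).2.2.1 h2).1
  rcases upd_cases (E := E) t (mv E t) (lev E t (mv E t)) with ⟨_, _, h'⟩ | ⟨_, b, _⟩ | ⟨a, _⟩
  · rw [lg, h6, h']; rfl
  · rw [h5] at b; exact absurd b (by simp)
  · exact absurd h4 a

theorem lg_succ {e t : ℕ} (he : e < len E t) (hle : e ≤ mv E t) :
    lg E (t + 1) e = lg E t e ∨ ∃ i, isT E e i t := by
  rcases hle.lt_or_eq with h | h
  · left; rw [lg, lev_lt h]; rfl
  · subst h
    have h6 := ((lev_at (E := E) t).2.2.1 he).1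
    rcases upd_cases (E := E) t (mv E t) (lev E t (mv E t)) with ⟨a, b, _⟩ | ⟨_, _, h'⟩ | ⟨_, h'⟩
    · right; exact ⟨_, rfl, he, rfl, a, b⟩
    · left; rw [lg, h6, h']; rfl
    · left; rw [lg, h6, h']; rfl

theorem Run.base_mono {e S : ℕ} (h : Run E e S) (i : ℕ) {t t' : ℕ} (ht : S ≤ t) (htt : t ≤ t') :
    base (lg E t e) i ≤ base (lg E t' e) i := by
  induction t', htt using Nat.le_induction with
  | base => exact le_rfl
  | succ u hu ih =>
    refine ih.trans ?_
    have he := h.lt_len (ht.trans hu)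
    rcases lg_succ he (h.le u (by omega)) with h1 | ⟨j, h1⟩
    · rw [h1]
    · rw [isT_lg h1, base_cons]
      split_ifs
      · have := base_le_marker (i := i) he
        have := (marker he).1
        simp only; omega
      · exact le_rfl

theorem Run.base_ge {e S : ℕ} (h : Run E e S) {i t t' : ℕ} (ht : S ≤ t) (htt : t < t')
    (hT : isT E e i t) : t ≤ base (lg E t' e) i := by
  have := h.base_mono i (t := t + 1) (t' := t') (by omega) (by omega)
  rw [isT_lg hT, base_cons, if_pos rfl] at this
  exact this

theorem Run.entries {e S : ℕ} (h : Run E e S) {t : ℕ} (ht : S ≤ t) {x : LogE}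
    (hx : x ∈ lg E t e) : S ≤ x.2.1 ∧ x.2.1 < t ∧ isT E e x.1 x.2.1 ∧
      x.2.2 = base (lg E x.2.1 e) x.1 := by
  induction t, ht using Nat.le_induction with
  | base => rw [h.lg0] at hx; simp at hx
  | succ u hu ih =>
    rcases lg_succ (h.lt_len hu) (h.le u (by omega)) with h1 | ⟨j, h1⟩
    · rw [h1] at hx
      obtain ⟨a, b, c⟩ := ih hx
      exact ⟨a, by omega, c⟩
    · rw [isT_lg h1, List.mem_cons] at hx
      rcases hx with rfl | hx
      · exact ⟨hu, by simp, h1, rfl⟩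
      · obtain ⟨a, b, c⟩ := ih hx
        exact ⟨a, by omega, c⟩

/-! #### Infinitely many treating moves make `A i` `K`-trivial -/

/-- requests issued at treating moves -/
def reqT (E : Env) (e i S P t a : ℕ) : Option (ℕ × Str) :=
  (E.D t a).elim Option.none fun v =>
    bif (decide (S ≤ t) && decide (mv E t = e) && decide (mv E t < len E t) &&
        decide (trigI E t (lev E t e) = i) && trtB E t (lev E t e)) &&
        untB E i t (lg E t e) (base (lg E t e) i) a then
      Option.some (v.1 + P, resA E i t v.2.length) else Option.none

theorem reqT_prim (pr : E.Pr) (e i S P : ℕ) :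
    Primrec fun p : ℕ × ℕ => reqT E e i S P p.1 p.2 := by
  have h1 : Primrec fun q : (ℕ × ℕ) × ℕ × Str => q.1.1 := p_fst Primrec.fst
  have h2 : Primrec fun q : (ℕ × ℕ) × ℕ × Str => q.1.2 := p_snd Primrec.fst
  have hv : Primrec fun q : (ℕ × ℕ) × ℕ × Str => q.2 := Primrec.snd
  have hi : Primrec fun _ : (ℕ × ℕ) × ℕ × Str => i := Primrec.const i
  have he : Primrec fun _ : (ℕ × ℕ) × ℕ × Str => e := Primrec.const e
  refine p_elim (g := fun (p : ℕ × ℕ) (v : ℕ × Str) =>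
    bif (decide (S ≤ p.1) && decide (mv E p.1 = e) && decide (mv E p.1 < len E p.1) &&
        decide (trigI E p.1 (lev E p.1 e) = i) && trtB E p.1 (lev E p.1 e)) &&
        untB E i p.1 (lg E p.1 e) (base (lg E p.1 e) i) p.2 then
      Option.some (v.1 + P, resA E i p.1 v.2.length) else Option.none)
    (p_D pr Primrec.fst Primrec.snd) (Primrec.const Option.none) ?_
  refine p_cond (p_and (p_and (p_and (p_and (p_and (p_le (Primrec.const S) h1)
      (p_eq (p_mv pr h1) he)) (p_lt (p_mv pr h1) (p_slen pr h1)))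
      (p_eq (p_trigI pr h1 (p_lev pr h1 he)) hi)) (p_trtB pr h1 (p_lev pr h1 he)))
      (p_untB pr hi h1 (p_lg pr h1 he) (p_base (p_lg pr h1 he) hi) h2))
    (Primrec.option_some.comp ((p_add (p_fst hv) (Primrec.const _)).pair
      (p_resA pr hi h1 (p_len (p_snd hv))))) (Primrec.const Option.none)

theorem unt_mem (ok : E.Ok W) {i s b a : ℕ} {log : List LogE} :
    untB E i s log b a = true ↔ a ∈ uset E i s log b := by
  unfold uset
  rw [Finset.mem_filter, Finset.mem_range]
  refine ⟨fun h => ⟨?_, h⟩, fun h => h.2⟩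
  unfold untB at h
  rcases hD : E.D s a with _ | v
  · simp [hD] at h
  · exact ok.lt hD

theorem reqT_eq (ok : E.Ok W) {e i S P t a : ℕ} (hi : i < E.k) {y : ℕ × Str} :
    reqT E e i S P t a = Option.some y ↔
    ∃ v, E.D t a = Option.some v ∧ S ≤ t ∧ isT E e i t ∧ a ∈ uset E i t (lg E t e) (base (lg E t e) i) ∧
      y = (v.1 + P, resA E i t v.2.length) := by
  unfold reqT
  rcases hD : E.D t a with _ | v
  · simp
  · simp only [Option.elim_some, Bool.cond_eq_ite, Bool.and_eq_true,
      Option.ite_none_right_eq_some, Option.some.injEq, decide_eq_true_eq, unt_mem ok]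
    constructor
    · rintro ⟨⟨⟨⟨⟨⟨h0, h1⟩, h2⟩, h3⟩, h4⟩, h5⟩, h6⟩
      exact ⟨v, rfl, h0, ⟨h1, h2, h3, hi, h4⟩, h5, h6.symm⟩
    · rintro ⟨v', rfl, h0, ⟨h1, h2, h3, _, h4⟩, h5, h6⟩
      exact ⟨⟨⟨⟨⟨⟨h0, h1⟩, h2⟩, h3⟩, h4⟩, h5⟩, h6.symm⟩

theorem reqT_sum (ok : E.Ok W) {e i S : ℕ} (hi : i < E.k) (hr : Run E e S) (N : ℕ) :
    ∑ s ∈ Finset.range N, ∑ a ∈ Finset.range N, rwt (reqT E e i S (lev E S e).1 s a) ≤ 1 := by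
  set P := (lev E S e).1 with hP
  set G : ℕ → Finset ℕ := fun s => if S ≤ s ∧ isT E e i s then cset E i s (base (lg E s e) i) else ∅
    with hG
  have hstage : ∀ s, ∑ a ∈ Finset.range N, rwt (reqT E e i S P s a) ≤ mass W (G s) := by
    intro s
    by_cases hs : S ≤ s ∧ isT E e i s
    · have := req_sum ok (reqT E e i S P s) (uset E i s (lg E s e) (base (lg E s e) i))
        ((1 / 2) ^ P) (by positivity) (fun a ha => by
        rcases h : reqT E e i S P s a with _ | y
        · exact absurd h ha
        · obtain ⟨v, h1, h2, h3, h4, rfl⟩ := (reqT_eq ok hi).1 h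
          refine ⟨h4, ?_⟩
          simp only [rwt]
          rw [ok.W_eq h1, pow_add, mul_comm]) N
      refine this.trans ?_
      simp only [hG, if_pos hs]
      have h5 := (trt_spec ok).1 hs.2.2.2.2.2
      rw [hs.2.2.2.1, hr.p_eq hs.1, ← hP] at h5
      rw [one_div, inv_pow, inv_mul_le_iff₀ (by positivity), mul_comm]
      exact h5.le
    · refine (Finset.sum_eq_zero fun a _ => ?_).le.trans (mass_nonneg ok _)
      rcases h : reqT E e i S P s a with _ | y
      · rfl
      · obtain ⟨v, h1, h2, h3, h4, rfl⟩ := (reqT_eq ok hi).1 h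
        exact absurd ⟨h2, h3⟩ hs
  refine (Finset.sum_le_sum fun s _ => hstage s).trans ?_
  refine mass_disj_one ok _ _ ?_
  have key : ∀ x y, x < y → Disjoint (G x) (G y) := by
    intro x y hxy
    rw [Finset.disjoint_left]
    intro a ha hb
    by_cases h1 : S ≤ x ∧ isT E e i x
    · by_cases h2 : S ≤ y ∧ isT E e i y
      · simp only [hG, if_pos h1, if_pos h2] at ha hb
        have h3 := hr.base_ge h1.1 hxy h1.2
        obtain ⟨v, a1, a2, a3⟩ := (mem_cset ok).1 ha
        obtain ⟨v', b1, b2, b3⟩ := (mem_cset ok).1 hb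
        have : v' = v := Option.some.inj (b1.symm.trans (ok.mono hxy.le a1))
        subst this
        have := ok.len a1
        omega
      · simp [hG, if_neg h2] at hb
    · simp [hG, if_neg h1] at ha
  intro x _ y _ hxy
  rcases lt_or_gt_of_ne hxy with h | h
  · exact key x y h
  · exact (key y x h).symm

theorem treat_trivial (hU : OptimalPF U) (ok : E.Ok W) (pr : E.Pr) (fo : E.For U A) {e i S : ℕ}
    (hi : i < E.k) (hr : Run E e S) (hinf : ∀ T, ∃ t ≥ T, isT E e i t) : KTrivialSet U (A i) := by
  set P := (lev E S e).1 with hP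
  obtain ⟨c, hc⟩ := kc_theorem₂ hU (R := reqT E e i S P) (reqT_prim pr e i S P).to_comp
    (reqT_sum ok hi hr)
  refine ⟨P + c, fun n => le_KC_add fun τ hτ => ?_⟩
  set a := Encodable.encode τ with ha
  have hlen : (zeroStr n).length = n := by simp [zeroStr]
  have claim : ∀ t, S ≤ t → isT E e i t → E.D t a = Option.some (τ.length, zeroStr n) →
      n ≤ base (lg E t e) i → ∃ s, reqT E e i S P s a = Option.some (τ.length + P, resA E i t n) := by
    intro t
    induction t using Nat.strong_induction_on with
    | _ t ih =>
      intro ht hT hD hb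
      by_cases hu : a ∈ uset E i t (lg E t e) (base (lg E t e) i)
      · exact ⟨t, (reqT_eq ok hi).2 ⟨_, hD, ht, hT, hu, by simp only [hlen]⟩⟩
      · have : ∃ t' b', (i, t', b') ∈ lg E t e ∧ (E.D t' a).isSome ∧ n ≤ b' ∧
            resA E i t' n = resA E i t n := by
          by_contra hn
          push Not at hn
          refine hu ((mem_uset ok).2 ⟨_, hD, ?_, ?_, ?_⟩)
          · simp only [hlen]; rfl
          · simp only [hlen]; exact hb
          · simp only [hlen]; exact hn
        obtain ⟨t', b', h1, h2, h3, h4⟩ := this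
        obtain ⟨c1, c2, c3, c4⟩ := hr.entries ht h1
        simp only at c1 c2 c3 c4
        obtain ⟨v, hv⟩ := Option.isSome_iff_exists.1 h2
        have hv' : v = _ := Option.some.inj ((ok.mono c2.le hv).symm.trans hD)
        rw [hv'] at hv
        rw [← h4]
        exact ih t' c2 c1 c3 hv (by omega)
  obtain ⟨s1, h1⟩ := fo.compl hτ
  obtain ⟨s2, h2⟩ := resA_lim ok fo hi n
  obtain ⟨t0, ht0, hT0⟩ := hinf (S + n)
  obtain ⟨t, ht, hT⟩ := hinf (t0 + 1 + s1 + s2)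
  obtain ⟨s, hs⟩ := claim t (by omega) hT (ok.mono (by omega) h1)
    (le_trans (by omega) (hr.base_ge (by omega) (by omega) hT0))
  rw [h2 t (by omega)] at hs
  refine (hc _ _ _ _ hs).trans ?_
  push_cast
  rw [add_assoc]

/-! #### Infinitely many `R`-moves make `A j` `K`-trivial -/

/-- `0^n` has been described and `n` is below the marker -/
def zB (E : Env) (e S s a : ℕ) : Bool :=
  decide (S ≤ s) && (E.D s a).elim false (fun v =>
    decide (v.2 = List.replicate v.2.length false) && decide (v.2.length ≤ mk E s e))

def reqZ (E : Env) (e S s a : ℕ) : Option (ℕ × Str) :=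
  (E.D s a).elim Option.none fun v =>
    bif zB E e S s a && !zB E e S (s - 1) a then Option.some (v.1, resB (Bs E s) v.2.length) else Option.none

theorem p_zB (pr : E.Pr) {α : Type} [Primcodable α] {e S : ℕ} {s a : α → ℕ} (hs : Primrec s)
    (ha : Primrec a) : Primrec fun x => zB E e S (s x) (a x) := by
  refine p_and (p_le (Primrec.const S) hs) (p_elim (g := fun x (v : ℕ × Str) =>
    decide (v.2 = List.replicate v.2.length false) && decide (v.2.length ≤ mk E (s x) e))
    (p_D pr hs ha) (Primrec.const false) ?_)
  have hv : Primrec fun q : α × ℕ × Str => q.2.2 := p_snd Primrec.snd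
  exact p_and (p_eq hv (p_repl (p_len hv))) (p_le (p_len hv)
    (p_mk pr (hs.comp Primrec.fst) (Primrec.const e)))

theorem reqZ_prim (pr : E.Pr) (e S : ℕ) : Primrec fun p : ℕ × ℕ => reqZ E e S p.1 p.2 := by
  have h1 : Primrec fun q : (ℕ × ℕ) × ℕ × Str => q.1.1 := p_fst Primrec.fst
  have h2 : Primrec fun q : (ℕ × ℕ) × ℕ × Str => q.1.2 := p_snd Primrec.fst
  have hv : Primrec fun q : (ℕ × ℕ) × ℕ × Str => q.2 := Primrec.snd
  refine p_elim (g := fun (p : ℕ × ℕ) (v : ℕ × Str) =>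
    bif zB E e S p.1 p.2 && !zB E e S (p.1 - 1) p.2 then
      Option.some (v.1, resB (Bs E p.1) v.2.length) else Option.none)
    (p_D pr Primrec.fst Primrec.snd) (Primrec.const Option.none) ?_
  exact p_cond (p_and (p_zB pr h1 h2) (p_not (p_zB pr (p_sub h1 (Primrec.const 1)) h2)))
    (Primrec.option_some.comp ((p_fst hv).pair (p_resB (p_Bs pr h1) (p_len (p_snd hv)))))
    (Primrec.const Option.none)

theorem zB_iff {e S s a : ℕ} : zB E e S s a = true ↔ S ≤ s ∧ ∃ v, E.D s a = Option.some v ∧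
    v.2 = List.replicate v.2.length false ∧ v.2.length ≤ mk E s e := by
  unfold zB
  rcases hD : E.D s a with _ | v
  · simp
  · simp only [Option.elim_some, Bool.and_eq_true, decide_eq_true_eq]
    constructor
    · rintro ⟨h1, h2, h3⟩
      exact ⟨h1, v, rfl, h2, h3⟩
    · rintro ⟨h1, v', h4, h2, h3⟩
      cases h4
      exact ⟨h1, h2, h3⟩

theorem zB_mono (ok : E.Ok W) {e S s t a : ℕ} (hr : Run E e S) (h : s ≤ t)
    (hs : zB E e S s a = true) : zB E e S t a = true := by
  obtain ⟨h1, v, h2, h3, h4⟩ := zB_iff.1 hs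
  exact zB_iff.2 ⟨by omega, v, ok.mono h h2, h3,
    h4.trans (mk_mono h (hr.lt_len h1) (hr.lt_len (by omega)))⟩

theorem reqZ_eq {e S s a : ℕ} {y : ℕ × Str} : reqZ E e S s a = Option.some y ↔ ∃ v, E.D s a = Option.some v ∧
    zB E e S s a = true ∧ zB E e S (s - 1) a = false ∧ y = (v.1, resB (Bs E s) v.2.length) := by
  unfold reqZ
  rcases hD : E.D s a with _ | v
  · simp
  · simp only [Option.elim_some, Bool.cond_eq_ite, Bool.and_eq_true,
      Option.ite_none_right_eq_some, Option.some.injEq, Bool.not_eq_true']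
    constructor
    · rintro ⟨⟨h1, h2⟩, h3⟩
      exact ⟨v, rfl, h1, h2, h3.symm⟩
    · rintro ⟨v', rfl, h1, h2, h3⟩
      exact ⟨⟨h1, h2⟩, h3.symm⟩

theorem reqZ_sum (ok : E.Ok W) {e S : ℕ} (hr : Run E e S) (N : ℕ) :
    ∑ s ∈ Finset.range N, ∑ a ∈ Finset.range N, rwt (reqZ E e S s a) ≤ 1 := by
  set G : ℕ → Finset ℕ := fun s => (Finset.range s).filter
    (fun a => zB E e S s a = true ∧ zB E e S (s - 1) a = false) with hG
  have hstage : ∀ s, ∑ a ∈ Finset.range N, rwt (reqZ E e S s a) ≤ mass W (G s) := by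
    intro s
    have := req_sum ok (reqZ E e S s) (G s) 1 zero_le_one (fun a ha => by
        rcases h : reqZ E e S s a with _ | y
        · exact absurd h ha
        · obtain ⟨v, h1, h2, h3, rfl⟩ := reqZ_eq.1 h
          refine ⟨Finset.mem_filter.2 ⟨Finset.mem_range.2 (ok.lt h1), h2, h3⟩, ?_⟩
          simp only [rwt]
          rw [ok.W_eq h1, one_mul]) N
    rwa [one_mul] at this
  refine (Finset.sum_le_sum fun s _ => hstage s).trans ?_
  refine mass_disj_one ok _ _ ?_
  have key : ∀ x y, x < y → Disjoint (G x) (G y) := by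
    intro x y hxy
    rw [Finset.disjoint_left]
    intro a ha hb
    have h1 := (Finset.mem_filter.1 ha).2.1
    have h2 := (Finset.mem_filter.1 hb).2.2
    rw [zB_mono ok hr (by omega) h1] at h2
    exact absurd h2 (by simp)
  intro x _ y _ hxy
  rcases lt_or_gt_of_ne hxy with h | h
  · exact key x y h
  · exact (key y x h).symm

theorem B_final {e S : ℕ} (hr : Run E e S) {s x : ℕ} (hs : S ≤ s) (hx : x < mk E s e) :
    x ∈ Bset E ↔ x ∈ Bs E s := by
  refine ⟨?_, fun h => ⟨s, h⟩⟩
  rintro ⟨t, ht⟩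
  by_contra hn
  obtain ⟨u, hu, h1, h2⟩ := mem_Bs.1 ht
  rcases lt_or_ge u s with h | h
  · exact hn (mem_Bs.2 ⟨u, h, h1, h2⟩)
  · have h3 := hr.le u (by omega)
    have h4 := mk_mono h (hr.lt_len hs) (hr.lt_len (by omega : S ≤ u))
    rcases h3.lt_or_eq with h5 | h5
    · have := marker_mono h5 h1
      omega
    · rw [← h5] at h2
      omega

theorem B_trivial (hU : OptimalPF U) (ok : E.Ok W) (pr : E.Pr) (fo : E.For U A) {e S : ℕ}
    (hr : Run E e S) (hinf : ∀ T, ∃ t ≥ T, mv E t = e) : KTrivialSet U (Bset E) := by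
  obtain ⟨c, hc⟩ := kc_theorem₂ hU (R := reqZ E e S) (reqZ_prim pr e S).to_comp
    (reqZ_sum ok hr)
  refine ⟨c, fun n => le_KC_add fun τ hτ => ?_⟩
  set a := Encodable.encode τ with ha
  have hlen : (zeroStr n).length = n := by simp [zeroStr]
  obtain ⟨s1, h1⟩ := fo.compl hτ
  obtain ⟨t0, ht0, hm0⟩ := hinf n
  have hex : ∃ s, zB E e S s a = true := by
    refine ⟨S + s1 + t0 + 1, zB_iff.2 ⟨by omega, _, ok.mono (by omega) h1, ?_, ?_⟩⟩
    · simp only [hlen]; rfl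
    · simp only [hlen]
      exact ht0.le.trans (mk_ge (by omega) (hr.lt_len (by omega)) hm0)
  set s := Nat.find hex with hs
  have hz : zB E e S s a = true := Nat.find_spec hex
  obtain ⟨h2, v, h3, h4, h5⟩ := zB_iff.1 hz
  have hv : v = (τ.length, zeroStr n) := by
    have e1 := ok.mono (le_max_left s s1) h3
    have e2 := ok.mono (le_max_right s s1) h1
    exact Option.some.inj (e1.symm.trans e2)
  have hpos := hr.pos
  have hreq : reqZ E e S s a = Option.some (τ.length, resB (Bs E s) n) := by
    refine reqZ_eq.2 ⟨v, h3, hz, ?_, by rw [hv]; simp only [hlen]⟩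
    have := Nat.find_min hex (m := s - 1) (by omega)
    simpa using this
  have hB : resB (Bs E s) n = restrSet (Bset E) n := by
    refine restr_eq fun x hx => ?_
    rw [any_iff, B_final hr h2]
    rw [hv] at h5
    simp only [hlen] at h5
    omega
  rw [hB] at hreq
  refine (hc _ _ _ _ hreq).trans ?_
  push_cast
  exact le_rfl

theorem RB_spec {s e : ℕ} {B : List ℕ} {L : Lev} : RB E s B e L = true ↔
    e.unpair.1 < E.k ∧ ∀ a < s, ∀ v, E.D s a = Option.some v → v.2.length ≤ L.2.2.1 →
      v.2 = resB B v.2.length → ∃ a' < s, ∃ v', E.D s a' = Option.some v' ∧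
        v'.2 = resA E e.unpair.1 s v.2.length ∧ v'.1 ≤ v.1 + e.unpair.2 := by
  unfold RB
  rw [Bool.and_eq_true, decide_eq_true_eq, List.all_eq_true]
  refine and_congr_right fun _ => forall_congr' fun a => ?_
  rw [List.mem_range]
  refine imp_congr_right fun _ => ?_
  rcases hD : E.D s a with _ | v
  · simp
  · simp only [Option.elim_some, Bool.or_eq_true, Bool.not_eq_true', ← Bool.not_eq_true,
      Bool.and_eq_true, decide_eq_true_eq, List.any_eq_true, List.mem_range, Option.some.injEq]
    have hin : ∀ a', ((E.D s a').elim false (fun v' =>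
        decide (v'.2 = resA E e.unpair.1 s v.2.length) && decide (v'.1 ≤ v.1 + e.unpair.2)) = true ↔
        ∃ v', E.D s a' = Option.some v' ∧
        v'.2 = resA E e.unpair.1 s v.2.length ∧ v'.1 ≤ v.1 + e.unpair.2) := by
      intro a'
      rcases hD' : E.D s a' with _ | v'
      · simp
      · simp
    simp only [hin]
    constructor
    · rintro h v' rfl h1 h2
      rcases h with h | h
      · exact absurd ⟨h1, h2⟩ h
      · exact h
    · intro h
      by_cases h1 : v.2.length ≤ L.2.2.1 ∧ v.2 = resB B v.2.length
      · exact Or.inr (h v rfl h1.1 h1.2)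
      · exact Or.inl h1

theorem R_trivial (hU : OptimalPF U) (ok : E.Ok W) (pr : E.Pr) (fo : E.For U A) {e S : ℕ}
    (hr : Run E e S) (hinf : ∀ T, ∃ t ≥ T, mv E t = e ∧ RB E t (Bs E t) e (lev E t e) = true) :
    e.unpair.1 < E.k ∧ KTrivialSet U (A e.unpair.1) := by
  have hj : e.unpair.1 < E.k := by
    obtain ⟨t, _, _, h⟩ := hinf 0
    exact (RB_spec.1 h).1
  refine ⟨hj, ?_⟩
  obtain ⟨c, hc⟩ := B_trivial hU ok pr fo hr
    (fun T => by obtain ⟨t, h1, h2, _⟩ := hinf T; exact ⟨t, h1, h2⟩)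
  refine ⟨c + e.unpair.2, fun n => ?_⟩
  have hlen : (restrSet (Bset E) n).length = n := by simp [restrSet]
  have h1 : KC U (restrSet (A e.unpair.1) n) ≤ KC U (restrSet (Bset E) n) + (e.unpair.2 : ℕ∞) := by
    refine le_KC_add fun τ hτ => ?_
    obtain ⟨s1, h1⟩ := fo.compl hτ
    obtain ⟨s2, h2⟩ := resA_lim ok fo hj n
    obtain ⟨s3, h3⟩ := resB_lim (E := E) n
    obtain ⟨t0, ht0, hm0, _⟩ := hinf n
    obtain ⟨t, ht, hm, hR⟩ := hinf (S + s1 + s2 + s3 + t0 + 1)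
    have hD := ok.mono (by omega : s1 ≤ t) h1
    obtain ⟨a', _, v', b1, b2, b3⟩ := (RB_spec.1 hR).2 _ (ok.lt hD) _ hD
      (by simp only [hlen]; exact ht0.le.trans (mk_ge (e := e) (by omega) (hr.lt_len (by omega)) hm0))
      (by simp only [hlen]; rw [h3 t (by omega)])
    simp only [hlen] at b2 b3
    rw [h2 t (by omega)] at b2
    obtain ⟨τ', _, c2, c3⟩ := fo.sound b1
    rw [b2] at c3
    refine (KC_le_of_mem c3).trans ?_
    rw [c2]
    exact_mod_cast b3
  refine h1.trans ?_
  have := add_le_add_left (hc n) (e.unpair.2 : ℕ∞)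
  refine this.trans ?_
  push_cast
  rw [add_assoc]

end

section
variable {E : Env} {W : ℕ → ℝ} {U : Str →. Str} {A : ℕ → Set ℕ}

/-- the coding flag of a level was computed at the stage given by its marker -/
theorem cd_eq {t e : ℕ} (he : e < len E t) : (lev E t e).2.2.2.1 = E.HS (mk E t e) e := by
  obtain ⟨h1, h2, h3⟩ := marker he
  have h4 := lev_const (E := E) (t := mk E t e + 1) (t' := t) (e := e) (by omega)
    (fun u hu hu' => h3 u (by omega) hu')
  rw [h4]
  have := (lev_at (E := E) (mk E t e)).2.1
  rwa [h2] at this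

theorem cod_fin (ok : E.Ok W) {e S : ℕ} (hr : Run E e S) :
    ∃ T, ∀ t ≥ T, mv E t = e → codB E t e (lev E t e) = false := by
  by_cases h : ∃ t ≥ S, mv E t = e ∧ codB E t e (lev E t e) = true
  · obtain ⟨t, h1, h2, h3⟩ := h
    refine ⟨t + 1, fun t' ht' _ => ?_⟩
    have he := hr.lt_len (by omega : S ≤ t')
    have h4 := mk_ge (by omega : t < t') he h2
    unfold codB at h3 ⊢
    rw [Bool.and_eq_true] at h3
    rw [cd_eq he, ok.HSmono h4 h3.1]
    simp
  · push Not at h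
    exact ⟨S, fun t ht hm => by simpa using h t ht hm⟩

theorem inc_inf (ok : E.Ok W) {e S : ℕ} (hr : Run E e S) (hinf : ∀ T, ∃ t ≥ T, mv E t = e) :
    ∀ T, ∃ t ≥ T, mv E t = e ∧ isInc E t := by
  intro T0
  by_contra hn
  push Not at hn
  set T := max T0 S with hT
  have hNT : ∀ t ≥ T, mv E t = e → isNT E t := by
    intro t ht hm
    have h1 := hn t (by omega) hm
    unfold isInc at h1
    by_contra h2
    refine h1 ⟨?_, h2⟩
    rw [hm]
    exact hr.lt_len (by omega)
  have hrc : ∀ t ≥ T, (lev E t e).2.1 = (lev E T e).2.1 := by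
    intro t ht
    induction t, ht using Nat.le_induction with
    | base => rfl
    | succ t ht ih =>
      rcases (hr.le t (by omega)).lt_or_eq with h | h
      · rw [lev_lt h, ih]
      · obtain ⟨h1, h2, h3⟩ := hNT t ht h.symm
        have h6 := ((lev_at (E := E) t).2.2.1 h1).1
        rw [← h] at h6 h2 h3
        rcases upd_cases (E := E) t e (lev E t e) with ⟨_, b, _⟩ | ⟨_, _, h'⟩ | ⟨a, _⟩
        · rw [h3] at b; exact absurd b (by simp)
        · rw [h6, h', ih]
        · exact absurd h2 a
  set q := (lev E S e).1 + (lev E T e).2.1 with hq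
  have hset : {t | T ≤ t ∧ mv E t = e}.Infinite := by
    rw [Set.infinite_iff_exists_gt]
    intro n
    obtain ⟨t, h1, h2⟩ := hinf (T + n + 1)
    exact ⟨t, ⟨by omega, h2⟩, by omega⟩
  obtain ⟨F, hF, hcard⟩ := hset.exists_subset_card_eq (2 ^ q + 1)
  have hF' : ∀ t ∈ F, T ≤ t ∧ mv E t = e := fun t ht => hF ht
  have h1 : ∑ t ∈ F, mass W (key E t) ≤ 1 := by
    refine mass_disj_one ok _ _ ?_
    have kd : ∀ x ∈ F, ∀ y ∈ F, x < y → Disjoint (key E x) (key E y) := by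
      intro x hx y hy hxy
      rw [Finset.disjoint_left]
      intro a ha hb
      exact key_disj ok hxy (hNT y (hF' y hy).1 (hF' y hy).2).1
        (by rw [(hF' x hx).2, (hF' y hy).2]) ha hb
    intro x hx y hy hxy
    rcases lt_or_gt_of_ne hxy with h | h
    · exact kd x hx y hy h
    · exact (kd y hy x hx h).symm
  have h2 : ∑ t ∈ F, (1 / 2 : ℝ) ^ q ≤ ∑ t ∈ F, mass W (key E t) := by
    refine Finset.sum_le_sum fun t ht => ?_
    obtain ⟨h3, h4⟩ := hF' t ht
    have h5 := trig_spec ok (hNT t h3 h4).2.1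
    refine le_trans (le_of_eq ?_) h5.le
    rw [thr, h4, hr.p_eq (by omega), hrc t h3]
  rw [Finset.sum_const, hcard, nsmul_eq_mul, one_div, inv_pow] at h2
  have h3 : ((2 ^ q + 1 : ℕ) : ℝ) * (2 ^ q)⁻¹ ≤ 1 := h2.trans h1
  rw [mul_inv_le_iff₀ (by positivity)] at h3
  push_cast at h3
  linarith

theorem conv_step (hU : OptimalPF U) (ok : E.Ok W) (pr : E.Pr) (fo : E.For U A)
    (hA : ∀ i < E.k, ¬ KTrivialSet U (A i)) {e S : ℕ} (hr : Run E e S) :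
    ∃ T, ∀ t ≥ T, e + 1 ≤ mv E t := by
  by_contra hn
  push Not at hn
  have hinf : ∀ T, ∃ t ≥ T, mv E t = e := by
    intro T
    obtain ⟨t, h1, h2⟩ := hn (T + S)
    have := hr.le t (by omega)
    exact ⟨t, by omega, by omega⟩
  have hI := inc_inf ok hr hinf
  have hTr : ∀ i, ∃ T, ∀ t ≥ T, ¬ isT E e i t := by
    intro i
    by_contra hc
    push Not at hc
    have hi : i < E.k := by
      obtain ⟨t, _, h⟩ := hc 0
      exact h.2.2.2.1
    exact hA i hi (treat_trivial hU ok pr fo hi hr hc)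
  choose Ti hTi using hTr
  have hRf : ∃ T, ∀ t ≥ T, mv E t = e → RB E t (Bs E t) e (lev E t e) = false := by
    by_contra hc
    push Not at hc
    obtain ⟨h1, h2⟩ := R_trivial hU ok pr fo hr (fun T => by
      obtain ⟨t, h1, h2, h3⟩ := hc T
      exact ⟨t, h1, h2, by simpa using h3⟩)
    exact hA _ h1 h2
  obtain ⟨TR, hTR⟩ := hRf
  obtain ⟨TC, hTC⟩ := cod_fin ok hr
  obtain ⟨t, ht, hm, hi1, hi2⟩ := hI (TR + TC + S + (Finset.range E.k).sup Ti)
  have hv := viol_at hi1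
  rw [hm] at hv hi1
  unfold viol at hv
  rw [hTR t (by omega) hm, hTC t (by omega) hm] at hv
  simp only [Bool.or_false, decide_eq_true_eq] at hv
  have h4 := Finset.le_sup (f := Ti) (Finset.mem_range.2 hv)
  refine hTi _ t (by omega) ⟨hm, by rw [hm]; exact hi1, rfl, hv, ?_⟩
  by_contra h5
  refine hi2 ⟨by rw [hm]; exact hi1, by rw [hm]; exact hv, ?_⟩
  rw [hm]
  simpa using h5

theorem conv (hU : OptimalPF U) (ok : E.Ok W) (pr : E.Pr) (fo : E.For U A)
    (hA : ∀ i < E.k, ¬ KTrivialSet U (A i)) (e : ℕ) : ∃ T, ∀ t ≥ T, e ≤ mv E t := by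
  induction e with
  | zero => exact ⟨0, by simp⟩
  | succ e ih =>
    obtain ⟨S, hS⟩ := run_exists ih
    exact conv_step hU ok pr fo hA hS

/-! ### Strictness -/

theorem KC_attained {U : Str →. Str} {ρ : Str} {m : ℕ} (h : KC U ρ ≤ (m : ℕ∞)) :
    ∃ τ, ρ ∈ U τ ∧ τ.length ≤ m := by
  unfold KC at h
  rcases isEmpty_or_nonempty {τ : Str // ρ ∈ U τ} with h' | h'
  · rw [iInf_of_empty] at h; simp at h
  · obtain ⟨τ, hτ⟩ := ciInf_mem (fun τ : {τ : Str // ρ ∈ U τ} => ((τ : Str).length : ℕ∞))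
    rw [← hτ] at h
    have h2 : ((τ.1.length : ℕ) : ℕ∞) ≤ m := h
    exact ⟨τ.1, τ.2, by exact_mod_cast h2⟩

theorem late_aux (P : ℕ → ℕ → Prop) (hP : ∀ n, ∃ s, ∀ t ≥ s, P n t) (m : ℕ) :
    ∃ s, ∀ t ≥ s, ∀ n < m, P n t := by
  choose f hf using hP
  refine ⟨(Finset.range m).sup f, fun t ht n hn => hf n t ?_⟩
  exact (Finset.le_sup (f := f) (Finset.mem_range.2 hn)).trans ht

theorem not_le (hU : OptimalPF U) (ok : E.Ok W) (pr : E.Pr) (fo : E.For U A)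
    (hA : ∀ i < E.k, ¬ KTrivialSet U (A i)) {j : ℕ} (hj : j < E.k) :
    ¬ KLeSet U (A j) (Bset E) := by
  rintro ⟨c, hc⟩
  set e := Nat.pair j c with he
  obtain ⟨T, hT⟩ := conv hU ok pr fo hA (e + 1)
  have hTlen := lt_len_of_le_mv (hT T le_rfl : e < mv E T)
  set m := mk E T e with hm
  have hmk : ∀ t ≥ T, lev E t e = lev E T e := fun t ht =>
    lev_const ht fun u hu _ => hT u hu
  -- for each `n ≤ m`, everything relevant about strings of length `n` is eventually correct
  have hlen : ∀ (X : Set ℕ) n, (restrSet X n).length = n := by intro X n; simp [restrSet]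
  have key : ∀ n, ∃ s, ∀ t ≥ s, resB (Bs E t) n = restrSet (Bset E) n ∧
      resA E j t n = restrSet (A j) n ∧
      ∀ a < t, ∀ v, E.D t a = Option.some v → v.2 = restrSet (Bset E) n →
        ∃ a' < t, ∃ v', E.D t a' = Option.some v' ∧ v'.2 = restrSet (A j) n ∧ v'.1 ≤ v.1 + c := by
    intro n
    obtain ⟨s2, h2⟩ := resA_lim ok fo hj n
    obtain ⟨s3, h3⟩ := resB_lim (E := E) n
    by_cases hex : ∃ τ, restrSet (A j) n ∈ U τ
    · -- a shortest description of `A j ↾ n`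
      obtain ⟨τ0, hτ0⟩ := hex
      have hfin : KC U (restrSet (A j) n) ≠ ⊤ :=
        ne_of_lt ((KC_le_of_mem hτ0).trans_lt (ENat.coe_lt_top _))
      obtain ⟨d, hd⟩ := ENat.ne_top_iff_exists.1 hfin
      obtain ⟨τ, hτ, hτl⟩ := KC_attained hd.ge
      obtain ⟨s1, h1⟩ := fo.compl hτ
      refine ⟨s1 + s2 + s3, fun t ht => ⟨h3 t (by omega), h2 t (by omega), ?_⟩⟩
      intro a _ v hv hvB
      have hD := ok.mono (by omega : s1 ≤ t) h1
      refine ⟨_, ok.lt hD, _, hD, rfl, ?_⟩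
      obtain ⟨τ', _, c2, c3⟩ := fo.sound hv
      rw [hvB] at c3
      have h4 := (hc n).trans (add_le_add_left (KC_le_of_mem c3) _)
      rw [← hd, c2] at h4
      have h5 : d ≤ v.1 + c := by exact_mod_cast h4
      simp only
      omega
    · refine ⟨s2 + s3, fun t ht => ⟨h3 t (by omega), h2 t (by omega), ?_⟩⟩
      intro a _ v hv hvB
      exfalso
      obtain ⟨τ', _, c2, c3⟩ := fo.sound hv
      rw [hvB] at c3
      have h4 := (hc n).trans (add_le_add_left (KC_le_of_mem c3) _)
      obtain ⟨τ, hτ, _⟩ := KC_attained (m := τ'.length + c) (by exact_mod_cast h4)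
      exact hex ⟨τ, hτ⟩
  obtain ⟨s, hs⟩ := late_aux _ key (m + 1)
  set t := max s T with ht
  have hnv := not_viol (hT t (by omega) : e < mv E t)
  have hR : RB E t (Bs E t) e (lev E t e) = true := by
    rw [RB_spec, he, Nat.unpair_pair]
    refine ⟨hj, fun a ha v hv h1 h2 => ?_⟩
    have hn : v.2.length < m + 1 := by
      rw [← he, hmk t (by omega)] at h1
      exact Nat.lt_succ_of_le h1
    obtain ⟨b1, b2, b3⟩ := hs t (by omega) _ hn
    rw [b1] at h2
    obtain ⟨a', ha', v', c1, c2, c3⟩ := b3 a ha v hv h2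
    exact ⟨a', ha', v', c1, by rw [c2]; simp only; rw [b2], c3⟩
  unfold viol at hnv
  rw [hR] at hnv
  simp at hnv

end

section
variable {E : Env} {W : ℕ → ℝ} {U : Str →. Str} {A : ℕ → Set ℕ}

/-! ### Turing reductions -/

theorem RecursiveIn.of_partrec {O f : ℕ →. ℕ} (h : Nat.Partrec f) : RecursiveIn O f := by
  induction h with
  | zero => exact .zero
  | succ => exact .succ
  | left => exact .left
  | right => exact .right
  | pair _ _ h1 h2 => exact .pair h1 h2
  | comp _ _ h1 h2 => exact .comp h1 h2
  | prec _ _ h1 h2 => exact .prec h1 h2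
  | rfind _ h1 => exact .rfind h1

theorem RecursiveIn.of_eq {O f g : ℕ →. ℕ} (h : RecursiveIn O f) (e : ∀ n, f n = g n) :
    RecursiveIn O g := (funext e : f = g) ▸ h

/-- total functions computable in an oracle -/
def TotIn (O : ℕ →. ℕ) (f : ℕ → ℕ) : Prop := RecursiveIn O (fun n => Part.some (f n))

theorem TotIn.of_comp {O : ℕ →. ℕ} {f : ℕ → ℕ} (h : Computable f) : TotIn O f :=
  RecursiveIn.of_partrec (Partrec.nat_iff.1 h)

theorem TotIn.comp {O : ℕ →. ℕ} {f g : ℕ → ℕ} (hf : TotIn O f) (hg : TotIn O g) :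
    TotIn O (fun n => f (g n)) := by
  refine RecursiveIn.of_eq (RecursiveIn.comp hf hg) fun n => ?_
  simp

theorem TotIn.pair {O : ℕ →. ℕ} {f g : ℕ → ℕ} (hf : TotIn O f) (hg : TotIn O g) :
    TotIn O (fun n => Nat.pair (f n) (g n)) := by
  refine RecursiveIn.of_eq (RecursiveIn.pair hf hg) fun n => ?_
  simp [Seq.seq]

theorem TotIn.add {O : ℕ →. ℕ} {f g : ℕ → ℕ} (hf : TotIn O f) (hg : TotIn O g) :
    TotIn O (fun n => f n + g n) := by
  have h : TotIn O (fun p => p.unpair.1 + p.unpair.2) :=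
    TotIn.of_comp (Primrec.nat_add.comp (Primrec.fst.comp Primrec.unpair)
      (Primrec.snd.comp Primrec.unpair)).to_comp
  have := h.comp (hf.pair hg)
  simpa using this

theorem TotIn.sum {O : ℕ →. ℕ} {h : ℕ → ℕ} (hh : TotIn O h) :
    TotIn O (fun p => ∑ e ∈ Finset.range p.unpair.2, h (Nat.pair p.unpair.1 e)) := by
  have hz : TotIn O (fun _ => 0) := TotIn.of_comp (Computable.const 0)
  have h1 : Primrec (fun q : ℕ => Nat.pair q.unpair.1 q.unpair.2.unpair.1) :=
    Primrec₂.natPair.comp (Primrec.fst.comp Primrec.unpair)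
      (Primrec.fst.comp (Primrec.unpair.comp (Primrec.snd.comp Primrec.unpair)))
  have h2 : Primrec (fun q : ℕ => q.unpair.2.unpair.2) :=
    (Primrec.snd.comp (Primrec.unpair.comp (Primrec.snd.comp Primrec.unpair)))
  have hg : TotIn O (fun q => q.unpair.2.unpair.2 + h (Nat.pair q.unpair.1 q.unpair.2.unpair.1)) :=
    (TotIn.of_comp h2.to_comp).add (hh.comp (TotIn.of_comp h1.to_comp))
  refine RecursiveIn.of_eq (RecursiveIn.prec hz hg) fun p => ?_
  simp only [Nat.unpaired]
  generalize p.unpair.2 = m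
  induction m with
  | zero => simp
  | succ m ih =>
    simp only [Finset.sum_range_succ]
    simp only [ih]
    simp [add_comm]

theorem TotIn.find {O : ℕ →. ℕ} {f : ℕ → ℕ} (hf : TotIn O f) (hex : ∀ a, ∃ n, f (Nat.pair a n) = 0) :
    TotIn O (fun a => Nat.find (hex a)) := by
  refine RecursiveIn.of_eq (RecursiveIn.rfind hf) fun a => ?_
  refine Part.eq_some_iff.2 (Nat.mem_rfind.2 ?_)
  constructor
  · simpa using Nat.find_spec (hex a)
  · intro m hm
    simpa using Nat.find_min (hex a) hm

theorem mem_dec_iff {t x : ℕ} : ((Bs E t).any (fun y => decide (y = x)) = true) ↔ x ∈ Bs E t := any_iff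

theorem Bset_ce (pr : E.Pr) : CESet (Bset E) := by
  have hp : Primrec (fun p : ℕ × ℕ => (Bs E p.2).any (fun y => decide (y = p.1))) := by
    refine p_any (p_Bs pr Primrec.snd) (p_eq Primrec.snd (Primrec.fst.comp Primrec.fst))
  refine ⟨fun n => Nat.rfind (fun t => Part.some ((Bs E t).any (fun y => decide (y = n)))), ?_, ?_⟩
  · refine Partrec.nat_iff.1 ?_
    exact Partrec.rfind (Computable.partrec hp.to_comp).to₂
  · intro n
    refine Iff.trans ?_ Nat.rfind_dom.symm
    constructor
    · rintro ⟨t, ht⟩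
      exact ⟨t, by simpa using ht, fun _ => trivial⟩
    · rintro ⟨t, ht, _⟩
      exact ⟨t, by simpa using ht⟩

theorem ce_le_halting {X : Set ℕ} (hX : CESet X) : TuringLeSet X haltingSet := by
  obtain ⟨f, hf, hX⟩ := hX
  obtain ⟨c, hc⟩ := Nat.Partrec.Code.exists_code.1
    (Partrec.nat_iff.1 ((Partrec.nat_iff.2 hf).comp (Computable.fst.comp Computable.unpair)))
  have hg : Computable (fun n => Encodable.encode (Nat.Partrec.Code.curry c n)) :=
    (Primrec.encode.comp (Nat.Partrec.Code.primrec₂_curry.comp (Primrec.const c) Primrec.id)).to_comp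
  have h1 : TotIn (chi haltingSet) (fun n => if n ∈ haltingSet then 1 else 0) :=
    RecursiveIn.oracle
  refine RecursiveIn.of_eq (h1.comp (TotIn.of_comp hg)) fun n => ?_
  unfold chi
  congr 1
  have : n ∈ X ↔ Encodable.encode (Nat.Partrec.Code.curry c n) ∈ haltingSet := by
    rw [hX]
    simp [haltingSet, Nat.Partrec.Code.eval_curry, hc]
  simp only [← this]

theorem stable {x s : ℕ} (hl : x < len E s) (hs : ∀ e ≤ x, mk E s e ∉ Bset E) :
    ∀ u ≥ s, x < mv E u := by
  intro u
  induction u using Nat.strong_induction_on with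
  | _ u ih =>
    intro hu
    by_contra hcon
    push Not at hcon
    have hq : ∀ v, s ≤ v → v < u → x < mv E v := fun v h1 h2 => ih v h2 h1
    have hlu : x < len E u := by
      rcases Nat.eq_or_lt_of_le hu with h | h
      · rw [← h]; exact hl
      · obtain ⟨v, rfl⟩ : ∃ v, u = v + 1 := ⟨u - 1, by omega⟩
        rw [len_succ]
        have := hq v (by omega) (by omega)
        omega
    have hc : lev E u (mv E u) = lev E s (mv E u) :=
      lev_const hu (fun v h1 h2 => hcon.trans_lt (hq v h1 h2))
    refine hs (mv E u) hcon ⟨u + 1, mem_Bs.2 ⟨u, by omega, by omega, ?_⟩⟩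
    unfold mk; rw [hc]

theorem stable_ex (hU : OptimalPF U) (ok : E.Ok W) (pr : E.Pr) (fo : E.For U A)
    (hA : ∀ i < E.k, ¬ KTrivialSet U (A i)) (x : ℕ) :
    ∃ s, x < len E s ∧ ∀ e ≤ x, mk E s e ∉ Bset E := by
  obtain ⟨T, hT⟩ := conv hU ok pr fo hA (x + 1)
  refine ⟨T, lt_len_of_le_mv (hT T le_rfl), ?_⟩
  rintro e he ⟨u, hu⟩
  have h1 : mk E T e ∈ Bs E (max u T) := Bs_mono (le_max_left _ _) hu
  have h2 : lev E (max u T) e = lev E T e :=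
    lev_const (le_max_right _ _) (fun v h1 _ => by have := hT v h1; omega)
  have h3 : mk E (max u T) e = mk E T e := by unfold mk; rw [h2]
  rw [← h3] at h1
  refine marker_not_mem (lt_len_of_le_mv ?_) h1
  have := hT (max u T) (le_max_right _ _)
  omega

theorem stable_correct (ok : E.Ok W) (fo : E.For U A) {x s : ℕ} (hl : x < len E s)
    (hs : ∀ e ≤ x, mk E s e ∉ Bset E) : x ∈ haltingSet ↔ (lev E s x).2.2.2.1 = true := by
  have hst := stable hl hs
  constructor
  · intro hx
    obtain ⟨t, ht⟩ := (fo.HS (x := x)).1 hx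
    have h1 : E.HS (max s t) x = true := ok.HSmono (le_max_right _ _) ht
    have h2 := not_viol (hst (max s t) (le_max_left _ _))
    have h3 : lev E (max s t) x = lev E s x :=
      lev_const (le_max_left _ _) (fun v h1 _ => hst v h1)
    rw [h3] at h2
    simp only [viol, codB, h1, Bool.or_eq_false_iff] at h2
    simpa using h2.2.1
  · intro h
    rw [cd_eq hl] at h
    exact (fo.HS (x := x)).2 ⟨_, h⟩

theorem halting_le (hU : OptimalPF U) (ok : E.Ok W) (pr : E.Pr) (fo : E.For U A)
    (hA : ∀ i < E.k, ¬ KTrivialSet U (A i)) : TuringLeSet haltingSet (Bset E) := by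
  have u1 : Primrec (fun q : ℕ => q.unpair.1) := Primrec.fst.comp Primrec.unpair
  have u2 : Primrec (fun q : ℕ => q.unpair.2) := Primrec.snd.comp Primrec.unpair
  have hO : TotIn (chi (Bset E)) (fun n => if n ∈ Bset E then 1 else 0) := RecursiveIn.oracle
  have h1 : TotIn (chi (Bset E)) (fun q => if mk E q.unpair.1 q.unpair.2 ∈ Bset E then 1 else 0) :=
    hO.comp (TotIn.of_comp (p_mk pr u1 u2).to_comp)
  have h2 : TotIn (chi (Bset E)) (fun q => ∑ e ∈ Finset.range (q.unpair.1 + 1),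
      if mk E q.unpair.2 e ∈ Bset E then 1 else 0) := by
    have := h1.sum.comp (TotIn.of_comp (Primrec₂.natPair.comp u2 (Primrec.succ.comp u1)).to_comp)
    simpa using this
  have h3 : TotIn (chi (Bset E)) (fun q => bif decide (q.unpair.1 < len E q.unpair.2) then 0 else 1) :=
    TotIn.of_comp (p_cond (p_lt u1 (p_slen pr u2)) (Primrec.const 0) (Primrec.const 1)).to_comp
  have h4 := h2.add h3
  have key : ∀ x s, ((∑ e ∈ Finset.range ((Nat.pair x s).unpair.1 + 1),
      if mk E (Nat.pair x s).unpair.2 e ∈ Bset E then 1 else 0) +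
      (bif decide ((Nat.pair x s).unpair.1 < len E (Nat.pair x s).unpair.2) then 0 else 1) = 0) ↔
      (x < len E s ∧ ∀ e ≤ x, mk E s e ∉ Bset E) := by
    intro x s
    simp only [Nat.unpair_pair, Nat.add_eq_zero_iff, Finset.sum_eq_zero_iff, Finset.mem_range]
    rw [and_comm]
    refine and_congr ?_ (forall_congr' fun e => ?_)
    · by_cases h : x < len E s <;> simp [h]
    · rw [Nat.lt_succ_iff]
      by_cases h : mk E s e ∈ Bset E <;> simp [h]
  have hex : ∀ x, ∃ s, ((∑ e ∈ Finset.range ((Nat.pair x s).unpair.1 + 1),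
      if mk E (Nat.pair x s).unpair.2 e ∈ Bset E then 1 else 0) +
      (bif decide ((Nat.pair x s).unpair.1 < len E (Nat.pair x s).unpair.2) then 0 else 1) = 0) := by
    intro x
    obtain ⟨s, hs⟩ := stable_ex hU ok pr fo hA x
    exact ⟨s, (key x s).2 hs⟩
  have h5 := h4.find hex
  have h6 : TotIn (chi (Bset E)) (fun q => bif (lev E q.unpair.2 q.unpair.1).2.2.2.1 then 1 else 0) :=
    TotIn.of_comp (p_cond (p_fst (p_snd (p_snd (p_snd (p_lev pr u2 u1)))))
      (Primrec.const 1) (Primrec.const 0)).to_comp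
  have h7 := h6.comp ((TotIn.of_comp Computable.id).pair h5)
  refine RecursiveIn.of_eq h7 fun x => ?_
  unfold chi
  congr 1
  have hs := (key x _).1 (Nat.find_spec (hex x))
  simp only [stable_correct ok fo hs.1 hs.2, Nat.unpair_pair, id]
  rw [Bool.cond_eq_ite]

theorem main_aux (hU : OptimalPF U)
    (k : ℕ) (A : Fin k → Set ℕ) (hA : ∀ i, CESet (A i))
    (hAnt : ∀ i, ¬ KTrivialSet U (A i)) :
    ∃ B : Set ℕ, CESet B ∧ TuringEquivSet B haltingSet ∧
      ∀ i, KLtSet U B (A i) := by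
  obtain ⟨E, W, hk, ok, pr, fo⟩ := exists_env hU.1 A hA
  subst hk
  have hA' : ∀ i < E.k, ¬ KTrivialSet U ((fun i => if h : i < E.k then A ⟨i, h⟩ else ∅) i) := by
    intro i hi
    simp only [dif_pos hi]
    exact hAnt _
  refine ⟨Bset E, Bset_ce pr, ⟨ce_le_halting (Bset_ce pr), halting_le hU ok pr fo hA'⟩, fun i => ?_⟩
  have h1 := B_le hU ok pr fo i.2
  have h2 := not_le hU ok pr fo hA' i.2
  simp only [dif_pos i.2] at h1 h2
  exact ⟨h1, h2⟩

end

/-- For any finite collection `A_0, …, A_{k-1}` of c.e. sets, none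
`K`-trivial, there is a c.e. set `B` with `B ≡_T ∅'` and `B <_K A_i` for all `i < k`. -/
theorem stmt2 (U : Str →. Str) (hU : OptimalPF U)
    (k : ℕ) (A : Fin k → Set ℕ) (hA : ∀ i, CESet (A i))
    (hAnt : ∀ i, ¬ KTrivialSet U (A i)) :
    ∃ B : Set ℕ, CESet B ∧ TuringEquivSet B haltingSet ∧
      ∀ i, KLtSet U B (A i) := by
  exact main_aux hU k A hA hAnt

end KPaper
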